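/- There exists a constant ε > 0 such that ε(Aₙ) ≥ ε for all alternating groups Aₙ with n ≥ 5. -/

import Mathlib

open scoped Classical

/-- The set of irreducible complex characters of a group `G`. -/
noncomputable def IrrChar (G : Type) [Monoid G] : Set (G → ℂ) :=
  {f | ∃ V : FDRep ℂ G, CategoryTheory.Simple V ∧ f = FDRep.character V}

/-- The largest degree of a complex irreducible representation of `G`. -/
noncomputable def maxIrrDeg (G : Type) [Monoid G] : ℕ :=
  sSup {d : ℕ | ∃ V : FDRep ℂ G, CategoryTheory.Simple V ∧ Module.finrank ℂ V = d}

/-- `ε(G)`: ratio of the sum of squares of the degrees of the irreducible characters of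
degree less than the largest degree, to the square of the largest degree. -/
noncomputable def epsG (G : Type) [Monoid G] : ℝ :=
  (∑ᶠ f ∈ {f ∈ IrrChar G | (f 1).re < (maxIrrDeg G : ℝ)}, (f 1).re ^ 2) /
    ((maxIrrDeg G : ℝ)) ^ 2

section
namespace TD

/-- Local self-dual axioms for a pair of cover maps. -/
structure Loc {P : Type} (D U : P → Finset P) : Prop where
  mem : ∀ x y, x ∈ D y ↔ y ∈ U x
  uD : ∀ {x y a b}, x ≠ y → a ∈ D x → a ∈ D y → b ∈ D x → b ∈ D y → a = b
  uU : ∀ {x y a b}, x ≠ y → a ∈ U x → a ∈ U y → b ∈ U x → b ∈ U y → a = b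
  jn : ∀ {x y z}, x ≠ y → z ∈ D x → z ∈ D y → ∃ w, w ∈ U x ∧ w ∈ U y
  mt : ∀ {x y z}, x ≠ y → z ∈ U x → z ∈ U y → ∃ w, w ∈ D x ∧ w ∈ D y
  thin : ∀ {x z a b c}, a ∈ U x → a ∈ D z → b ∈ U x → b ∈ D z → c ∈ U x → c ∈ D z →
    a = b ∨ a = c ∨ b = c

variable {P : Type} {D U : P → Finset P}

theorem Loc.dual (h : Loc D U) : Loc U D where
  mem := fun x y => (h.mem y x).symm
  uD := h.uU
  uU := h.uD
  jn := h.mt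
  mt := h.jn
  thin := fun a b c d e f => h.thin b a d c f e

/-- The interval from `x` to `z` has at most one middle element. -/
def Ch (D U : P → Finset P) (x z : P) : Prop :=
  ∀ a b, a ∈ U x → a ∈ D z → b ∈ U x → b ∈ D z → a = b

theorem Ch_dual (x z : P) : Ch U D z x ↔ Ch D U x z :=
  ⟨fun h a b h1 h2 h3 h4 => h a b h2 h1 h4 h3, fun h a b h1 h2 h3 h4 => h a b h2 h1 h4 h3⟩

/-- Given a middle element and a non-chain there is another middle element. -/
theorem other {x z a : P} (h : ¬ Ch D U x z) (ha : a ∈ U x) (ha' : a ∈ D z) :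
    ∃ b, b ∈ U x ∧ b ∈ D z ∧ b ≠ a := by
  unfold Ch at h
  push Not at h
  obtain ⟨p, q, h1, h2, h3, h4, h5⟩ := h
  by_cases hp : p = a
  · exact ⟨q, h3, h4, fun e => h5 (hp.trans e.symm)⟩
  · exact ⟨p, h1, h2, hp⟩

/-- Number of lower covers of `x` which form a chain with top `a`. -/
noncomputable def tt (D U : P → Finset P) (x a : P) : ℕ :=
  ((D x).filter (fun w => Ch D U w a)).card

theorem Loc.cnt (h : Loc D U) {x a : P} (hx : x ∈ D a) :
    tt D U x a + (D a).card = (D x).card + 1 := by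
  have hax : a ∈ U x := (h.mem _ _).1 hx
  have key : ((D a).erase x).card = ((D x).filter (fun w => ¬ Ch D U w a)).card := by
    have hm : ∀ y ∈ (D a).erase x, ∃ w, w ∈ D x ∧ w ∈ D y := by
      intro y hy
      rw [Finset.mem_erase] at hy
      exact h.mt hy.1.symm hax ((h.mem _ _).1 hy.2)
    choose! g hg using hm
    apply Finset.card_bij (fun y _ => g y)
    · intro y hy
      have := hg y hy
      rw [Finset.mem_erase] at hy
      rw [Finset.mem_filter]
      refine ⟨this.1, fun hc => hy.1 ?_⟩
      exact hc y x ((h.mem _ _).1 this.2) hy.2 ((h.mem _ _).1 this.1) hx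
    · intro y hy y' hy' e
      have h1 := hg y hy
      have h2 := hg y' hy'
      rw [← e] at h2
      rw [Finset.mem_erase] at hy hy'
      rcases h.thin ((h.mem _ _).1 h1.2) hy.2 ((h.mem _ _).1 h2.2) hy'.2 ((h.mem _ _).1 h1.1) hx
        with e | e | e
      · exact e
      · exact absurd e hy.1
      · exact absurd e hy'.1
    · intro w hw
      rw [Finset.mem_filter] at hw
      obtain ⟨b, hb1, hb2, hb3⟩ := other hw.2 ((h.mem _ _).1 hw.1) hx
      have hbm : b ∈ (D a).erase x := Finset.mem_erase.2 ⟨hb3, hb2⟩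
      refine ⟨b, hbm, ?_⟩
      have := hg b hbm
      exact h.uD hb3 this.2 this.1 ((h.mem _ _).2 hb1) hw.1
  have h2 := Finset.card_filter_add_card_filter_not (s := D x) (fun w => Ch D U w a)
  have h3 := Finset.card_erase_add_one hx
  unfold tt
  omega

/-- Up-cube property at `k`. -/
def UC (D U : P → Finset P) (k : P) : Prop :=
  ∀ n1 n2 n3 l12 l13 l23, n1 ∈ U k → n2 ∈ U k → n3 ∈ U k → n1 ≠ n2 → n1 ≠ n3 → n2 ≠ n3 →
    l12 ∈ U n1 → l12 ∈ U n2 → l13 ∈ U n1 → l13 ∈ U n3 → l23 ∈ U n2 → l23 ∈ U n3 →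
    ∃ m, m ∈ U l12 ∧ m ∈ U l13 ∧ m ∈ U l23

/-- Number of common chain bottoms. -/
noncomputable def ee (D U : P → Finset P) (k a b : P) : ℕ :=
  ((D k).filter (fun w => Ch D U w a ∧ Ch D U w b)).card

theorem Loc.G1 (h : Loc D U) {k n n' l : P} (hk : k ∈ D n) (hk' : k ∈ D n') (hnn : n ≠ n')
    (hn : n ∈ D l) (hn' : n' ∈ D l) (dc : UC U D l) :
    tt D U k n ≤ tt D U n' l + ee D U k n n' := by
  have hsplit : (D k).filter (fun w => Ch D U w n) =
      (D k).filter (fun w => Ch D U w n ∧ Ch D U w n') ∪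
      (D k).filter (fun w => Ch D U w n ∧ ¬ Ch D U w n') := by
    ext w; simp only [Finset.mem_filter, Finset.mem_union]; tauto
  have hle : ((D k).filter (fun w => Ch D U w n ∧ ¬ Ch D U w n')).card ≤ tt D U n' l := by
    have hm : ∀ w ∈ (D k).filter (fun w => Ch D U w n ∧ ¬ Ch D U w n'),
        ∃ b, b ∈ U w ∧ b ∈ D n' ∧ b ≠ k := by
      intro w hw
      rw [Finset.mem_filter] at hw
      exact other hw.2.2 ((h.mem _ _).1 hw.1) hk'
    choose! g hg using hm
    apply Finset.card_le_card_of_injOn g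
    · intro w hw
      have hgw := hg w hw
      simp only [Finset.coe_filter, Set.mem_setOf_eq] at hw
      simp only [Finset.coe_filter, Set.mem_setOf_eq]
      refine ⟨hgw.2.1, ?_⟩
      by_contra hc
      obtain ⟨c, hc1, hc2, hc3⟩ := other hc ((h.mem _ _).1 hgw.2.1) hn'
      have hcn : c ≠ n := by
        rintro rfl
        exact hgw.2.2 (h.uD hnn ((h.mem _ _).2 hc1) hgw.2.1 hk hk')
      obtain ⟨o, ho1, ho2⟩ := h.mt hcn ((h.mem _ _).1 hc2) ((h.mem _ _).1 hn)
      obtain ⟨w', hw1, hw2, hw3⟩ := dc n n' c k o (g w) hn hn' hc2 hnn hcn.symm hc3.symm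
        hk hk' ho2 ho1 hgw.2.1 ((h.mem _ _).2 hc1)
      have hww : w' = w := h.uD hgw.2.2 hw3 hw1 ((h.mem _ _).2 hgw.1) hw.1
      subst hww
      have hok : o = k := hw.2.1 o k ((h.mem _ _).1 hw2) ho2 ((h.mem _ _).1 hw.1) hk
      subst hok
      exact hgw.2.2 (h.uD hc3.symm hgw.2.1 ((h.mem _ _).2 hc1) hk' ho1)
    · intro w hw w' hw' e
      have h1 := hg w hw
      have h2 := hg w' hw'
      rw [← e] at h2
      simp only [Finset.coe_filter, Set.mem_setOf_eq] at hw hw'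
      exact h.uD h1.2.2 ((h.mem _ _).2 h1.1) hw.1 ((h.mem _ _).2 h2.1) hw'.1
  have := Finset.card_union_le ((D k).filter (fun w => Ch D U w n ∧ Ch D U w n'))
    ((D k).filter (fun w => Ch D U w n ∧ ¬ Ch D U w n'))
  rw [← hsplit] at this
  unfold ee
  unfold tt at *
  omega

end TD
end

section
namespace TD
variable {P : Type} {D U : P → Finset P}

theorem Loc.col (h : Loc D U) (hU : ∀ x, (U x).card = (D x).card + 1)
    {k n n' l : P} (hk : k ∈ D n) (hk' : k ∈ D n') (hnn : n ≠ n')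
    (hn : n ∈ D l) (hn' : n' ∈ D l) (dc : ∀ m ∈ U l, UC U D m) :
    tt D U n' l + ee U D l n n' + (((U k).erase n).erase n').card ≤ tt D U k n +
      ((((U k).erase n).erase n').filter (fun x => ∃ m a b, m ∈ U l ∧ m ∈ U a ∧ m ∈ U b ∧
        a ∈ U n ∧ a ∈ U x ∧ b ∈ U n' ∧ b ∈ U x)).card := by
  have hX : ((U l).filter (fun m => ¬ Ch D U n m ∧ ¬ Ch D U n' m)).card ≤
      ((((U k).erase n).erase n').filter (fun x => ∃ m a b, m ∈ U l ∧ m ∈ U a ∧ m ∈ U b ∧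
        a ∈ U n ∧ a ∈ U x ∧ b ∈ U n' ∧ b ∈ U x)).card := by
    have hm : ∀ m ∈ (U l).filter (fun m => ¬ Ch D U n m ∧ ¬ Ch D U n' m),
        ∃ x a b, m ∈ U a ∧ m ∈ U b ∧ a ∈ U n ∧ a ∈ U x ∧ b ∈ U n' ∧ b ∈ U x ∧ x ∈ U k ∧
          x ≠ n ∧ x ≠ n' ∧ a ≠ l := by
      intro m hm
      rw [Finset.mem_filter] at hm
      have hlm : l ∈ D m := (h.mem _ _).2 hm.1
      obtain ⟨a, ha1, ha2, ha3⟩ := other hm.2.1 ((h.mem _ _).1 hn) hlm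
      obtain ⟨b, hb1, hb2, hb3⟩ := other hm.2.2 ((h.mem _ _).1 hn') hlm
      have hab : a ≠ b := by
        rintro rfl
        exact hnn (h.uD ha3 ((h.mem _ _).2 ha1) hn ((h.mem _ _).2 hb1) hn')
      obtain ⟨x, hx1, hx2⟩ := h.mt hab ((h.mem _ _).1 ha2) ((h.mem _ _).1 hb2)
      have hxn : x ≠ n := by
        rintro rfl
        rcases h.thin ha1 ha2 ((h.mem _ _).1 hx2) hb2 ((h.mem _ _).1 hn) hlm with e | e | e
        · exact hab e
        · exact ha3 e
        · exact hb3 e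
      have hxn' : x ≠ n' := by
        rintro rfl
        rcases h.thin ((h.mem _ _).1 hx1) ha2 hb1 hb2 ((h.mem _ _).1 hn') hlm with e | e | e
        · exact hab e
        · exact ha3 e
        · exact hb3 e
      obtain ⟨w, hw1, hw2, hw3⟩ := dc m hm.1 l a b n n' x hlm ha2 hb2 ha3.symm hb3.symm hab
        hn ((h.mem _ _).2 ha1) hn' ((h.mem _ _).2 hb1) hx1 hx2
      have hwk : w = k := h.uD hnn hw1 hw2 hk hk'
      subst hwk
      exact ⟨x, a, b, (h.mem _ _).1 ha2, (h.mem _ _).1 hb2, ha1, (h.mem _ _).1 hx1, hb1,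
        (h.mem _ _).1 hx2, (h.mem _ _).1 hw3, hxn, hxn', ha3⟩
    choose! g ga gb hg using hm
    apply Finset.card_le_card_of_injOn g
    · intro m hm
      obtain ⟨h1, h2, h3, h4, h5, h6, h7, h8, h9, h10⟩ := hg m hm
      have hm' := (Finset.mem_filter.1 (Finset.mem_coe.1 hm)).1
      simp only [Finset.mem_coe, Finset.mem_filter, Finset.mem_erase]
      exact ⟨⟨h9, h8, h7⟩, m, ga m, gb m, hm', h1, h2, h3, h4, h5, h6⟩
    · intro m hm m' hm' e
      obtain ⟨h1, h2, h3, h4, h5, h6, h7, h8, h9, h10⟩ := hg m hm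
      obtain ⟨i1, i2, i3, i4, i5, i6, i7, i8, i9, i10⟩ := hg m' hm'
      have hm1 := (Finset.mem_filter.1 (Finset.mem_coe.1 hm)).1
      have hm2 := (Finset.mem_filter.1 (Finset.mem_coe.1 hm')).1
      rw [← e] at i4
      have haa : ga m = ga m' := h.uU h8 h4 h3 i4 i3
      rw [← haa] at i1
      exact h.uU h10 h1 hm1 i1 hm2
  have e1 := h.dual.cnt (x := l) (a := n) ((h.mem _ _).1 hn)
  have e2 := h.dual.cnt (x := l) (a := n') ((h.mem _ _).1 hn')
  have e3 := h.cnt hk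
  have e4 := h.cnt hn'
  have e5 := Finset.card_filter_add_card_filter_not (s := U l)
    (fun m => Ch U D m n ∨ Ch U D m n')
  have e6 : ((U l).filter (fun m => Ch U D m n ∨ Ch U D m n')).card + ee U D l n n' =
      tt U D l n + tt U D l n' := by
    unfold ee tt
    rw [Finset.filter_or, Finset.filter_and]
    exact Finset.card_union_add_card_inter _ _
  have e7 : (U l).filter (fun m => ¬ (Ch U D m n ∨ Ch U D m n')) =
      (U l).filter (fun m => ¬ Ch D U n m ∧ ¬ Ch D U n' m) := by
    apply Finset.filter_congr
    intro m _
    rw [Ch_dual (D := D) (U := U) n m, Ch_dual (D := D) (U := U) n' m, not_or]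
  rw [e7] at e5
  have e8 : (((U k).erase n).erase n').card + 2 = (U k).card := by
    have a1 : n ∈ U k := (h.mem _ _).1 hk
    have a2 : n' ∈ (U k).erase n := Finset.mem_erase.2 ⟨hnn.symm, (h.mem _ _).1 hk'⟩
    have := Finset.card_erase_add_one a1
    have := Finset.card_erase_add_one a2
    omega
  have u1 := hU k
  have u2 := hU n
  have u3 := hU n'
  have u4 := hU l
  omega

theorem Loc.col_le (h : Loc D U) (hU : ∀ x, (U x).card = (D x).card + 1)
    {k n n' l : P} (hk : k ∈ D n) (hk' : k ∈ D n') (hnn : n ≠ n')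
    (hn : n ∈ D l) (hn' : n' ∈ D l) (dc : ∀ m ∈ U l, UC U D m) :
    tt D U n' l + ee U D l n n' ≤ tt D U k n := by
  have h1 := h.col hU hk hk' hnn hn hn' dc
  have h2 := Finset.card_filter_le (((U k).erase n).erase n')
    (fun x => ∃ m a b, m ∈ U l ∧ m ∈ U a ∧ m ∈ U b ∧
        a ∈ U n ∧ a ∈ U x ∧ b ∈ U n' ∧ b ∈ U x)
  omega

/-- `q ≤ e`. -/
theorem Loc.q_le_e (h : Loc D U) (hU : ∀ x, (U x).card = (D x).card + 1)
    {k n n' l : P} (hk : k ∈ D n) (hk' : k ∈ D n') (hnn : n ≠ n')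
    (hn : n ∈ D l) (hn' : n' ∈ D l) (dc0 : UC U D l) (dc : ∀ m ∈ U l, UC U D m) :
    ee U D l n n' ≤ ee D U k n n' := by
  have h1 := h.col_le hU hk hk' hnn hn hn' dc
  have h2 := h.G1 hk hk' hnn hn hn' dc0
  omega

/-- A failing cube forces `e` positive. -/
theorem Loc.bad_e (h : Loc D U) (hU : ∀ x, (U x).card = (D x).card + 1)
    {k n n' l x a b : P} (hk : k ∈ D n) (hk' : k ∈ D n') (hnn : n ≠ n')
    (hn : n ∈ D l) (hn' : n' ∈ D l) (dc0 : UC U D l) (dc : ∀ m ∈ U l, UC U D m)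
    (hx : x ∈ U k) (hxn : x ≠ n) (hxn' : x ≠ n')
    (ha : a ∈ U n) (ha' : a ∈ U x) (hb : b ∈ U n') (hb' : b ∈ U x)
    (hbad : ¬ ∃ m, m ∈ U l ∧ m ∈ U a ∧ m ∈ U b) :
    ∃ w, w ∈ D k ∧ Ch D U w n ∧ Ch D U w n' := by
  have h1 := h.col hU hk hk' hnn hn hn' dc
  have h2 := h.G1 hk hk' hnn hn hn' dc0
  have h3 : ((((U k).erase n).erase n').filter (fun x => ∃ m a b, m ∈ U l ∧ m ∈ U a ∧ m ∈ U b ∧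
        a ∈ U n ∧ a ∈ U x ∧ b ∈ U n' ∧ b ∈ U x)).card < (((U k).erase n).erase n').card := by
    apply Finset.card_lt_card
    rw [Finset.filter_ssubset]
    refine ⟨x, Finset.mem_erase.2 ⟨hxn', Finset.mem_erase.2 ⟨hxn, hx⟩⟩, ?_⟩
    rintro ⟨m, a', b', h1, h2, h3, h4, h5, h6, h7⟩
    have e1 : a' = a := h.uU hxn h5 h4 ha' ha
    have e2 : b' = b := h.uU hxn' h7 h6 hb' hb
    subst e1 e2
    exact hbad ⟨m, h1, h2, h3⟩
  have h4 : 0 < ee D U k n n' := by omega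
  obtain ⟨w, hw⟩ := Finset.card_pos.1 h4
  exact ⟨w, by simpa using hw⟩

end TD
end

section
namespace TD
variable {P : Type} {D U : P → Finset P}

/-- Axioms of a thin differential poset. -/
structure Ax (D U : P → Finset P) (rk : P → ℕ) : Prop where
  mem : ∀ x y, x ∈ D y ↔ y ∈ U x
  rk : ∀ {x y}, x ∈ D y → rk y = rk x + 1
  hU : ∀ x, (U x).card = (D x).card + 1
  com : ∀ x y, x ≠ y → (U x ∩ U y).card = (D x ∩ D y).card
  thin : ∀ x z, (U x ∩ D z).card ≤ 2

variable {rk : P → ℕ}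

theorem Ax.loc (h : Ax D U rk) : Loc D U := by
  have uD : ∀ n x y a b, rk x ≤ n → x ≠ y → a ∈ D x → a ∈ D y → b ∈ D x → b ∈ D y → a = b := by
    intro n
    induction n with
    | zero =>
      intro x y a b hr _ ha
      have := h.rk ha
      omega
    | succ n ih =>
      intro x y a b hr hxy ha ha' hb hb'
      by_contra hab
      have h1 : 1 < (U a ∩ U b).card := Finset.one_lt_card.2
        ⟨x, by simp [← h.mem, ha, hb], y, by simp [← h.mem, ha', hb'], hxy⟩
      rw [h.com a b hab, Finset.one_lt_card] at h1
      obtain ⟨c, hc, d, hd, hcd⟩ := h1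
      rw [Finset.mem_inter] at hc hd
      have := h.rk ha
      exact hcd (ih a b c d (by omega) hab hc.1 hc.2 hd.1 hd.2)
  have uD' : ∀ {x y a b}, x ≠ y → a ∈ D x → a ∈ D y → b ∈ D x → b ∈ D y → a = b :=
    fun {x y a b} => uD _ x y a b le_rfl
  refine ⟨h.mem, uD', ?_, ?_, ?_, ?_⟩
  · intro x y a b hxy ha ha' hb hb'
    by_contra hab
    have h1 : 1 < (U x ∩ U y).card := Finset.one_lt_card.2
        ⟨a, by simp [ha, ha'], b, by simp [hb, hb'], hab⟩
    rw [h.com x y hxy, Finset.one_lt_card] at h1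
    obtain ⟨c, hc, d, hd, hcd⟩ := h1
    rw [Finset.mem_inter] at hc hd
    exact hcd (uD' hxy hc.1 hc.2 hd.1 hd.2)
  · intro x y z hxy hx hy
    have h1 : 0 < (D x ∩ D y).card := Finset.card_pos.2 ⟨z, by simp [hx, hy]⟩
    rw [← h.com x y hxy, Finset.card_pos] at h1
    obtain ⟨w, hw⟩ := h1
    exact ⟨w, Finset.mem_inter.1 hw⟩
  · intro x y z hxy hx hy
    have h1 : 0 < (U x ∩ U y).card := Finset.card_pos.2 ⟨z, by simp [hx, hy]⟩
    rw [h.com x y hxy, Finset.card_pos] at h1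
    obtain ⟨w, hw⟩ := h1
    exact ⟨w, Finset.mem_inter.1 hw⟩
  · intro x z a b c h1 h2 h3 h4 h5 h6
    by_contra hc
    push Not at hc
    have : 2 < (U x ∩ D z).card := Finset.two_lt_card.2
      ⟨a, by simp [*], b, by simp [*], c, by simp [*], hc.1, hc.2.1, hc.2.2⟩
    have := h.thin x z
    omega

/-- `s + t = 2`. -/
theorem Ax.st (h : Ax D U rk) {x a : P} (hx : x ∈ D a) : tt U D a x + tt D U x a = 2 := by
  have e1 := h.loc.dual.cnt (x := a) (a := x) ((h.mem _ _).1 hx)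
  have e2 := h.loc.cnt hx
  have := h.hU x
  have := h.hU a
  omega

theorem Ax.no3 (h : Ax D U rk) {x k a b c : P} (hx : x ∈ D k) (ha : a ∈ U k) (hb : b ∈ U k)
    (hc : c ∈ U k) (ha' : Ch D U x a) (hb' : Ch D U x b) (hc' : Ch D U x c) :
    a = b ∨ a = c ∨ b = c := by
  by_contra hh
  push Not at hh
  have : 2 < tt U D k x := Finset.two_lt_card.2
      ⟨a, by simp [*, Ch_dual (D := D) (U := U)], b, by simp [*, Ch_dual (D := D) (U := U)],
        c, by simp [*, Ch_dual (D := D) (U := U)], hh.1, hh.2.1, hh.2.2⟩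
  have := h.st hx
  omega

/-- Triangle property at rank `n`. -/
def Tn (D U : P → Finset P) (rk : P → ℕ) (n : ℕ) : Prop :=
  ∀ a b c ab ac bc, rk a = n → a ≠ b → a ≠ c → b ≠ c → ab ∈ D a → ab ∈ D b → ac ∈ D a → ac ∈ D c →
    bc ∈ D b → bc ∈ D c →
    (ab = ac ∧ ab = bc) ∨ (∃ m, m ∈ U a ∧ m ∈ U b ∧ m ∈ U c)

theorem Ax.T_of (h : Ax D U rk) (K : ℕ) (uc : ∀ k, rk k < K → UC D U k) :
    ∀ n, n ≤ K + 1 → Tn D U rk n := by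
  have L := h.loc
  intro n
  induction n with
  | zero =>
    intro _ a b c ab ac bc hr _ _ _ h1
    have := h.rk h1
    omega
  | succ n ih =>
    intro hn a b c ab ac bc hr hab hac hbc h1 h2 h3 h4 h5 h6
    by_cases e1 : ab = ac
    · subst e1
      exact Or.inl ⟨rfl, L.uD hbc h2 h4 h5 h6⟩
    by_cases e2 : ab = bc
    · subst e2
      exact absurd (L.uD hac h1 h6 h3 h4) e1
    by_cases e3 : ac = bc
    · subst e3
      exact absurd (L.uD hab h1 h2 h3 h5) e1
    right
    have mm := h.mem
    obtain ⟨p, hp1, hp2⟩ := L.mt e1 ((mm _ _).1 h1) ((mm _ _).1 h3)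
    obtain ⟨q, hq1, hq2⟩ := L.mt e2 ((mm _ _).1 h2) ((mm _ _).1 h5)
    obtain ⟨r, hr1, hr2⟩ := L.mt e3 ((mm _ _).1 h4) ((mm _ _).1 h6)
    have hrk := h.rk h1
    rcases ih (by omega) ab ac bc p q r (by omega) e1 e2 e3 hp1 hp2 hq1 hq2 hr1 hr2
      with ⟨g1, g2⟩ | ⟨m, m1, m2, m3⟩
    · subst g1 g2
      have hrp := h.rk hp1
      exact uc p (by omega) ab ac bc a b c ((mm _ _).1 hp1) ((mm _ _).1 hp2) ((mm _ _).1 hq2)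
        e1 e2 e3 ((mm _ _).1 h1) ((mm _ _).1 h3) ((mm _ _).1 h2) ((mm _ _).1 h5)
        ((mm _ _).1 h4) ((mm _ _).1 h6)
    · exfalso
      have i1 : m = a := L.uU e1 m1 m2 ((mm _ _).1 h1) ((mm _ _).1 h3)
      have i2 : m = b := L.uU e2 m1 m3 ((mm _ _).1 h2) ((mm _ _).1 h5)
      exact hab (i1.symm.trans i2)

theorem Ax.DC_of (h : Ax D U rk) (K : ℕ) (uc : ∀ k, rk k < K → UC D U k) (m : P)
    (hm : rk m ≤ K + 3) : UC U D m := by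
  have L := h.loc
  have mm := h.mem
  intro n1 n2 n3 l12 l13 l23 h1 h2 h3 d12 d13 d23 a1 a2 a3 a4 a5 a6
  have e1 : l12 ≠ l13 := by
    rintro rfl
    rcases L.thin ((mm _ _).1 a1) h1 ((mm _ _).1 a2) h2 ((mm _ _).1 a4) h3 with e | e | e
    exacts [d12 e, d13 e, d23 e]
  have e2 : l12 ≠ l23 := by
    rintro rfl
    rcases L.thin ((mm _ _).1 a1) h1 ((mm _ _).1 a2) h2 ((mm _ _).1 a6) h3 with e | e | e
    exacts [d12 e, d13 e, d23 e]
  have e3 : l13 ≠ l23 := by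
    rintro rfl
    rcases L.thin ((mm _ _).1 a3) h1 ((mm _ _).1 a5) h2 ((mm _ _).1 a6) h3 with e | e | e
    exacts [d12 e, d13 e, d23 e]
  obtain ⟨p, hp1, hp2⟩ := L.mt e1 ((mm _ _).1 a1) ((mm _ _).1 a3)
  obtain ⟨q, hq1, hq2⟩ := L.mt e2 ((mm _ _).1 a2) ((mm _ _).1 a5)
  obtain ⟨r, hr1, hr2⟩ := L.mt e3 ((mm _ _).1 a4) ((mm _ _).1 a6)
  have r1 := h.rk h1
  have r2 := h.rk a1
  rcases h.T_of K uc (rk l12) (by omega) l12 l13 l23 p q r rfl e1 e2 e3 hp1 hp2 hq1 hq2 hr1 hr2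
      with ⟨g1, g2⟩ | ⟨m, m1, m2, m3⟩
  · subst g1 g2
    exact ⟨p, hp1, hp2, hq2⟩
  · exfalso
    have i1 : m = n1 := L.uU e1 m1 m2 ((mm _ _).1 a1) ((mm _ _).1 a3)
    have i2 : m = n2 := L.uU e2 m1 m3 ((mm _ _).1 a2) ((mm _ _).1 a5)
    exact d12 (i1.symm.trans i2)

theorem Ax.hex1 (h : Ax D U rk) {k t t' p n al : P} (uc : UC D U p)
    (ht : t ∈ D k) (ht' : t' ∈ D k) (htt : t ≠ t') (hn : n ∈ U k)
    (hal : al ∈ U t) (hal' : al ∈ D n) (halk : al ≠ k) (hc : Ch D U t' n)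
    (hp : p ∈ D t) (hp' : p ∈ D t') : Ch D U p al := by
  have L := h.loc
  have mm := h.mem
  by_contra hcon
  obtain ⟨o, o1, o2, o3⟩ := other hcon ((mm _ _).1 hp) ((mm _ _).2 hal)
  have hot : o ≠ t' := by
    rintro rfl
    exact o3 (L.uD halk o2 ht' ((mm _ _).2 hal) ht)
  obtain ⟨q, q1, q2⟩ := L.jn hot ((mm _ _).2 o1) hp'
  obtain ⟨m, m1, m2, m3⟩ := uc t t' o k al q ((mm _ _).1 hp) ((mm _ _).1 hp') o1 htt o3.symm
    hot.symm ((mm _ _).1 ht) ((mm _ _).1 ht') hal ((mm _ _).1 o2) q2 q1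
  have hmn : m = n := L.uU halk m2 m1 ((mm _ _).1 hal') hn
  subst hmn
  have hqk : q = k := hc q k q2 ((mm _ _).2 m3) ((mm _ _).1 ht') ((mm _ _).2 hn)
  subst hqk
  exact o3 (L.uD halk o2 ((mm _ _).2 q1) ((mm _ _).2 hal) ht)

theorem Ax.hex2 (h : Ax D U rk) {k t t' t'' p p' s n : P} (uc : UC D U p) (uc' : UC D U p')
    (dc0 : UC U D t) (dc : ∀ m ∈ U t, UC U D m)
    (ht : t ∈ D k) (ht' : t' ∈ D k) (ht'' : t'' ∈ D k) (htt : t ≠ t') (htt' : t ≠ t'')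
    (hn : n ∈ U k) (hnc : ¬ Ch D U t n) (hc : Ch D U t' n) (hc' : Ch D U t'' n)
    (hp : p ∈ D t) (hp' : p ∈ D t') (hq : p' ∈ D t) (hq' : p' ∈ D t'') (hpp : p ≠ p')
    (hs : s ∈ D p) (hs' : s ∈ D p') : ∃ w, w ∈ D s ∧ Ch D U w p ∧ Ch D U w p' := by
  have L := h.loc
  have mm := h.mem
  obtain ⟨al, a1, a2, a3⟩ := other hnc ((mm _ _).1 ht) ((mm _ _).2 hn)
  have c1 := h.hex1 uc ht ht' htt hn a1 a2 a3 hc hp hp'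
  have c2 := h.hex1 uc' ht ht'' htt' hn a1 a2 a3 hc' hq hq'
  have h1 := L.q_le_e h.hU hs hs' hpp hp hq dc0 dc
  have h2 : 0 < ee U D t p p' := Finset.card_pos.2
    ⟨al, by simp [Ch_dual (D := D) (U := U), a1, c1, c2]⟩
  obtain ⟨w, hw⟩ := Finset.card_pos.1 (lt_of_lt_of_le h2 h1)
  exact ⟨w, by simpa using hw⟩

theorem Ax.noHex (h : Ax D U rk) (K : ℕ) (uc : ∀ k, rk k < K → UC D U k) :
    ∀ r k, rk k ≤ r → r ≤ K → ∀ n1 n2 n3 t12 t13 t23, n1 ∈ U k → n2 ∈ U k → n3 ∈ U k →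
      n1 ≠ n2 → n1 ≠ n3 → n2 ≠ n3 → t12 ∈ D k → t13 ∈ D k → t23 ∈ D k →
      Ch D U t12 n1 → Ch D U t12 n2 → Ch D U t13 n1 → Ch D U t13 n3 →
      Ch D U t23 n2 → Ch D U t23 n3 → False := by
  have L := h.loc
  have mm := h.mem
  intro r
  induction r with
  | zero =>
    intro k hk _ n1 n2 n3 t12 t13 t23 _ _ _ _ _ _ h1
    have := h.rk h1
    omega
  | succ r ih =>
    intro k hk hK n1 n2 n3 t12 t13 t23 u1 u2 u3 d12 d13 d23 v12 v13 v23 c1 c2 c3 c4 c5 c6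
    have nc1 : ¬ Ch D U t12 n3 := by
      intro hc
      rcases h.no3 v12 u1 u2 u3 c1 c2 hc with e | e | e
      exacts [d12 e, d13 e, d23 e]
    have nc2 : ¬ Ch D U t13 n2 := by
      intro hc
      rcases h.no3 v13 u1 u2 u3 c3 hc c4 with e | e | e
      exacts [d12 e, d13 e, d23 e]
    have nc3 : ¬ Ch D U t23 n1 := by
      intro hc
      rcases h.no3 v23 u1 u2 u3 hc c5 c6 with e | e | e
      exacts [d12 e, d13 e, d23 e]
    have e1 : t12 ≠ t13 := by rintro rfl; exact nc1 c4
    have e2 : t12 ≠ t23 := by rintro rfl; exact nc1 c6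
    have e3 : t13 ≠ t23 := by rintro rfl; exact nc2 c5
    obtain ⟨p1, hp1, hp1'⟩ := L.mt e1 ((mm _ _).1 v12) ((mm _ _).1 v13)
    obtain ⟨p2, hp2, hp2'⟩ := L.mt e2 ((mm _ _).1 v12) ((mm _ _).1 v23)
    obtain ⟨p3, hp3, hp3'⟩ := L.mt e3 ((mm _ _).1 v13) ((mm _ _).1 v23)
    have f1 : p1 ≠ p2 := by
      rintro rfl
      rcases L.thin ((mm _ _).1 hp1) v12 ((mm _ _).1 hp1') v13 ((mm _ _).1 hp2') v23 with e | e | e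
      exacts [e1 e, e2 e, e3 e]
    have f2 : p1 ≠ p3 := by
      rintro rfl
      rcases L.thin ((mm _ _).1 hp1) v12 ((mm _ _).1 hp1') v13 ((mm _ _).1 hp3') v23 with e | e | e
      exacts [e1 e, e2 e, e3 e]
    have f3 : p2 ≠ p3 := by
      rintro rfl
      rcases L.thin ((mm _ _).1 hp2) v12 ((mm _ _).1 hp3) v13 ((mm _ _).1 hp3') v23 with e | e | e
      exacts [e1 e, e2 e, e3 e]
    have r0 := h.rk v12
    have r1 := h.rk hp1
    have r2 := h.rk hp2
    have r3 := h.rk hp3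
    have r4 := h.rk v13
    have r5 := h.rk v23
    obtain ⟨s, s1, s2, s3⟩ := h.DC_of K uc k (by omega) t12 t13 t23 p1 p2 p3 v12 v13 v23 e1 e2 e3
      hp1 hp1' hp2 hp2' hp3 hp3'
    have r6 := h.rk s1
    have ucp : ∀ p, p ∈ ({p1, p2, p3} : Set P) → UC D U p := by
      rintro p (rfl | rfl | rfl) <;> apply uc <;> omega
    have dcc : ∀ t ∈ D k, UC U D t ∧ ∀ m ∈ U t, UC U D m := by
      intro t ht
      have := h.rk ht
      refine ⟨h.DC_of K uc t (by omega), fun m hm => ?_⟩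
      have := h.rk ((mm _ _).2 hm)
      exact h.DC_of K uc m (by omega)
    have ucp1 := ucp p1 (by simp)
    have ucp2 := ucp p2 (by simp)
    have ucp3 := ucp p3 (by simp)
    obtain ⟨w1, x1, y1, z1⟩ := h.hex2 ucp1 ucp2 (dcc _ v12).1 (dcc _ v12).2 v12 v13 v23 e1 e2 u3
      nc1 c4 c6 hp1 hp1' hp2 hp2' f1 s1 s2
    obtain ⟨w2, x2, y2, z2⟩ := h.hex2 ucp1 ucp3 (dcc _ v13).1 (dcc _ v13).2 v13 v12 v23 e1.symm e3 u2
      nc2 c2 c5 hp1' hp1 hp3 hp3' f2 s1 s3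
    obtain ⟨w3, x3, y3, z3⟩ := h.hex2 ucp2 ucp3 (dcc _ v23).1 (dcc _ v23).2 v23 v12 v13 e2.symm
      e3.symm u1 nc3 c1 c3 hp2' hp2 hp3' hp3 f3 s2 s3
    exact ih s (by omega) (by omega) p1 p2 p3 w1 w2 w3 ((mm _ _).1 s1) ((mm _ _).1 s2)
      ((mm _ _).1 s3) f1 f2 f3 x1 x2 x3 y1 z1 y2 z2 y3 z3

theorem Ax.uc (h : Ax D U rk) : ∀ k, UC D U k := by
  have L := h.loc
  have mm := h.mem
  have : ∀ K k, rk k = K → UC D U k := by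
    intro K
    induction K using Nat.strong_induction_on with
    | _ K ih =>
    intro k hk
    have uc : ∀ k, rk k < K → UC D U k := fun k hk => ih _ hk k rfl
    intro n1 n2 n3 l12 l13 l23 h1 h2 h3 d12 d13 d23 a1 a2 a3 a4 a5 a6
    by_contra hbad
    have dcc : ∀ l n, l ∈ U n → n ∈ U k → UC U D l ∧ ∀ m ∈ U l, UC U D m := by
      intro l n hl hn
      have := h.rk ((mm _ _).2 hl)
      have := h.rk ((mm _ _).2 hn)
      refine ⟨h.DC_of K uc l (by omega), fun m hm => ?_⟩
      have := h.rk ((mm _ _).2 hm)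
      exact h.DC_of K uc m (by omega)
    obtain ⟨w1, x1, y1, z1⟩ := L.bad_e h.hU ((mm _ _).2 h1) ((mm _ _).2 h2) d12 ((mm _ _).2 a1)
      ((mm _ _).2 a2) (dcc l12 n1 a1 h1).1 (dcc l12 n1 a1 h1).2 h3 d13.symm d23.symm a3 a4 a5 a6
      hbad
    obtain ⟨w2, x2, y2, z2⟩ := L.bad_e h.hU ((mm _ _).2 h1) ((mm _ _).2 h3) d13 ((mm _ _).2 a3)
      ((mm _ _).2 a4) (dcc l13 n1 a3 h1).1 (dcc l13 n1 a3 h1).2 h2 d12.symm d23 a1 a2 a6 a5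
      (fun ⟨m, m1, m2, m3⟩ => hbad ⟨m, m2, m1, m3⟩)
    obtain ⟨w3, x3, y3, z3⟩ := L.bad_e h.hU ((mm _ _).2 h2) ((mm _ _).2 h3) d23 ((mm _ _).2 a5)
      ((mm _ _).2 a6) (dcc l23 n2 a5 h2).1 (dcc l23 n2 a5 h2).2 h1 d12 d13 a2 a1 a4 a3
      (fun ⟨m, m1, m2, m3⟩ => hbad ⟨m, m2, m3, m1⟩)
    exact h.noHex K uc K k hk.le le_rfl n1 n2 n3 w1 w2 w3 h1 h2 h3 d12 d13 d23 x1 x2 x3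
      y1 z1 y2 z2 y3 z3
  exact fun k => this _ k rfl

theorem Ax.dc (h : Ax D U rk) (m : P) : UC U D m :=
  h.DC_of (rk m) (fun k _ => h.uc k) m (by omega)

theorem Ax.T (h : Ax D U rk) {a b c ab ac bc : P} (h1 : a ≠ b) (h2 : a ≠ c) (h3 : b ≠ c)
    (h4 : ab ∈ D a) (h5 : ab ∈ D b) (h6 : ac ∈ D a) (h7 : ac ∈ D c)
    (h8 : bc ∈ D b) (h9 : bc ∈ D c) :
    (ab = ac ∧ ab = bc) ∨ (∃ m, m ∈ U a ∧ m ∈ U b ∧ m ∈ U c) :=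
  h.T_of (rk a) (fun k _ => h.uc k) (rk a) (by omega) a b c ab ac bc rfl h1 h2 h3 h4 h5 h6 h7 h8 h9

end TD
end

section
namespace TD
variable {P : Type} {D U : P → Finset P} {rk : P → ℕ}

/-- Adjacency: distinct elements with a common lower cover. -/
def Adj (D : P → Finset P) (x y : P) : Prop := x ≠ y ∧ ∃ w, w ∈ D x ∧ w ∈ D y

theorem Adj.symm {x y : P} (h : Adj D x y) : Adj D y x :=
  ⟨h.1.symm, h.2.imp fun _ hw => ⟨hw.2, hw.1⟩⟩

theorem Ax.Q (h : Ax D U rk) : ∀ n A B C E a b c d, rk A ≤ n → A ≠ C → B ≠ E →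
    ¬ Adj D A C → ¬ Adj D B E → A ≠ B → B ≠ C → C ≠ E → E ≠ A →
    a ∈ D A → a ∈ D B → b ∈ D B → b ∈ D C → c ∈ D C → c ∈ D E → d ∈ D E → d ∈ D A →
    ∃ z, z ∈ D a ∧ z ∈ D b ∧ z ∈ D c ∧ z ∈ D d := by
  have L := h.loc
  have mm := h.mem
  intro n
  induction n with
  | zero =>
    intro A B C E a b c d hr _ _ _ _ _ _ _ _ h1
    have := h.rk h1
    omega
  | succ n ih =>
    intro A B C E a b c d hr hAC hBE nAC nBE hAB hBC hCE hEA a1 a2 b1 b2 c1 c2 d1 d2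
    have hra := h.rk a1
    have eab : a ≠ b := by rintro rfl; exact nAC ⟨hAC, a, a1, b2⟩
    have ebc : b ≠ c := by rintro rfl; exact nBE ⟨hBE, b, b1, c2⟩
    have ecd : c ≠ d := by rintro rfl; exact nAC ⟨hAC, c, d2, c1⟩
    have eda : d ≠ a := by rintro rfl; exact nBE ⟨hBE, d, a2, d1⟩
    have eac : a ≠ c := by rintro rfl; exact nAC ⟨hAC, a, a1, c1⟩
    have ebd : b ≠ d := by rintro rfl; exact nAC ⟨hAC, b, d2, b2⟩
    obtain ⟨p, p1, p2⟩ := L.mt eab ((mm _ _).1 a2) ((mm _ _).1 b1)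
    obtain ⟨q, q1, q2⟩ := L.mt ebc ((mm _ _).1 b2) ((mm _ _).1 c1)
    obtain ⟨r, r1, r2⟩ := L.mt ecd ((mm _ _).1 c2) ((mm _ _).1 d1)
    obtain ⟨s, s1, s2⟩ := L.mt eda ((mm _ _).1 d2) ((mm _ _).1 a1)
    by_cases hac : Adj D a c
    · obtain ⟨_, w, w1, w2⟩ := hac
      have x1 : w = p ∧ w = q := by
        rcases h.T eac eab ebc.symm w1 w2 p1 p2 q2 q1 with e | ⟨m, m1, m2, m3⟩
        · exact e
        · exfalso
          have i1 := L.uU eab m1 m3 ((mm _ _).1 a2) ((mm _ _).1 b1)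
          have i2 := L.uU ebc m3 m2 ((mm _ _).1 b2) ((mm _ _).1 c1)
          exact hBC (i1.symm.trans i2)
      have x2 : w = s ∧ w = r := by
        rcases h.T eac eda.symm ecd w1 w2 s2 s1 r1 r2 with e | ⟨m, m1, m2, m3⟩
        · exact e
        · exfalso
          have i1 := L.uU eda m3 m1 ((mm _ _).1 d2) ((mm _ _).1 a1)
          have i2 := L.uU ecd m2 m3 ((mm _ _).1 c2) ((mm _ _).1 d1)
          exact hEA (i2.symm.trans i1)
      exact ⟨w, w1, x1.1 ▸ p2, w2, x2.1 ▸ s1⟩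
    by_cases hbd : Adj D b d
    · obtain ⟨_, w, w1, w2⟩ := hbd
      have x1 : w = p ∧ w = s := by
        rcases h.T ebd eab.symm eda w1 w2 p2 p1 s1 s2 with e | ⟨m, m1, m2, m3⟩
        · exact e
        · exfalso
          have i1 := L.uU eab m3 m1 ((mm _ _).1 a2) ((mm _ _).1 b1)
          have i2 := L.uU eda m2 m3 ((mm _ _).1 d2) ((mm _ _).1 a1)
          exact hAB (i2.symm.trans i1)
      have x2 : w = q ∧ w = r := by
        rcases h.T ebd ebc ecd.symm w1 w2 q1 q2 r2 r1 with e | ⟨m, m1, m2, m3⟩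
        · exact e
        · exfalso
          have i1 := L.uU ebc m1 m3 ((mm _ _).1 b2) ((mm _ _).1 c1)
          have i2 := L.uU ecd m3 m2 ((mm _ _).1 c2) ((mm _ _).1 d1)
          exact hCE (i1.symm.trans i2)
      exact ⟨w, x1.1 ▸ p1, w1, x2.1 ▸ q2, w2⟩
    exfalso
    obtain ⟨z, z1, z2, z3, z4⟩ := ih a b c d p q r s (by omega) eac ebd hac hbd eab ebc ecd eda
      p1 p2 q1 q2 r1 r2 s1 s2
    have epq : p ≠ q := by rintro rfl; exact hac ⟨eac, p, p1, q2⟩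
    have eps : p ≠ s := by rintro rfl; exact hbd ⟨ebd, p, p2, s1⟩
    have eqr : q ≠ r := by rintro rfl; exact hbd ⟨ebd, q, q1, r2⟩
    have ers : r ≠ s := by rintro rfl; exact hac ⟨eac, r, s2, r1⟩
    have eqs : q ≠ s := by rintro rfl; exact hac ⟨eac, q, s2, q2⟩
    obtain ⟨m, m1, m2⟩ := L.jn eqs z2 z4
    obtain ⟨v, v1, v2, v3⟩ := h.uc z p q s b a m ((mm _ _).1 z1) ((mm _ _).1 z2) ((mm _ _).1 z4)
      epq eps eqs ((mm _ _).1 p2) ((mm _ _).1 q1) ((mm _ _).1 p1) ((mm _ _).1 s2) m1 m2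
    obtain ⟨u, u1, u2, u3⟩ := h.uc z r q s c d m ((mm _ _).1 z3) ((mm _ _).1 z2) ((mm _ _).1 z4)
      eqr.symm ers eqs ((mm _ _).1 r1) ((mm _ _).1 q2) ((mm _ _).1 r2) ((mm _ _).1 s1) m1 m2
    have i1 := L.uU eab v2 v1 ((mm _ _).1 a2) ((mm _ _).1 b1)
    have i2 := L.uU ecd u1 u2 ((mm _ _).1 c2) ((mm _ _).1 d1)
    subst i1 i2
    exact nBE ⟨hBE, m, (mm _ _).2 v3, (mm _ _).2 u3⟩

/-- Non-adjacent elements have at most four common neighbours. -/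
theorem Ax.codeg (h : Ax D U rk) {A C : P} (hAC : A ≠ C) (nAC : ¬ Adj D A C) (S : Finset P)
    (hS : ∀ x ∈ S, Adj D A x ∧ Adj D C x) : S.card ≤ 4 := by
  have L := h.loc
  have mm := h.mem
  rcases S.eq_empty_or_nonempty with rfl | ⟨B, hB⟩
  · simp
  obtain ⟨⟨hAB, a, a1, a2⟩, ⟨hCB, b, b2, b1⟩⟩ := hS B hB
  have eab : a ≠ b := by rintro rfl; exact nAC ⟨hAC, a, a1, b2⟩
  -- the three types
  have hsub : S ⊆ {B} ∪ (S.filter (fun x => x ≠ B ∧ ¬ Adj D B x) ∪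
      (S.filter (fun x => x ≠ B ∧ Adj D B x ∧ a ∈ D x) ∪
      S.filter (fun x => x ≠ B ∧ Adj D B x ∧ b ∈ D x))) := by
    intro x hx
    simp only [Finset.mem_union, Finset.mem_singleton, Finset.mem_filter]
    by_cases e0 : x = B
    · exact Or.inl e0
    by_cases e1 : Adj D B x
    · right; right
      by_contra hcon
      push Not at hcon
      have na : a ∉ D x := fun hh => hcon.1 hx e0 e1 hh
      have nb : b ∉ D x := fun hh => hcon.2 hx e0 e1 hh
      obtain ⟨⟨hAx, d, d1, d2⟩, ⟨hCx, c, c1, c2⟩⟩ := hS x hx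
      obtain ⟨_, w, w1, w2⟩ := e1
      have t1 : ∃ m, m ∈ U A ∧ m ∈ U B ∧ m ∈ U x := by
        rcases h.T hAB hAx (Ne.symm e0) a1 a2 d1 d2 w1 w2 with e | e
        · exact absurd (e.2 ▸ w2) na
        · exact e
      have t2 : ∃ m, m ∈ U C ∧ m ∈ U B ∧ m ∈ U x := by
        rcases h.T hCB hCx (Ne.symm e0) b2 b1 c1 c2 w1 w2 with e | e
        · exact absurd (e.2 ▸ w2) nb
        · exact e
      obtain ⟨m, m1, m2, m3⟩ := t1
      obtain ⟨m', n1, n2, n3⟩ := t2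
      have := L.uU (Ne.symm e0) m2 m3 n2 n3
      subst this
      exact nAC ⟨hAC, L.mt hAC m1 n1⟩
    · exact Or.inr (Or.inl ⟨hx, e0, e1⟩)
  have c1 : (S.filter (fun x => x ≠ B ∧ ¬ Adj D B x)).card ≤ 1 := by
    rw [Finset.card_le_one]
    intro x hx y hy
    rw [Finset.mem_filter] at hx hy
    obtain ⟨hxS, exB, nBx⟩ := hx
    obtain ⟨hyS, eyB, nBy⟩ := hy
    obtain ⟨⟨hAx, d, d1, d2⟩, ⟨hCx, c, c1, c2⟩⟩ := hS x hxS
    obtain ⟨⟨hAy, d', d1', d2'⟩, ⟨hCy, c', c1', c2'⟩⟩ := hS y hyS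
    obtain ⟨z, z1, z2, z3, z4⟩ := h.Q _ A B C x a b c d le_rfl hAC (Ne.symm exB) nAC nBx hAB
      hCB.symm hCx hAx.symm a1 a2 b1 b2 c1 c2 d2 d1
    obtain ⟨z', y1, y2, y3, y4⟩ := h.Q _ A B C y a b c' d' le_rfl hAC (Ne.symm eyB) nAC nBy hAB
      hCB.symm hCy hAy.symm a1 a2 b1 b2 c1' c2' d2' d1'
    have ez : z' = z := L.uD eab y1 y2 z1 z2
    subst ez
    have hd : d = d' := by
      rcases L.thin ((mm _ _).1 z4) d1 ((mm _ _).1 y4) d1' ((mm _ _).1 z1) a1 with e | e | e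
      · exact e
      · exact absurd ⟨exB.symm, a, a2, e ▸ d2⟩ nBx
      · exact absurd ⟨eyB.symm, a, a2, e ▸ d2'⟩ nBy
    have hc : c = c' := by
      rcases L.thin ((mm _ _).1 z3) c1 ((mm _ _).1 y3) c1' ((mm _ _).1 z2) b2 with e | e | e
      · exact e
      · exact absurd ⟨exB.symm, b, b1, e ▸ c2⟩ nBx
      · exact absurd ⟨eyB.symm, b, b1, e ▸ c2'⟩ nBy
    subst hd hc
    have hdc : d ≠ c := by rintro rfl; exact nAC ⟨hAC, d, d1, c1⟩
    exact L.uU hdc ((mm _ _).1 d2) ((mm _ _).1 c2) ((mm _ _).1 d2') ((mm _ _).1 c2')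
  have c2 : (S.filter (fun x => x ≠ B ∧ Adj D B x ∧ a ∈ D x)).card ≤ 1 := by
    rw [Finset.card_le_one]
    have key : ∀ x ∈ S.filter (fun x => x ≠ B ∧ Adj D B x ∧ a ∈ D x),
        ∃ m, m ∈ U C ∧ m ∈ U B ∧ m ∈ U x := by
      intro x hx
      rw [Finset.mem_filter] at hx
      obtain ⟨hxS, exB, ⟨_, w, w1, w2⟩, hax⟩ := hx
      obtain ⟨⟨hAx, d, d1, d2⟩, ⟨hCx, c, c1, c2⟩⟩ := hS x hxS
      rcases h.T hCB hCx (Ne.symm exB) b2 b1 c1 c2 w1 w2 with e | e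
      · exfalso
        have : w = a := L.uD exB w2 w1 hax a2
        exact eab (this.symm.trans e.2.symm)
      · exact e
    intro x hx y hy
    obtain ⟨m, m1, m2, m3⟩ := key x hx
    obtain ⟨m', n1, n2, n3⟩ := key y hy
    have := L.uU hCB m1 m2 n1 n2
    subst this
    rw [Finset.mem_filter] at hx hy
    rcases L.thin ((mm _ _).1 hx.2.2.2) ((mm _ _).2 m3) ((mm _ _).1 hy.2.2.2) ((mm _ _).2 n3)
      ((mm _ _).1 a2) ((mm _ _).2 m2) with e | e | e
    · exact e
    · exact absurd e hx.2.1
    · exact absurd e hy.2.1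
  have c3 : (S.filter (fun x => x ≠ B ∧ Adj D B x ∧ b ∈ D x)).card ≤ 1 := by
    rw [Finset.card_le_one]
    have key : ∀ x ∈ S.filter (fun x => x ≠ B ∧ Adj D B x ∧ b ∈ D x),
        ∃ m, m ∈ U A ∧ m ∈ U B ∧ m ∈ U x := by
      intro x hx
      rw [Finset.mem_filter] at hx
      obtain ⟨hxS, exB, ⟨_, w, w1, w2⟩, hax⟩ := hx
      obtain ⟨⟨hAx, d, d1, d2⟩, ⟨hCx, c, c1, c2⟩⟩ := hS x hxS
      rcases h.T hAB hAx (Ne.symm exB) a1 a2 d1 d2 w1 w2 with e | e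
      · exfalso
        have : w = b := L.uD exB w2 w1 hax b1
        exact eab (e.2.trans this)
      · exact e
    intro x hx y hy
    obtain ⟨m, m1, m2, m3⟩ := key x hx
    obtain ⟨m', n1, n2, n3⟩ := key y hy
    have := L.uU hAB m1 m2 n1 n2
    subst this
    rw [Finset.mem_filter] at hx hy
    rcases L.thin ((mm _ _).1 hx.2.2.2) ((mm _ _).2 m3) ((mm _ _).1 hy.2.2.2) ((mm _ _).2 n3)
      ((mm _ _).1 b1) ((mm _ _).2 m2) with e | e | e
    · exact e
    · exact absurd e hx.2.1
    · exact absurd e hy.2.1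
  have k0 := Finset.card_le_card hsub
  have k1 := Finset.card_union_le {B} (S.filter (fun x => x ≠ B ∧ ¬ Adj D B x) ∪
      (S.filter (fun x => x ≠ B ∧ Adj D B x ∧ a ∈ D x) ∪
      S.filter (fun x => x ≠ B ∧ Adj D B x ∧ b ∈ D x)))
  have k2 := Finset.card_union_le (S.filter (fun x => x ≠ B ∧ ¬ Adj D B x))
      (S.filter (fun x => x ≠ B ∧ Adj D B x ∧ a ∈ D x) ∪
      S.filter (fun x => x ≠ B ∧ Adj D B x ∧ b ∈ D x))
  have k3 := Finset.card_union_le (S.filter (fun x => x ≠ B ∧ Adj D B x ∧ a ∈ D x))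
      (S.filter (fun x => x ≠ B ∧ Adj D B x ∧ b ∈ D x))
  rw [Finset.card_singleton] at k1
  omega

theorem Ax.D_le (h : Ax D U rk) {x a : P} (hx : x ∈ D a) :
    (D x).card ≤ (D a).card + 1 ∧ (D a).card ≤ (D x).card + 1 := by
  have := h.st hx
  have := h.loc.cnt hx
  omega

/-- Adjacent elements have at most twice `R` common neighbours. -/
theorem Ax.codeg' (h : Ax D U rk) {A C : P} (hAC : Adj D A C) (S : Finset P)
    (hS : ∀ x ∈ S, Adj D A x ∧ Adj D C x) : S.card ≤ 2 * (D A).card := by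
  have L := h.loc
  have mm := h.mem
  obtain ⟨hne, v, v1, v2⟩ := hAC
  obtain ⟨m, m1, m2⟩ := L.jn hne v1 v2
  have hsub : S ⊆ ((U v).erase A) ∪ ((D m).erase A).erase C := by
    intro x hx
    obtain ⟨⟨hAx, d, d1, d2⟩, ⟨hCx, c, c1, c2⟩⟩ := hS x hx
    simp only [Finset.mem_union, Finset.mem_erase]
    rcases h.T hne hAx hCx v1 v2 d1 d2 c1 c2 with e | ⟨m', n1, n2, n3⟩
    · left
      refine ⟨hAx.symm, (mm _ _).1 ?_⟩
      rw [e.1]; exact d2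
    · right
      have := L.uU hne n1 n2 m1 m2
      subst this
      exact ⟨hCx.symm, hAx.symm, (mm _ _).2 n3⟩
  have k0 := Finset.card_le_card hsub
  have k1 := Finset.card_union_le ((U v).erase A) (((D m).erase A).erase C)
  have k2 := Finset.card_erase_add_one ((mm _ _).1 v1)
  have k3 := Finset.card_erase_add_one ((mm _ _).2 m1)
  have k4 := Finset.card_erase_add_one (Finset.mem_erase.2 ⟨hne.symm, (mm _ _).2 m2⟩)
  have k5 := h.hU v
  have k6 := h.D_le v1
  have k7 := h.D_le ((mm _ _).2 m1)
  omega

end TD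
end

section
namespace TD
variable {P : Type} {D U : P → Finset P} {rk : P → ℕ}

theorem Ax.e_le_one (h : Ax D U rk) : ∀ n k a b, rk k ≤ n → a ∈ U k → b ∈ U k → a ≠ b →
    ee D U k a b ≤ 1 := by
  have L := h.loc
  have mm := h.mem
  intro n
  induction n with
  | zero =>
    intro k a b hk _ _ _
    unfold ee
    have : D k = ∅ := by
      rw [Finset.eq_empty_iff_forall_notMem]
      intro x hx
      have := h.rk hx
      omega
    simp [this]
  | succ n ih =>
    intro k a b hk ha hb hab
    by_contra hcon
    push Not at hcon
    obtain ⟨x, hx, y, hy, hxy⟩ := Finset.one_lt_card.1 hcon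
    rw [Finset.mem_filter] at hx hy
    obtain ⟨z, z1, z2⟩ := L.mt hxy ((mm _ _).1 hx.1) ((mm _ _).1 hy.1)
    have h1 := L.q_le_e h.hU z1 z2 hxy hx.1 hy.1 (h.dc k) (fun m _ => h.dc m)
    have h2 : 1 < ee U D k x y := Finset.one_lt_card.2
      ⟨a, by simp [Ch_dual (D := D) (U := U), ha, hx.2.1, hy.2.1], b,
        by simp [Ch_dual (D := D) (U := U), hb, hx.2.2, hy.2.2], hab⟩
    have := h.rk hx.1
    have := h.rk z1
    have := ih z x y (by omega) ((mm _ _).1 z1) ((mm _ _).1 z2) hxy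
    omega

theorem even_card_invol (t : P → P) (ht : ∀ x, t (t x) = x) (s : Finset P)
    (hs : ∀ x ∈ s, t x ∈ s) (hf : ∀ x ∈ s, t x ≠ x) : Even s.card := by
  have h : ∑ _x ∈ s, (1 : ZMod 2) = 0 :=
    Finset.sum_involution (fun x _ => t x) (fun _ _ => by decide) (fun x hx _ => hf x hx)
      (fun x hx => hs x hx) (fun x _ => ht x)
  rw [Finset.sum_const, nsmul_eq_mul, mul_one] at h
  exact (ZMod.natCast_eq_zero_iff_even).1 h

/-- Involutive automorphism data. -/
structure Tau (D U : P → Finset P) (rk : P → ℕ) (t : P → P) : Prop where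
  inv : ∀ x, t (t x) = x
  mapD : ∀ {x y}, x ∈ D y → t x ∈ D (t y)
  mapU : ∀ {x y}, x ∈ U y → t x ∈ U (t y)
  two : ∀ x, t x = x → rk x ≠ 2
  ne : ∀ x, 0 < rk x → (D x).Nonempty

variable {t : P → P}

theorem Tau.ch (T : Tau D U rk t) {x z : P} (hc : Ch D U x z) : Ch D U (t x) (t z) := by
  intro a b h1 h2 h3 h4
  have := hc (t a) (t b) (by simpa [T.inv] using T.mapU h1) (by simpa [T.inv] using T.mapD h2)
    (by simpa [T.inv] using T.mapU h3) (by simpa [T.inv] using T.mapD h4)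
  rw [← T.inv a, this, T.inv]

theorem Ax.S (h : Ax D U rk) (T : Tau D U rk t) : ∀ n v, rk v ≤ n → t v = v → ∀ a b,
    a ∈ U v → b ∈ U v → t a = a → t b = b → a = b := by
  have L := h.loc
  have mm := h.mem
  intro n
  induction n using Nat.strong_induction_on with
  | _ n IH =>
  intro v hv hfv
  have ih : ∀ w, rk w < rk v → t w = w → ∀ a b,
    a ∈ U w → b ∈ U w → t a = a → t b = b → a = b :=
    fun w hw => IH (rk w) (by omega) w le_rfl
  -- key diamond lemma
  have key : ∀ a b, a ∈ U v → b ∈ U v → t a = a → t b = b → a ≠ b →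
      ∀ k ∈ D v, t k ≠ k → Ch D U k a ∨ Ch D U k b := by
    intro a b ha hb hfa hfb hab k hk hfk
    by_contra hcon
    push Not at hcon
    have hk' : t k ∈ D v := by simpa [hfv] using T.mapD hk
    obtain ⟨o, o1, o2⟩ := L.mt hfk ((mm _ _).1 hk') ((mm _ _).1 hk)
    have hfo : t o = o := by
      have i1 := T.mapD o1
      have i2 := T.mapD o2
      rw [T.inv] at i1
      exact L.uD hfk i2 i1 o1 o2
    have sub : ∀ a, a ∈ U v → t a = a → ¬ Ch D U k a → ∃ x e, x ≠ v ∧ x ∈ D a ∧ x ∈ U k ∧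
        e ∈ D x ∧ t e = e ∧ e ∈ U o := by
      intro a ha hfa hc
      obtain ⟨x, x1, x2, x3⟩ := other hc ((mm _ _).1 hk) ((mm _ _).2 ha)
      have tx2 : t x ∈ D a := by simpa [hfa] using T.mapD x2
      have tx1 : t x ∈ U (t k) := T.mapU x1
      have hfx : t x ≠ x := by
        intro e
        rw [e] at tx1
        exact hfk (L.uD x3 ((mm _ _).2 tx1) hk' ((mm _ _).2 x1) hk)
      have hxv : t x ≠ v := by
        intro e
        apply x3
        rw [← T.inv x, e, hfv]
      obtain ⟨e, e1, e2⟩ := L.mt hfx ((mm _ _).1 tx2) ((mm _ _).1 x2)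
      have hfe : t e = e := by
        have i1 := T.mapD e1
        have i2 := T.mapD e2
        rw [T.inv] at i1
        exact L.uD hfx i2 i1 e1 e2
      obtain ⟨w, w1, w2, w3⟩ := h.dc a v x (t x) k (t k) e ((mm _ _).2 ha) x2 tx2 x3.symm hxv.symm
        hfx.symm hk ((mm _ _).2 x1) hk' ((mm _ _).2 tx1) e2 e1
      have : w = o := L.uD hfk w2 w1 o1 o2
      subst this
      exact ⟨x, e, x3, x2, x1, e2, hfe, (mm _ _).1 w3⟩
    obtain ⟨x, e, x0, x1, x2, x3, x4, x5⟩ := sub a ha hfa hcon.1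
    obtain ⟨y, e', y0, y1, y2, y3, y4, y5⟩ := sub b hb hfb hcon.2
    have r1 := h.rk hk
    have r2 := h.rk o2
    have hee : e = e' := ih o (by omega) hfo e e' x5 y5 x4 y4
    subst hee
    have hke : k ≠ e := by rintro rfl; exact hfk x4
    have hxy : x = y := L.uU hke x2 ((mm _ _).1 x3) y2 ((mm _ _).1 y3)
    subst hxy
    exact x0 (L.uD hab x1 y1 ((mm _ _).2 ha) ((mm _ _).2 hb))
  intro a b ha hb hfa hfb
  by_contra hab
  by_cases hex : ∃ k ∈ D v, t k = k
  · obtain ⟨k, hk, hfk⟩ := hex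
    have rkv := h.rk hk
    have chk : ∀ a, a ∈ U v → t a = a → Ch D U k a := by
      intro a ha hfa
      by_contra hc
      obtain ⟨x, x1, x2, x3⟩ := other hc ((mm _ _).1 hk) ((mm _ _).2 ha)
      have tx1 : t x ∈ U k := by simpa [hfk] using T.mapU x1
      have tx2 : t x ∈ D a := by simpa [hfa] using T.mapD x2
      have hxv : t x ≠ v := by
        intro e
        apply x3
        rw [← T.inv x, e, hfv]
      rcases L.thin x1 x2 tx1 tx2 ((mm _ _).1 hk) ((mm _ _).2 ha) with e | e | e
      · exact x3 (ih k (by omega) hfk x v x1 ((mm _ _).1 hk) e.symm hfv)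
      · exact x3 e
      · exact hxv e
    have only : ∀ k' ∈ D v, k' = k := by
      intro k' hk'
      by_contra hne
      have tk' : t k' ∈ D v := by simpa [hfv] using T.mapD hk'
      by_cases hf' : t k' = k'
      · obtain ⟨o, o1, o2⟩ := L.mt hne ((mm _ _).1 hk') ((mm _ _).1 hk)
        have hfo : t o = o := by
          have i1 := T.mapD o1
          have i2 := T.mapD o2
          rw [hf'] at i1
          rw [hfk] at i2
          exact L.uD hne i1 i2 o1 o2
        have r2 := h.rk o2
        exact hne (ih o (by omega) hfo k' k ((mm _ _).1 o1) ((mm _ _).1 o2) hf' hfk)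
      · have fin : ∀ a, a ∈ U v → t a = a → Ch D U k' a → False := by
          intro a ha hfa hc
          have hc' : Ch D U (t k') a := by simpa [hfa] using T.ch hc
          have : 2 < tt D U v a := Finset.two_lt_card.2
            ⟨k, by simp [hk, chk a ha hfa], k', by simp [hk', hc], t k', by simp [tk', hc'],
              fun e => hne e.symm, fun e => hne (by rw [← T.inv k', ← e, hfk]),
              fun e => hf' e.symm⟩
          have := h.st ((mm _ _).2 ha)
          omega
        rcases key a b ha hb hfa hfb hab k' hk' hf' with e | e
        · exact fin a ha hfa e
        · exact fin b hb hfb e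
    have hDv : D v = {k} := by
      ext x
      simp only [Finset.mem_singleton]
      exact ⟨only x, fun e => e ▸ hk⟩
    have h1 : 1 < tt U D v k := Finset.one_lt_card.2
      ⟨a, by simp [Ch_dual (D := D) (U := U), ha, chk a ha hfa],
       b, by simp [Ch_dual (D := D) (U := U), hb, chk b hb hfb], hab⟩
    have h2 := h.st hk
    have h3 := L.cnt hk
    rw [hDv, Finset.card_singleton] at h3
    have h4 : D k = ∅ := by
      rw [← Finset.card_eq_zero]
      omega
    have h5 : rk k = 0 := by
      by_contra hc
      have := T.ne k (by omega)
      rw [h4] at this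
      simp at this
    have h6 := h.rk ((mm _ _).2 ha)
    exact T.two a hfa (by omega)
  · push Not at hex
    have evD : Even (D v).card := even_card_invol t T.inv _
      (fun x hx => by simpa [hfv] using T.mapD hx) hex
    have h3 : ∃ c, c ∈ U v ∧ t c = c ∧ c ≠ a ∧ c ≠ b := by
      by_contra hcon
      push Not at hcon
      have ev : Even (((U v).erase a).erase b).card := by
        apply even_card_invol t T.inv
        · intro x hx
          simp only [Finset.mem_erase] at hx ⊢
          refine ⟨fun e => hx.1 ?_, fun e => hx.2.1 ?_, by simpa [hfv] using T.mapU hx.2.2⟩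
          · rw [← T.inv x, e, hfb]
          · rw [← T.inv x, e, hfa]
        · intro x hx e
          simp only [Finset.mem_erase] at hx
          exact hx.1 (hcon x hx.2.2 e hx.2.1)
      have k1 := Finset.card_erase_add_one ha
      have k2 := Finset.card_erase_add_one (Finset.mem_erase.2 ⟨Ne.symm hab, hb⟩)
      have k3 := h.hU v
      obtain ⟨p, hp⟩ := ev
      obtain ⟨q, hq⟩ := evD
      omega
    obtain ⟨c, hc, hfc, hca, hcb⟩ := h3
    have hDne : (D v).Nonempty := by
      rw [← Finset.card_pos]
      have : 2 < (U v).card := Finset.two_lt_card.2 ⟨a, ha, b, hb, c, hc, hab, hca.symm, hcb.symm⟩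
      have := h.hU v
      omega
    obtain ⟨k, hk⟩ := hDne
    have hfk := hex k hk
    have tk : t k ∈ D v := by simpa [hfv] using T.mapD hk
    have fin : ∀ a b, a ∈ U v → b ∈ U v → t a = a → t b = b → a ≠ b → Ch D U k a → Ch D U k b →
        False := by
      intro a b ha hb hfa hfb hab h1 h2
      have h1' : Ch D U (t k) a := by simpa [hfa] using T.ch h1
      have h2' : Ch D U (t k) b := by simpa [hfb] using T.ch h2
      have h3 : 1 < ee D U v a b := Finset.one_lt_card.2
        ⟨k, by simp [hk, h1, h2], t k, by simp [tk, h1', h2'], Ne.symm hfk⟩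
      have := h.e_le_one _ v a b le_rfl ha hb hab
      omega
    have k1 := key a b ha hb hfa hfb hab k hk hfk
    have k2 := key a c ha hc hfa hfc hca.symm k hk hfk
    have k3 := key b c hb hc hfb hfc hcb.symm k hk hfk
    have f1 := fin a b ha hb hfa hfb hab
    have f2 := fin a c ha hc hfa hfc hca.symm
    have f3 := fin b c hb hc hfb hfc hcb.symm
    tauto

end TD
end

section
namespace TD
variable {P : Type} {D U : P → Finset P} {rk : P → ℕ}

theorem tt_double (x : P) : ∑ a ∈ U x, tt D U x a = ∑ w ∈ D x, tt U D x w := by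
  have := Finset.sum_card_bipartiteAbove_eq_sum_card_bipartiteBelow
    (s := U x) (t := D x) (fun a w => Ch D U w a)
  unfold Finset.bipartiteAbove Finset.bipartiteBelow at this
  unfold tt
  rw [this]
  apply Finset.sum_congr rfl
  intro w _
  congr 1
  apply Finset.filter_congr
  intro a _
  rw [Ch_dual (D := D) (U := U)]

theorem Ax.good (h : Ax D U rk) {l m : P} (hm : m ∈ U l) (h0 : tt D U l m = 0)
    (hR : 3 ≤ (D l).card) (hq : ∀ v ∈ D l, ∀ l' ∈ U v, tt D U v l' = 1) : False := by
  have L := h.loc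
  have mm := h.mem
  have hlm : l ∈ D m := (mm _ _).2 hm
  have hnc : ∀ v ∈ D l, ¬ Ch D U v m := by
    intro v hv hc
    have : v ∈ (D l).filter (fun w => Ch D U w m) := by simp [hv, hc]
    rw [Finset.card_eq_zero.1 h0] at this
    simp at this
  have hg : ∀ v ∈ D l, ∃ l', l' ∈ U v ∧ l' ∈ D m ∧ l' ≠ l := fun v hv =>
    other (hnc v hv) ((mm _ _).1 hv) hlm
  choose! g hg using hg
  have hsub : (D l).image g ⊆ ((U m).filter (fun w => Ch U D w l)).biUnion
      (fun w => ((D m).filter (fun x => Ch D U x w)).erase l) := by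
    intro x hx
    obtain ⟨v, hv, rfl⟩ := Finset.mem_image.1 hx
    obtain ⟨g1, g2, g3⟩ := hg v hv
    have e1 := L.dual.G1 (k := m) (n := l) (n' := g v) (l := v) hm ((mm _ _).1 g2) g3.symm
      ((mm _ _).1 hv) g1 (h.uc v)
    have e2 := h.st hlm
    have e3 := h.st ((mm _ _).2 g1)
    have e4 := hq v hv (g v) g1
    have e5 : 0 < ee U D m l (g v) := by omega
    obtain ⟨w, hw⟩ := Finset.card_pos.1 e5
    rw [Finset.mem_filter] at hw
    rw [Finset.mem_biUnion]
    refine ⟨w, Finset.mem_filter.2 ⟨hw.1, hw.2.1⟩, ?_⟩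
    rw [Finset.mem_erase, Finset.mem_filter]
    exact ⟨g3, g2, (Ch_dual (D := D) (U := U) _ _).1 hw.2.2⟩
  have k1 := Finset.card_le_card hsub
  rw [Finset.card_image_of_injOn] at k1
  · have k2 := Finset.card_biUnion_le_card_mul ((U m).filter (fun w => Ch U D w l))
      (fun w => ((D m).filter (fun x => Ch D U x w)).erase l) 1 (by
        intro w hw
        rw [Finset.mem_filter] at hw
        have e1 : l ∈ (D m).filter (fun x => Ch D U x w) :=
          Finset.mem_filter.2 ⟨hlm, (Ch_dual (D := D) (U := U) _ _).1 hw.2⟩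
        have e2 := Finset.card_erase_add_one e1
        have e3 := h.st ((mm _ _).2 hw.1)
        unfold tt at e3
        omega)
    have k3 := h.st hlm
    have k4 : ((U m).filter (fun w => Ch U D w l)).card = tt U D m l := rfl
    omega
  · intro v hv v' hv' e
    obtain ⟨g1, g2, g3⟩ := hg v hv
    obtain ⟨g1', g2', g3'⟩ := hg v' hv'
    have e : g v = g v' := e
    rw [← e] at g1'
    exact L.uD g3 ((mm _ _).2 g1) hv ((mm _ _).2 g1') hv'

theorem Ax.depth (h : Ax D U rk) {l : P} (hR : 5 ≤ (D l).card)
    (hall : ∀ v ∈ D l, ∀ l' ∈ U v, (D l').card = (D l).card) : False := by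
  have L := h.loc
  have mm := h.mem
  have ht : ∀ v ∈ D l, ∀ l' ∈ U v, tt D U v l' = tt D U v l := by
    intro v hv l' hl'
    have e1 := L.cnt ((mm _ _).2 hl')
    have e2 := L.cnt hv
    have := hall v hv l' hl'
    omega
  have h1 : ∀ v ∈ D l, tt D U v l ≤ 1 := by
    intro v hv
    have e1 := tt_double (D := D) (U := U) v
    rw [Finset.sum_congr rfl (ht v hv), Finset.sum_const, smul_eq_mul, h.hU] at e1
    have e2 : ∑ w ∈ D v, tt U D v w ≤ ∑ w ∈ D v, 2 := Finset.sum_le_sum (fun w hw => by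
      have := h.st hw
      omega)
    rw [Finset.sum_const, smul_eq_mul, ← e1] at e2
    by_contra hc
    push Not at hc
    have : ((D v).card + 1) * 2 ≤ ((D v).card + 1) * tt D U v l := Nat.mul_le_mul_left _ hc
    omega
  have hsum := tt_double (D := D) (U := U) l
  by_cases hz : ∃ v ∈ D l, tt D U v l = 0
  · obtain ⟨v, hv, hv0⟩ := hz
    have e1 : ∑ m ∈ U l, tt D U l m ≤ ∑ m ∈ U l, if Ch U D m v then 2 else 0 := by
      apply Finset.sum_le_sum
      intro m hm
      have hlm := (mm _ _).2 hm
      split_ifs with hc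
      · have := h.st hlm
        omega
      · rw [Ch_dual (D := D) (U := U)] at hc
        obtain ⟨l', a1, a2, a3⟩ := other hc ((mm _ _).1 hv) hlm
        have := L.col_le h.hU (k := v) (n := l') (n' := l) (l := m) ((mm _ _).2 a1) hv a3 a2 hlm
          (fun m _ => h.dc m)
        have := ht v hv l' a1
        omega
    rw [← Finset.sum_filter, Finset.sum_const, smul_eq_mul] at e1
    have e2 : ((U l).filter (fun m => Ch U D m v)).card = tt U D l v := rfl
    have e3 := h.st hv
    have e4 : ∑ w ∈ D l, 1 ≤ ∑ w ∈ D l, tt U D l w := Finset.sum_le_sum (fun w hw => by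
      have := h.st hw
      have := h1 w hw
      omega)
    rw [Finset.sum_const, smul_eq_mul] at e4
    omega
  · push Not at hz
    have e1 : ∑ w ∈ D l, tt U D l w = ∑ w ∈ D l, 1 := Finset.sum_congr rfl (fun w hw => by
      have := h.st hw
      have := h1 w hw
      have := hz w hw
      omega)
    rw [Finset.sum_const, smul_eq_mul] at e1
    have e2 : ∃ m ∈ U l, tt D U l m = 0 := by
      by_contra hc
      push Not at hc
      have : ∑ m ∈ U l, 1 ≤ ∑ m ∈ U l, tt D U l m := Finset.sum_le_sum (fun m hm => by
        have := hc m hm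
        omega)
      rw [Finset.sum_const, smul_eq_mul, h.hU] at this
      omega
    obtain ⟨m, hm, hm0⟩ := e2
    refine h.good hm hm0 (by omega) (fun v hv l' hl' => ?_)
    have := ht v hv l' hl'
    have := h1 v hv
    have := hz v hv
    omega

end TD
end

section
namespace TD
variable {P : Type} {D U : P → Finset P} {rk : P → ℕ}

/-- The neighbours of `x`. -/
noncomputable def Nb (D U : P → Finset P) (x : P) : Finset P :=
  (D x).biUnion (fun v => (U v).erase x)

theorem Ax.mem_Nb (h : Ax D U rk) {x y : P} : y ∈ Nb D U x ↔ Adj D x y := by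
  unfold Nb Adj
  simp only [Finset.mem_biUnion, Finset.mem_erase]
  constructor
  · rintro ⟨v, h1, h2, h3⟩
    exact ⟨h2.symm, v, h1, (h.mem _ _).2 h3⟩
  · rintro ⟨h1, v, h2, h3⟩
    exact ⟨v, h2, h1.symm, (h.mem _ _).1 h3⟩

theorem Ax.sum_Nb (h : Ax D U rk) (x : P) (F : P → ℕ) :
    ∑ v ∈ D x, ∑ y ∈ U v, F y = (D x).card * F x + ∑ y ∈ Nb D U x, F y := by
  have e1 : ∑ y ∈ Nb D U x, F y = ∑ v ∈ D x, ∑ y ∈ (U v).erase x, F y := by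
    unfold Nb
    apply Finset.sum_biUnion
    intro v hv w hw hvw
    rw [Function.onFun, Finset.disjoint_left]
    intro y hy hy'
    rw [Finset.mem_erase] at hy hy'
    exact hvw (h.loc.uD hy.1 ((h.mem _ _).2 hy.2) hv ((h.mem _ _).2 hy'.2) hw)
  rw [e1, ← smul_eq_mul, ← Finset.sum_const, ← Finset.sum_add_distrib]
  apply Finset.sum_congr rfl
  intro v hv
  exact (Finset.add_sum_erase _ _ ((h.mem _ _).1 hv)).symm

theorem Ax.card_Nb (h : Ax D U rk) (x : P) :
    (Nb D U x).card + (D x).card = ∑ v ∈ D x, ((D v).card + 1) := by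
  have := h.sum_Nb x (fun _ => 1)
  simp only [Finset.sum_const, smul_eq_mul, mul_one, h.hU] at this
  omega

theorem Ax.card_Nb_bd (h : Ax D U rk) (x : P) :
    (D x).card * (D x).card ≤ (Nb D U x).card + (D x).card ∧
    (Nb D U x).card + (D x).card ≤ (D x).card * ((D x).card + 2) := by
  rw [h.card_Nb]
  constructor
  · rw [← smul_eq_mul, ← Finset.sum_const]
    apply Finset.sum_le_sum
    intro v hv
    have := h.D_le hv
    omega
  · rw [← smul_eq_mul (D x).card, ← Finset.sum_const]
    apply Finset.sum_le_sum
    intro v hv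
    have := h.D_le hv
    omega

/-- Degree function. -/
structure Dg (D U : P → Finset P) (rk : P → ℕ) (f : P → ℕ) : Prop where
  pos : ∀ x, 0 < f x
  down : ∀ x, 0 < rk x → f x = ∑ v ∈ D x, f v
  up : ∀ v, (rk v + 1) * f v = ∑ x ∈ U v, f x

variable {f : P → ℕ}

theorem Dg.eig (h : Ax D U rk) (d : Dg D U rk f) (x : P) (hx : 0 < rk x) :
    rk x * f x = (D x).card * f x + ∑ y ∈ Nb D U x, f y := by
  rw [← h.sum_Nb, d.down x hx, Finset.mul_sum]
  apply Finset.sum_congr rfl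
  intro v hv
  rw [← d.up, h.rk hv]

theorem Dg.le (h : Ax D U rk) (d : Dg D U rk f) {v x : P} (hv : v ∈ D x) : f v ≤ f x := by
  rw [d.down x (by have := h.rk hv; omega)]
  exact Finset.single_le_sum (f := f) (fun _ _ => Nat.zero_le _) hv

theorem Dg.R_le (h : Ax D U rk) (d : Dg D U rk f) (x : P) (hx : 0 < rk x) :
    2 * (D x).card ≤ rk x + 1 := by
  have e1 := h.sum_Nb x f
  have e2 := d.eig h x hx
  have e3 : ∑ v ∈ D x, ((D x).card - 1) * f v ≤ ∑ v ∈ D x, ∑ y ∈ (U v).erase x, f y := by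
    apply Finset.sum_le_sum
    intro v hv
    have k1 : ∑ y ∈ (U v).erase x, f v ≤ ∑ y ∈ (U v).erase x, f y := Finset.sum_le_sum
      (fun y hy => d.le h ((h.mem _ _).2 (Finset.mem_of_mem_erase hy)))
    rw [Finset.sum_const, smul_eq_mul] at k1
    refine le_trans (Nat.mul_le_mul_right _ ?_) k1
    have k2 := Finset.card_erase_add_one ((h.mem _ _).1 hv)
    have k3 := h.hU v
    have k4 := h.D_le hv
    omega
  have e4 : ∑ v ∈ D x, ∑ y ∈ U v, f y = (D x).card * f x +
      ∑ v ∈ D x, ∑ y ∈ (U v).erase x, f y := by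
    rw [← smul_eq_mul, ← Finset.sum_const, ← Finset.sum_add_distrib]
    apply Finset.sum_congr rfl
    intro v hv
    exact (Finset.add_sum_erase _ _ ((h.mem _ _).1 hv)).symm
  rw [← Finset.mul_sum, ← d.down x hx] at e3
  have e5 : ((D x).card + ((D x).card - 1)) * f x ≤ rk x * f x := by
    rw [add_mul]
    omega
  have := Nat.le_of_mul_le_mul_right e5 (d.pos x)
  omega

end TD
end

section
namespace TD
variable {P : Type} {D U : P → Finset P} {rk : P → ℕ} {f : P → ℕ} {t : P → P}

/-- Weight of small neighbours. -/
noncomputable def WW (D U : P → Finset P) (f : P → ℕ) (b : ℕ) (x : P) : ℕ :=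
  ∑ y ∈ (Nb D U x).filter (fun y => f y < b), f y

theorem Ax.rk_Nb (h : Ax D U rk) {x y : P} (hy : y ∈ Nb D U x) : rk y = rk x := by
  obtain ⟨_, w, h1, h2⟩ := h.mem_Nb.1 hy
  rw [h.rk h1, h.rk h2]

theorem Dg.Q_ge (h : Ax D U rk) (d : Dg D U rk f) {n b : ℕ} (hn : 0 < n) (La : Finset P)
    (hLa : ∀ x, x ∈ La ↔ rk x = n) :
    b * ∑ x ∈ La.filter (fun x => b ≤ f x), WW D U f b x ≤
      n * ∑ x ∈ La.filter (fun x => f x < b), f x ^ 2 := by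
  have e1 : ∑ x ∈ La.filter (fun x => b ≤ f x), WW D U f b x =
      ∑ y ∈ La.filter (fun x => f x < b), ((Nb D U y).filter (fun x => b ≤ f x)).card * f y := by
    have a1 : ∀ x ∈ La.filter (fun x => b ≤ f x), WW D U f b x =
        ∑ y ∈ La.filter (fun x => f x < b), if Adj D x y then f y else 0 := by
      intro x hx
      rw [Finset.mem_filter, hLa] at hx
      unfold WW
      rw [← Finset.sum_filter]
      apply Finset.sum_congr _ (fun _ _ => rfl)
      ext y
      simp only [Finset.mem_filter, h.mem_Nb, hLa]
      constructor
      · rintro ⟨h1, h2⟩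
        exact ⟨⟨(h.rk_Nb (h.mem_Nb.2 h1)).trans hx.1, h2⟩, h1⟩
      · rintro ⟨⟨_, h2⟩, h1⟩
        exact ⟨h1, h2⟩
    rw [Finset.sum_congr rfl a1, Finset.sum_comm]
    apply Finset.sum_congr rfl
    intro y hy
    rw [Finset.mem_filter, hLa] at hy
    rw [← Finset.sum_filter, Finset.sum_const, smul_eq_mul]
    congr 2
    ext x
    simp only [Finset.mem_filter, h.mem_Nb, hLa]
    constructor
    · rintro ⟨⟨_, h2⟩, h1⟩
      exact ⟨h1.symm, h2⟩
    · rintro ⟨h1, h2⟩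
      exact ⟨⟨(h.rk_Nb (h.mem_Nb.2 h1)).trans hy.1, h2⟩, h1.symm⟩
  rw [e1, Finset.mul_sum, Finset.mul_sum]
  apply Finset.sum_le_sum
  intro y hy
  rw [Finset.mem_filter, hLa] at hy
  have e2 := d.eig h y (by omega)
  rw [hy.1] at e2
  have e3 : ∑ x ∈ (Nb D U y).filter (fun x => b ≤ f x), b ≤
      ∑ x ∈ (Nb D U y).filter (fun x => b ≤ f x), f x :=
    Finset.sum_le_sum (fun x hx => (Finset.mem_filter.1 hx).2)
  have e4 : ∑ x ∈ (Nb D U y).filter (fun x => b ≤ f x), f x ≤ ∑ x ∈ Nb D U y, f x :=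
    Finset.sum_le_sum_of_subset (Finset.filter_subset _ _)
  rw [Finset.sum_const, smul_eq_mul] at e3
  have e5 : ((Nb D U y).filter (fun x => b ≤ f x)).card * b ≤ n * f y := by omega
  calc b * (((Nb D U y).filter (fun x => b ≤ f x)).card * f y)
      = (((Nb D U y).filter (fun x => b ≤ f x)).card * b) * f y := by ring
    _ ≤ n * f y * f y := Nat.mul_le_mul_right _ e5
    _ = n * f y ^ 2 := by ring

theorem Dg.split (h : Ax D U rk) (d : Dg D U rk f) (b : ℕ) (x : P) (hx : 0 < rk x) :
    rk x * f x = (D x).card * f x + ∑ y ∈ (Nb D U x).filter (fun y => b ≤ f y), f y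
      + WW D U f b x := by
  rw [d.eig h x hx, add_assoc]
  congr 1
  have := Finset.sum_filter_add_sum_filter_not (Nb D U x) (fun y => b ≤ f y) f
  rw [← this]
  unfold WW
  simp only [not_le]

/-- If `W = 0`, all neighbours are large. -/
theorem WW_zero (d : Dg D U rk f) {b : ℕ} {x : P} (h0 : WW D U f b x = 0) :
    ∀ y ∈ Nb D U x, b ≤ f y := by
  intro y hy
  by_contra hc
  unfold WW at h0
  rw [Finset.sum_eq_zero_iff] at h0
  have := h0 y (by simp [hy]; omega)
  have := d.pos y
  omega

theorem arith1 {r R n : ℕ} (hn : 200 ≤ n) (h1 : r * r ≤ n) (h2 : R ≤ r + 2)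
    (h3 : 127 * n ≤ 64 * (R * R) + 192 * R) : False := by
  have h4 : R * R ≤ (r + 2) * (r + 2) := Nat.mul_le_mul h2 h2
  have h5 : 127 * n ≤ 64 * (r * r) + 448 * r + 640 := by
    calc 127 * n ≤ 64 * ((r + 2) * (r + 2)) + 192 * (r + 2) := by omega
      _ = 64 * (r * r) + 448 * r + 640 := by ring
  have h6 : r ≤ 8 := by
    by_contra hc
    push Not at hc
    have : 9 * r ≤ r * r := Nat.mul_le_mul_right r hc
    omega
  have h7 : r * r ≤ 8 * 8 := Nat.mul_le_mul h6 h6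
  omega

/-- Case 2. -/
theorem case2 (h : Ax D U rk) (T : Tau D U rk t) (d : Dg D U rk f) {n b : ℕ} (hn : 200 ≤ n)
    (hb : 0 < b) (La : Finset P)
    (hLa : ∀ x, x ∈ La ↔ rk x = n) (h1 : ∀ x ∈ La, t x ≠ x → f x ≤ b)
    (c : P → ℕ) (hc : ∀ x ∈ La, b ≤ f x → WW D U f b x = b * c x) (l : P) (hl : l ∈ La)
    (hfl : t l = l) (hlb : f l = 2 * b) :
    n ≤ 64 * ∑ x ∈ La.filter (fun x => b ≤ f x), c x := by
  have hrl := (hLa l).1 hl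
  by_contra hcon
  push Not at hcon
  have hcl : c l ≤ ∑ x ∈ La.filter (fun x => b ≤ f x), c x :=
    Finset.single_le_sum (f := c) (fun _ _ => Nat.zero_le _)
      (Finset.mem_filter.2 ⟨hl, by omega⟩)
  have hnf : ∀ y ∈ Nb D U l, t y ≠ y := by
    intro y hy hfy
    obtain ⟨hne, w, w1, w2⟩ := h.mem_Nb.1 hy
    have i1 := T.mapD w1
    have i2 := T.mapD w2
    rw [hfl] at i1
    rw [hfy] at i2
    have hfw : t w = w := h.loc.uD hne i1 i2 w1 w2
    exact hne (h.S T _ w le_rfl hfw l y ((h.mem _ _).1 w1) ((h.mem _ _).1 w2) hfl hfy)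
  have hyL : ∀ y ∈ Nb D U l, y ∈ La := fun y hy => (hLa y).2 ((h.rk_Nb hy).trans hrl)
  have e1 := d.split h b l (by omega)
  have e2 : ∑ y ∈ (Nb D U l).filter (fun y => b ≤ f y), f y =
      ((Nb D U l).filter (fun y => b ≤ f y)).card * b := by
    rw [← smul_eq_mul, ← Finset.sum_const]
    apply Finset.sum_congr rfl
    intro y hy
    rw [Finset.mem_filter] at hy
    exact le_antisymm (h1 y (hyL y hy.1) (hnf y hy.1)) hy.2
  rw [e2, hc l hl (by omega), hrl, hlb] at e1
  set R := (D l).card with hR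
  set N1 := ((Nb D U l).filter (fun y => b ≤ f y)).card with hN1
  have e3 : 2 * n = 2 * R + N1 + c l := by
    apply Nat.eq_of_mul_eq_mul_left hb
    linarith
  have e4 : N1 ≤ (Nb D U l).card := Finset.card_filter_le _ _
  have e5 := (h.card_Nb_bd l).2
  rw [← hR] at e5
  have e6 := d.R_le h l (by omega)
  rw [← hR, hrl] at e6
  have key : ∀ y ∈ (Nb D U l).filter (fun y => b ≤ f y), 1 ≤ c y := by
    intro y hy
    rw [Finset.mem_filter] at hy
    by_contra hc0
    have hyl := hyL y hy.1
    have hry := (hLa y).1 hyl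
    have hw : WW D U f b y = 0 := by
      rw [hc y hyl hy.2]
      have : c y = 0 := by omega
      rw [this, mul_zero]
    have hz := WW_zero d hw
    have g1 := d.eig h y (by omega)
    have g2 : ∑ x ∈ Nb D U y, b ≤ ∑ x ∈ Nb D U y, f x := Finset.sum_le_sum hz
    have hfy : f y = b := le_antisymm (h1 y hyl (hnf y hy.1)) hy.2
    rw [Finset.sum_const, smul_eq_mul] at g2
    rw [hry, hfy] at g1
    have g3 : (D y).card + (Nb D U y).card ≤ n := by
      apply Nat.le_of_mul_le_mul_right _ hb
      rw [add_mul]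
      omega
    have g4 := (h.card_Nb_bd y).1
    obtain ⟨hne, w, w1, w2⟩ := h.mem_Nb.1 hy.1
    have g5 := h.D_le w1
    have g6 := h.D_le w2
    have g7 : R ≤ (D y).card + 2 := by omega
    refine arith1 hn (r := (D y).card) (R := R) (by omega) g7 ?_
    have g8 : R * (R + 2) = R * R + 2 * R := by ring
    omega
  have e7 : ∑ y ∈ (Nb D U l).filter (fun y => b ≤ f y), 1 ≤
      ∑ y ∈ (Nb D U l).filter (fun y => b ≤ f y), c y := Finset.sum_le_sum key
  have e8 : ∑ y ∈ (Nb D U l).filter (fun y => b ≤ f y), c y ≤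
      ∑ x ∈ La.filter (fun x => b ≤ f x), c x := by
    apply Finset.sum_le_sum_of_subset
    apply Finset.filter_subset_filter
    exact hyL
  rw [Finset.sum_const, smul_eq_mul, mul_one] at e7
  omega

end TD
end

section
namespace TD
variable {P : Type} {D U : P → Finset P} {rk : P → ℕ} {f : P → ℕ} {t : P → P}

/-- Case 1. -/
theorem case1 (h : Ax D U rk) (d : Dg D U rk f) {n b : ℕ} (hn : 200 ≤ n)
    (hb : 0 < b) (La : Finset P)
    (hLa : ∀ x, x ∈ La ↔ rk x = n) (h1 : ∀ x ∈ La, f x ≤ b)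
    (c : P → ℕ) (hc : ∀ x ∈ La, b ≤ f x → WW D U f b x = b * c x)
    (hB : ∃ x ∈ La, b ≤ f x) :
    n ≤ 64 * ∑ x ∈ La.filter (fun x => b ≤ f x), c x := by
  by_contra hcon
  push Not at hcon
  set Bd := La.filter (fun x => b ≤ f x ∧ 1 ≤ c x) with hBd
  have hBdc : Bd.card ≤ ∑ x ∈ La.filter (fun x => b ≤ f x), c x := by
    have e1 : ∑ x ∈ Bd, 1 ≤ ∑ x ∈ Bd, c x :=
      Finset.sum_le_sum (fun x hx => (Finset.mem_filter.1 hx).2.2)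
    have e2 : ∑ x ∈ Bd, c x ≤ ∑ x ∈ La.filter (fun x => b ≤ f x), c x := by
      apply Finset.sum_le_sum_of_subset
      intro x hx
      rw [hBd, Finset.mem_filter] at hx
      exact Finset.mem_filter.2 ⟨hx.1, hx.2.1⟩
    rw [Finset.sum_const, smul_eq_mul, mul_one] at e1
    omega
  have hNL : ∀ x ∈ La, ∀ y ∈ Nb D U x, y ∈ La := fun x hx y hy =>
    (hLa y).2 ((h.rk_Nb hy).trans ((hLa x).1 hx))
  -- counting for all elements of `B`
  have hsp : ∀ x ∈ La, b ≤ f x →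
      n = (D x).card + ((Nb D U x).filter (fun y => b ≤ f y)).card + c x := by
    intro x hx hbx
    have hrx := (hLa x).1 hx
    have e1 := d.split h b x (by omega)
    have e2 : ∑ y ∈ (Nb D U x).filter (fun y => b ≤ f y), f y =
        ((Nb D U x).filter (fun y => b ≤ f y)).card * b := by
      rw [← smul_eq_mul, ← Finset.sum_const]
      apply Finset.sum_congr rfl
      intro y hy
      rw [Finset.mem_filter] at hy
      exact le_antisymm (h1 y (hNL x hx y hy.1)) hy.2
    have hfx : f x = b := le_antisymm (h1 x hx) hbx
    rw [e2, hc x hx hbx, hrx, hfx] at e1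
    apply Nat.eq_of_mul_eq_mul_left hb
    linarith
  have hnt : ∀ x ∈ La, b ≤ f x → c x = 0 → (∀ y ∈ Nb D U x, b ≤ f y) ∧
      n = (D x).card + (Nb D U x).card ∧ (D x).card = Nat.sqrt n := by
    intro x hx hbx hcx
    have hw : WW D U f b x = 0 := by rw [hc x hx hbx, hcx, mul_zero]
    have hz := WW_zero d hw
    have e1 := hsp x hx hbx
    rw [Finset.filter_true_of_mem hz, hcx, add_zero] at e1
    refine ⟨hz, e1, ?_⟩
    have e2 := h.card_Nb_bd x
    rw [Nat.eq_sqrt]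
    constructor
    · omega
    · calc n ≤ (D x).card * ((D x).card + 2) := by omega
        _ < ((D x).card + 1) * ((D x).card + 1) := by
          have : ((D x).card + 1) * ((D x).card + 1) = (D x).card * ((D x).card + 2) + 1 := by ring
          omega
  set R := Nat.sqrt n with hR
  have hR14 : 14 ≤ R := by rw [hR, Nat.le_sqrt]; omega
  have hRn : R * R ≤ n := Nat.sqrt_le n
  have hR14' : 14 * R ≤ R * R := Nat.mul_le_mul_right R hR14
  -- existence of an interior element
  have hex : ∃ l ∈ La, b ≤ f l ∧ c l = 0 := by
    by_contra hno
    push Not at hno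
    obtain ⟨x, hx, hbx⟩ := hB
    have e1 := hsp x hx hbx
    have e2 := d.R_le h x (by have := (hLa x).1 hx; omega)
    rw [(hLa x).1 hx] at e2
    have e3 : c x ≤ ∑ x ∈ La.filter (fun x => b ≤ f x), c x :=
      Finset.single_le_sum (f := c) (fun _ _ => Nat.zero_le _) (Finset.mem_filter.2 ⟨hx, hbx⟩)
    have e4 : (Nb D U x).filter (fun y => b ≤ f y) ⊆ Bd := by
      intro y hy
      rw [Finset.mem_filter] at hy
      have hyL := hNL x hx y hy.1
      have := hno y hyL hy.2
      rw [hBd, Finset.mem_filter]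
      exact ⟨hyL, hy.2, by omega⟩
    have e5 := Finset.card_le_card e4
    omega
  -- interior elements have a boundary neighbour
  have hdep : ∀ x ∈ La, b ≤ f x → c x = 0 → ∃ y ∈ Bd, Adj D y x := by
    intro x hx hbx hcx
    by_contra hno
    push Not at hno
    obtain ⟨i1, i2, i3⟩ := hnt x hx hbx hcx
    refine h.depth (l := x) (by omega) (fun v hv y hy => ?_)
    by_cases hyx : y = x
    · rw [hyx]
    have hadj : Adj D x y := ⟨Ne.symm hyx, v, hv, (h.mem _ _).2 hy⟩
    have hyN := h.mem_Nb.2 hadj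
    have hyL := hNL x hx y hyN
    have hcy : c y = 0 := by
      by_contra hcy
      refine hno y ?_ hadj.symm
      rw [hBd, Finset.mem_filter]
      exact ⟨hyL, i1 y hyN, by omega⟩
    rw [(hnt y hyL (i1 y hyN) hcy).2.2, i3]
  -- codegree sums
  have hcod : ∀ x ∈ La, b ≤ f x → c x = 0 →
      (∀ y ∈ Bd, ((Nb D U x).filter (fun z => Adj D y z)).card ≤
        4 + (if Adj D x y then 2 * R else 0)) ∧
      (∀ y ∈ Bd, ((Nb D U x).filter (fun z => Adj D y z)).card ≤ 2 * R) := by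
    intro x hx hbx hcx
    have i3 := (hnt x hx hbx hcx).2.2
    have key : ∀ y ∈ Bd, (Adj D x y → ((Nb D U x).filter (fun z => Adj D y z)).card ≤ 2 * R) ∧
        (¬ Adj D x y → ((Nb D U x).filter (fun z => Adj D y z)).card ≤ 4) := by
      intro y hy
      have hS : ∀ z ∈ (Nb D U x).filter (fun z => Adj D y z), Adj D x z ∧ Adj D y z := by
        intro z hz
        rw [Finset.mem_filter, h.mem_Nb] at hz
        exact hz
      constructor
      · intro ha
        have := h.codeg' ha _ hS
        rwa [i3] at this
      · intro ha
        refine h.codeg ?_ ha _ hS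
        rintro rfl
        rw [hBd, Finset.mem_filter] at hy
        omega
    constructor
    · intro y hy
      have := key y hy
      split_ifs with ha
      · have := this.1 ha; omega
      · have := this.2 ha; omega
    · intro y hy
      have := key y hy
      by_cases ha : Adj D x y
      · exact this.1 ha
      · have := this.2 ha; omega
  -- the number of boundary neighbours
  have hk : ∀ x ∈ La, b ≤ f x → c x = 0 →
      n ≤ R + 4 * Bd.card + (Bd.filter (fun y => Adj D x y)).card * (2 * R + 1) := by
    intro x hx hbx hcx
    obtain ⟨i1, i2, i3⟩ := hnt x hx hbx hcx
    have hsub : Nb D U x ⊆ (Bd.filter (fun y => Adj D x y)) ∪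
        Bd.biUnion (fun y => (Nb D U x).filter (fun z => Adj D y z)) := by
      intro z hz
      have hzL := hNL x hx z hz
      rw [Finset.mem_union]
      by_cases hcz : c z = 0
      · right
        obtain ⟨y, hy, hyz⟩ := hdep z hzL (i1 z hz) hcz
        rw [Finset.mem_biUnion]
        exact ⟨y, hy, Finset.mem_filter.2 ⟨hz, hyz⟩⟩
      · left
        rw [Finset.mem_filter, hBd, Finset.mem_filter]
        exact ⟨⟨hzL, i1 z hz, by omega⟩, h.mem_Nb.1 hz⟩
    have e1 := Finset.card_le_card hsub
    have e2 := Finset.card_union_le (Bd.filter (fun y => Adj D x y))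
      (Bd.biUnion (fun y => (Nb D U x).filter (fun z => Adj D y z)))
    have e3 : (Bd.biUnion (fun y => (Nb D U x).filter (fun z => Adj D y z))).card ≤
        ∑ y ∈ Bd, ((Nb D U x).filter (fun z => Adj D y z)).card := Finset.card_biUnion_le
    have e4 : ∑ y ∈ Bd, ((Nb D U x).filter (fun z => Adj D y z)).card ≤
        ∑ y ∈ Bd, (4 + (if Adj D x y then 2 * R else 0)) :=
      Finset.sum_le_sum (hcod x hx hbx hcx).1
    rw [Finset.sum_add_distrib, Finset.sum_const, smul_eq_mul, ← Finset.sum_filter,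
      Finset.sum_const, smul_eq_mul] at e4
    rw [mul_add, mul_one]
    omega
  obtain ⟨l, hl, hbl, hcl⟩ := hex
  obtain ⟨i1, i2, i3⟩ := hnt l hl hbl hcl
  set I := (Nb D U l).filter (fun z => c z = 0) with hI
  have hIcard : n ≤ R + Bd.card + I.card := by
    have e1 := Finset.card_filter_add_card_filter_not (s := Nb D U l) (fun z => c z = 0)
    have e2 : (Nb D U l).filter (fun z => ¬ c z = 0) ⊆ Bd := by
      intro z hz
      rw [Finset.mem_filter] at hz
      rw [hBd, Finset.mem_filter]
      exact ⟨hNL l hl z hz.1, i1 z hz.1, by omega⟩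
    have e3 := Finset.card_le_card e2
    have e4 : I.card = ((Nb D U l).filter (fun z => c z = 0)).card := rfl
    omega
  have hdc : ∑ z ∈ I, (Bd.filter (fun y => Adj D z y)).card ≤ Bd.card * (2 * R) := by
    have e1 := Finset.sum_card_bipartiteAbove_eq_sum_card_bipartiteBelow
      (s := I) (t := Bd) (fun z y => Adj D z y)
    unfold Finset.bipartiteAbove Finset.bipartiteBelow at e1
    rw [e1, ← smul_eq_mul, ← Finset.sum_const]
    apply Finset.sum_le_sum
    intro y hy
    refine le_trans (Finset.card_le_card ?_) ((hcod l hl hbl hcl).2 y hy)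
    intro z hz
    rw [Finset.mem_filter, hI, Finset.mem_filter] at hz
    exact Finset.mem_filter.2 ⟨hz.1.1, hz.2.symm⟩
  have hlow : I.card * (n - R - 4 * Bd.card) ≤
      (∑ z ∈ I, (Bd.filter (fun y => Adj D z y)).card) * (2 * R + 1) := by
    rw [Finset.sum_mul, ← smul_eq_mul, ← Finset.sum_const]
    apply Finset.sum_le_sum
    intro z hz
    rw [hI, Finset.mem_filter] at hz
    have := hk z (hNL l hl z hz.1) (i1 z hz.1) hz.2
    omega
  have f1 : I.card * (n - R - 4 * Bd.card) ≤ Bd.card * (2 * R) * (2 * R + 1) :=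
    hlow.trans (Nat.mul_le_mul_right _ hdc)
  have f2 : n ≤ 2 * I.card := by omega
  have f3 : n ≤ 2 * (n - R - 4 * Bd.card) := by omega
  have f4 : n * n ≤ 4 * (I.card * (n - R - 4 * Bd.card)) := by
    calc n * n ≤ (2 * I.card) * (2 * (n - R - 4 * Bd.card)) := Nat.mul_le_mul f2 f3
      _ = _ := by ring
  have f5 : 2 * R * (2 * R + 1) ≤ 6 * n := by
    calc 2 * R * (2 * R + 1) = 4 * (R * R) + 2 * R := by ring
      _ ≤ 6 * n := by omega
  have f6 : Bd.card * (2 * R) * (2 * R + 1) ≤ Bd.card * (6 * n) := by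
    rw [mul_assoc]
    exact Nat.mul_le_mul_left _ f5
  have f7 : n * n ≤ (24 * Bd.card) * n := by
    calc n * n ≤ 4 * (Bd.card * (6 * n)) := by omega
      _ = _ := by ring
  have f8 := Nat.le_of_mul_le_mul_right f7 (by omega)
  omega

theorem main (h : Ax D U rk) (T : Tau D U rk t) (d : Dg D U rk f) {n b : ℕ} (hn : 200 ≤ n)
    (hb : 0 < b) (La : Finset P)
    (hLa : ∀ x, x ∈ La ↔ rk x = n) (h1 : ∀ x ∈ La, t x ≠ x → f x ≤ b)
    (h2 : ∀ x ∈ La, t x = x → f x < b ∨ f x = 2 * b)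
    (hB : ∃ x ∈ La, b ≤ f x) :
    b ^ 2 ≤ 64 * ∑ x ∈ La.filter (fun x => f x < b), f x ^ 2 := by
  have hdiv : ∀ x ∈ La, b ≤ f x → b ∣ f x := by
    intro x hx hbx
    by_cases hf : t x = x
    · rcases h2 x hx hf with e | e
      · omega
      · exact ⟨2, by omega⟩
    · have := h1 x hx hf
      exact ⟨1, by omega⟩
  have hex : ∀ x, ∃ c, x ∈ La → b ≤ f x → WW D U f b x = b * c := by
    intro x
    by_cases hx : x ∈ La ∧ b ≤ f x
    · have hr := (hLa x).1 hx.1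
      have e1 := d.split h b x (by omega)
      have e2 : b ∣ (D x).card * f x + ∑ y ∈ (Nb D U x).filter (fun y => b ≤ f y), f y := by
        apply dvd_add
        · exact Dvd.dvd.mul_left (hdiv x hx.1 hx.2) _
        · apply Finset.dvd_sum
          intro y hy
          rw [Finset.mem_filter] at hy
          exact hdiv y ((hLa y).2 ((h.rk_Nb hy.1).trans hr)) hy.2
      have e3 : b ∣ WW D U f b x := by
        rw [← Nat.dvd_add_right e2, ← e1]
        exact Dvd.dvd.mul_left (hdiv x hx.1 hx.2) _
      obtain ⟨c, hc⟩ := e3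
      exact ⟨c, fun _ _ => hc⟩
    · exact ⟨0, fun h1 h2 => absurd ⟨h1, h2⟩ hx⟩
  choose c hc using hex
  have key : n ≤ 64 * ∑ x ∈ La.filter (fun x => b ≤ f x), c x := by
    by_cases hcase : ∃ x ∈ La, t x = x ∧ f x = 2 * b
    · obtain ⟨x, hx, hfx, hx2⟩ := hcase
      exact case2 h T d hn hb La hLa h1 c hc x hx hfx hx2
    · push Not at hcase
      refine case1 h d hn hb La hLa ?_ c hc hB
      intro x hx
      by_cases hf : t x = x
      · rcases h2 x hx hf with e | e
        · omega
        · exact absurd e (hcase x hx hf)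
      · exact h1 x hx hf
  have e1 := d.Q_ge h (n := n) (b := b) (by omega) La hLa
  have e2 : ∑ x ∈ La.filter (fun x => b ≤ f x), WW D U f b x =
      b * ∑ x ∈ La.filter (fun x => b ≤ f x), c x := by
    rw [Finset.mul_sum]
    apply Finset.sum_congr rfl
    intro x hx
    rw [Finset.mem_filter] at hx
    exact hc x hx.1 hx.2
  rw [e2] at e1
  have e3 : n * b ^ 2 ≤ n * (64 * ∑ x ∈ La.filter (fun x => f x < b), f x ^ 2) := by
    calc n * b ^ 2 ≤ (64 * ∑ x ∈ La.filter (fun x => b ≤ f x), c x) * b ^ 2 :=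
          Nat.mul_le_mul_right _ key
      _ = 64 * (b * (b * ∑ x ∈ La.filter (fun x => b ≤ f x), c x)) := by ring
      _ ≤ 64 * (n * ∑ x ∈ La.filter (fun x => f x < b), f x ^ 2) := Nat.mul_le_mul_left _ e1
      _ = _ := by ring
  exact Nat.le_of_mul_le_mul_left e3 (by omega)

end TD
end

set_option linter.unusedSectionVars false
namespace CT
open Representation
variable {G H : Type} [Group G] [Fintype G] [Group H] [Fintype H]

/-- the scalar product of class functions -/
noncomputable def ip (φ ψ : G → ℂ) : ℂ := (Fintype.card G : ℂ)⁻¹ * ∑ g, φ g * ψ g⁻¹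

/-- characters of finite-dimensional representations -/
def IsCh (φ : G → ℂ) : Prop := ∃ V : FDRep ℂ G, φ = V.character

/-- class functions -/
def IsCl (φ : G → ℂ) : Prop := ∀ g h, φ (h * g * h⁻¹) = φ g

lemma card_ne : (Fintype.card G : ℂ) ≠ 0 := by
  exact_mod_cast Fintype.card_ne_zero

lemma IsCh.cl {φ : G → ℂ} (h : IsCh φ) : IsCl φ := by
  obtain ⟨V, rfl⟩ := h
  intro g k
  exact FDRep.char_conj V g k

lemma isCh_of {V : Type} [AddCommGroup V] [Module ℂ V] [Module.Finite ℂ V]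
    (ρ : Representation ℂ G V) : IsCh (fun g => LinearMap.trace ℂ V (ρ g)) :=
  ⟨FDRep.of ρ, by
    funext g
    rfl⟩

lemma IsCh.rep {φ : G → ℂ} (h : IsCh φ) : ∃ (V : Type) (_ : AddCommGroup V) (_ : Module ℂ V)
    (_ : Module.Finite ℂ V) (ρ : Representation ℂ G V),
    (φ = fun g => LinearMap.trace ℂ V (ρ g)) := by
  obtain ⟨V, rfl⟩ := h
  exact ⟨V, inferInstance, inferInstance, inferInstance, V.ρ, rfl⟩

lemma IsCh.one {φ : G → ℂ} (h : IsCh φ) : ∃ d : ℕ, φ 1 = d := by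
  obtain ⟨V, rfl⟩ := h
  exact ⟨_, FDRep.char_one V⟩

lemma IsCh.comp {φ : G → ℂ} (h : IsCh φ) (f : H →* G) : IsCh (fun x => φ (f x)) := by
  obtain ⟨V, _, _, _, ρ, rfl⟩ := h.rep
  exact isCh_of (ρ.comp f)

lemma IsCh.mul {φ ψ : G → ℂ} (h : IsCh φ) (h' : IsCh ψ) : IsCh (fun x => φ x * ψ x) := by
  obtain ⟨V, _, _, _, ρ, rfl⟩ := h.rep
  obtain ⟨W, _, _, _, σ, rfl⟩ := h'.rep
  have := isCh_of (ρ.tprod σ)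
  convert this using 2 with g
  exact (LinearMap.trace_tensorProduct' _ _).symm

lemma IsCh.inv {φ : G → ℂ} (h : IsCh φ) : IsCh (fun x => φ x⁻¹) := by
  obtain ⟨V, _, _, _, ρ, rfl⟩ := h.rep
  have := isCh_of ρ.dual
  convert this using 2 with g
  rw [Representation.dual_apply]
  exact (LinearMap.trace_transpose' _).symm

lemma isCh_lin (f : G →* ℂ) : IsCh (fun x => f x) := by
  let ρ : Representation ℂ G ℂ := (Algebra.lmul ℂ ℂ).toMonoidHom.comp f
  convert isCh_of ρ using 2 with g
  simp [ρ, LinearMap.trace_eq_matrix_trace ℂ (Module.Basis.singleton Unit ℂ), Matrix.trace,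
    LinearMap.toMatrix_apply]

lemma ip_nat {φ ψ : G → ℂ} (h : IsCh φ) (h' : IsCh ψ) : ∃ m : ℕ, ip φ ψ = m := by
  obtain ⟨V, rfl⟩ := h
  obtain ⟨W, rfl⟩ := h'
  have : Invertible (Nat.card G : ℂ) := invertibleOfNonzero (by simpa using card_ne)
  have := FDRep.scalar_product_char_eq_finrank_equivariant W V
  refine ⟨_, Eq.trans ?_ this⟩
  simp [ip]

lemma irr_iff {φ : G → ℂ} : φ ∈ IrrChar G ↔ IsCh φ ∧ ip φ φ = 1 := by
  have key : ∀ V : FDRep ℂ G, CategoryTheory.Simple V ↔ ip V.character V.character = 1 := by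
    intro V
    rw [FDRep.simple_iff_char_is_norm_one, ip, inv_mul_eq_one₀ card_ne]
    simp [eq_comm]
  constructor
  · rintro ⟨V, hV, rfl⟩
    exact ⟨⟨V, rfl⟩, (key V).1 hV⟩
  · rintro ⟨⟨V, rfl⟩, hV⟩
    exact ⟨V, (key V).2 hV, rfl⟩

lemma orth {χ ψ : G → ℂ} (h : χ ∈ IrrChar G) (h' : ψ ∈ IrrChar G) :
    ip χ ψ = if χ = ψ then 1 else 0 := by
  split_ifs with e
  · subst e; exact (irr_iff.1 h).2
  obtain ⟨V, hV, rfl⟩ := h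
  obtain ⟨W, hW, rfl⟩ := h'
  have : Invertible (Nat.card G : ℂ) := invertibleOfNonzero (by simpa using card_ne)
  have := FDRep.char_orthonormal V W
  rw [if_neg] at this
  · rw [← this]; simp [ip]
  · rintro ⟨i⟩
    exact e (FDRep.char_iso i)

lemma ip_comm (φ ψ : G → ℂ) : ip φ ψ = ip ψ φ := by
  unfold ip
  congr 1
  rw [← Equiv.sum_comp (Equiv.inv G)]
  simp [mul_comm]

/-- the operator attached to a class function vanishes everywhere -/
lemma op_zero (φ : G → ℂ) (hc : IsCl φ) (h0 : ∀ χ ∈ IrrChar G, ∑ g, φ g⁻¹ * χ g = 0) :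
    ∀ (n : ℕ) (V : Type) [AddCommGroup V] [Module ℂ V] [Module.Finite ℂ V]
      (ρ : Representation ℂ G V), Module.finrank ℂ V = n → ∀ v, ∑ g, φ g⁻¹ • ρ g v = 0 := by
  intro n
  induction n using Nat.strong_induction_on with
  | _ n ih =>
  intro V _ _ _ ρ hn v
  by_cases hirr : IsIrreducible ρ
  · let A : V →ₗ[ℂ] V := ∑ g, φ g⁻¹ • ρ g
    have hA : ∀ k w, A (ρ k w) = ρ k (A w) := by
      intro k w
      simp only [A, LinearMap.sum_apply, LinearMap.smul_apply, map_sum, map_smul]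
      rw [← Equiv.sum_comp (MulAut.conj k).toEquiv]
      refine Finset.sum_congr rfl fun g _ => ?_
      have h1 : φ (k * g * k⁻¹)⁻¹ = φ g⁻¹ := by
        rw [← hc g⁻¹ k]; congr 1; group
      simp only [MulEquiv.toEquiv_eq_coe, EquivLike.coe_coe, MulAut.conj_apply]
      rw [h1, ← Module.End.mul_apply, ← map_mul, ← Module.End.mul_apply, ← map_mul]
      simp
    let F : IntertwiningMap ρ ρ := A.intertwiningMap_of_isIntertwiningMap ρ ρ hA
    obtain ⟨c, hcF⟩ := (IsIrreducible.algebraMap_intertwiningMap_bijective_of_isAlgClosed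
      (ρ := ρ)).2 F
    have hcA : ∀ w, A w = c • w := by
      intro w
      have : F w = (algebraMap ℂ (IntertwiningMap ρ ρ) c) w := by rw [hcF]
      exact this.trans (by simp [Algebra.algebraMap_eq_smul_one])
    have hirr2 : (fun g => LinearMap.trace ℂ V (ρ g)) ∈ IrrChar G := by
      rw [irr_iff]
      refine ⟨isCh_of ρ, ?_⟩
      have : Invertible (Nat.card G : ℂ) := invertibleOfNonzero (by simpa using card_ne)
      have := Representation.card_inv_mul_sum_char_mul_char_eq_finrank ρ ρ
      rw [IsIrreducible.finrank_intertwiningMap_self] at this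
      refine Eq.trans ?_ (this.trans (by simp))
      simp [ip, Representation.character]
    have htr : LinearMap.trace ℂ V A = 0 := by
      simpa [A] using h0 _ hirr2
    have hA' : A = c • LinearMap.id := by ext w; simp [hcA w]
    rw [hA'] at htr
    have hz : c = 0 ∨ Module.finrank ℂ V = 0 := by simpa using htr
    have : A v = 0 := by
      rcases hz with hz | hz
      · simp [hcA, hz]
      · have := Module.finrank_zero_iff.1 hz
        exact Subsingleton.elim _ _
    simpa [A] using this
  · rcases subsingleton_or_nontrivial V with hs | hs
    · exact Subsingleton.elim _ _
    have hne : ∃ W : Subrepresentation ρ, W ≠ ⊥ ∧ W ≠ ⊤ := by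
      by_contra hcon
      push Not at hcon
      apply hirr
      have : Nontrivial (Subrepresentation ρ) := by
        refine ⟨⊥, ⊤, fun hbt => ?_⟩
        have := congrArg Subrepresentation.toSubmodule hbt
        exact bot_ne_top (α := Submodule ℂ V) this
      refine { eq_bot_or_eq_top := fun W => ?_ }
      by_cases hW : W = ⊥
      · exact Or.inl hW
      · exact Or.inr (hcon W hW)
    obtain ⟨W, hW1, hW2⟩ := hne
    have : NeZero (Nat.card G : ℂ) := ⟨by simpa using card_ne⟩
    have hss : IsSemisimpleRepresentation ρ := inferInstance
    obtain ⟨W', hW'⟩ := hss.exists_isCompl W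
    have hz : ∀ W : Subrepresentation ρ, W ≠ ⊤ → ∀ w ∈ W.toSubmodule,
        ∑ g, φ g⁻¹ • ρ g w = 0 := by
      intro W hW w hw
      have hlt : Module.finrank ℂ W.toSubmodule < n := by
        rw [← hn]
        apply Submodule.finrank_lt
        intro e
        exact hW (Subrepresentation.toSubmodule_injective e)
      have := ih _ hlt W.toSubmodule W.toRepresentation rfl ⟨w, hw⟩
      have := congrArg (Subtype.val) this
      simpa [Subrepresentation.toRepresentation] using this
    have hW2' : W' ≠ ⊤ := by
      rintro rfl
      exact hW1 (by simpa using hW'.inf_eq_bot)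
    have hv : v ∈ W.toSubmodule ⊔ W'.toSubmodule := by
      have := hW'.sup_eq_top
      have := congrArg Subrepresentation.toSubmodule this
      rw [Subrepresentation.toSubmodule_sup] at this
      rw [this]; exact Submodule.mem_top
    obtain ⟨a, ha, b, hb, rfl⟩ := Submodule.mem_sup.1 hv
    simp only [map_add, smul_add, Finset.sum_add_distrib]
    rw [hz W hW2 a ha, hz W' hW2' b hb, add_zero]

lemma complete (φ : G → ℂ) (hc : IsCl φ) (h0 : ∀ χ ∈ IrrChar G, ip φ χ = 0) : φ = 0 := by
  have h0' : ∀ χ ∈ IrrChar G, ∑ g, φ g⁻¹ * χ g = 0 := by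
    intro χ hχ
    have := h0 χ hχ
    rw [ip_comm, ip] at this
    have := (mul_eq_zero.1 this).resolve_left (inv_ne_zero card_ne)
    rw [← this]
    exact Finset.sum_congr rfl fun g _ => mul_comm _ _
  let ρ : Representation ℂ G (G → ℂ) :=
    { toFun := fun s => LinearMap.funLeft ℂ ℂ (fun t => s⁻¹ * t)
      map_one' := by ext; simp
      map_mul' := fun a b => by
        ext i j
        simp [LinearMap.funLeft_apply, mul_assoc] }
  have := op_zero φ hc h0' _ (G → ℂ) ρ rfl (Pi.single 1 1)
  funext x
  have h2 := congrFun this x⁻¹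
  simp only [ρ, Finset.sum_apply, Pi.smul_apply, MonoidHom.coe_mk, OneHom.coe_mk,
    LinearMap.funLeft_apply, Pi.single_apply, smul_eq_mul, mul_ite, mul_one, mul_zero,
    Pi.zero_apply] at h2
  rw [Finset.sum_eq_single x⁻¹] at h2
  · simpa using h2
  · intro b _ hb
    rw [if_neg]
    intro e
    exact hb (inv_mul_eq_one.1 e)
  · simp

end CT

set_option linter.unusedSectionVars false
namespace CT
variable {G H : Type} [Group G] [Fintype G] [Group H] [Fintype H]

lemma ip_add (φ φ' ψ : G → ℂ) : ip (φ + φ') ψ = ip φ ψ + ip φ' ψ := by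
  simp [ip, add_mul, Finset.sum_add_distrib, mul_add]

lemma ip_sub (φ φ' ψ : G → ℂ) : ip (φ - φ') ψ = ip φ ψ - ip φ' ψ := by
  simp [ip, sub_mul, Finset.sum_sub_distrib, mul_sub]

lemma ip_smul (c : ℂ) (φ ψ : G → ℂ) : ip (c • φ) ψ = c * ip φ ψ := by
  simp only [ip, Pi.smul_apply, smul_eq_mul, mul_assoc, ← Finset.mul_sum]
  ring

lemma ip_sum {ι : Type*} (s : Finset ι) (F : ι → G → ℂ) (ψ : G → ℂ) :
    ip (∑ i ∈ s, F i) ψ = ∑ i ∈ s, ip (F i) ψ := by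
  induction s using Finset.induction_on with
  | empty => simp [ip]
  | insert a s ha ih => rw [Finset.sum_insert ha, Finset.sum_insert ha, ip_add, ih]

lemma irr_finite (G : Type) [Group G] [Fintype G] : (IrrChar G).Finite := by
  have hli : LinearIndependent ℂ (fun x : IrrChar G => x.1) := by
    rw [linearIndependent_iff']
    intro s c hs i hi
    have := congrArg (fun φ => ip φ i.1) hs
    simp only [ip_sum, ip_smul] at this
    rw [Finset.sum_eq_single i] at this
    · rw [orth i.2 i.2, if_pos rfl] at this
      simpa [ip] using this
    · intro b _ hb
      rw [orth b.2 i.2, if_neg (fun e => hb (Subtype.ext e)), mul_zero]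
    · intro h; exact absurd hi h
  have := hli.finite
  exact Set.toFinite _

/-- the finite set of irreducible characters -/
noncomputable def irr (G : Type) [Group G] [Fintype G] : Finset (G → ℂ) :=
  (irr_finite G).toFinset

lemma mem_irr {χ : G → ℂ} : χ ∈ irr G ↔ χ ∈ IrrChar G := by simp [irr]

lemma mem_irr' {χ : G → ℂ} : χ ∈ irr G ↔ IsCh χ ∧ ip χ χ = 1 := by rw [mem_irr, irr_iff]

lemma orth' {χ ψ : G → ℂ} (h : χ ∈ irr G) (h' : ψ ∈ irr G) :
    ip χ ψ = if χ = ψ then 1 else 0 := orth (mem_irr.1 h) (mem_irr.1 h')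

lemma isCh_irr {χ : G → ℂ} (h : χ ∈ irr G) : IsCh χ := (mem_irr'.1 h).1

lemma expand {φ : G → ℂ} (h : IsCl φ) : φ = ∑ χ ∈ irr G, ip φ χ • χ := by
  rw [← sub_eq_zero]
  apply complete
  · intro g k
    simp only [Pi.sub_apply, Finset.sum_apply, Pi.smul_apply]
    rw [h g k]
    congr 1
    refine Finset.sum_congr rfl fun χ hχ => ?_
    rw [(isCh_irr hχ).cl g k]
  · intro χ hχ
    rw [ip_sub, ip_sum, Finset.sum_eq_single χ, ip_smul, orth hχ hχ]
    · simp
    · intro b hb hne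
      rw [ip_smul, orth' hb (mem_irr.2 hχ), if_neg hne, mul_zero]
    · intro h; exact absurd (mem_irr.2 hχ) h

lemma parseval {φ : G → ℂ} (h : IsCl φ) (ψ : G → ℂ) :
    ip φ ψ = ∑ χ ∈ irr G, ip φ χ * ip ψ χ := by
  conv_lhs => rw [expand h, ip_sum]
  refine Finset.sum_congr rfl fun χ hχ => ?_
  rw [ip_smul, ip_comm χ ψ]

/-- column orthogonality -/
lemma column (x y : G) : ∑ χ ∈ irr G, χ x⁻¹ * χ y =
    ((Finset.univ.filter (fun g : G => g * x * g⁻¹ = y)).card : ℂ) := by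
  let φ : G → ℂ := fun y => ((Finset.univ.filter (fun g : G => g * x * g⁻¹ = y)).card : ℂ)
  have hφ : IsCl φ := by
    intro y k
    simp only [φ]
    congr 1
    refine Finset.card_bij (fun g _ => k⁻¹ * g) ?_ ?_ ?_
    · intro g hg
      simp only [Finset.mem_filter, Finset.mem_univ, true_and] at hg ⊢
      calc k⁻¹ * g * x * (k⁻¹ * g)⁻¹ = k⁻¹ * (g * x * g⁻¹) * k := by group
        _ = y := by rw [hg]; group
    · intro a _ b _ h
      exact mul_left_cancel h
    · intro g hg
      simp only [Finset.mem_filter, Finset.mem_univ, true_and] at hg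
      refine ⟨k * g, ?_, by group⟩
      simp only [Finset.mem_filter, Finset.mem_univ, true_and]
      rw [← hg]; group
  have h1 : ∀ χ ∈ irr G, ip φ χ = χ x⁻¹ := by
    intro χ hχ
    have h2 : ∀ g, φ g * χ g⁻¹ = ∑ k : G, if k * x * k⁻¹ = g then χ g⁻¹ else 0 := by
      intro g
      simp only [φ]
      rw [← Finset.sum_filter, Finset.sum_const, nsmul_eq_mul]
    simp only [ip, h2]
    rw [Finset.sum_comm]
    have h3 : ∀ k : G, (∑ g, if k * x * k⁻¹ = g then χ g⁻¹ else 0) = χ x⁻¹ := by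
      intro k
      rw [Finset.sum_ite_eq]
      simp only [Finset.mem_univ, if_true]
      rw [← (isCh_irr hχ).cl x⁻¹ k]
      congr 1; group
    simp only [h3, Finset.sum_const, nsmul_eq_mul, Finset.card_univ]
    rw [inv_mul_cancel_left₀ card_ne]
  have := congrFun (expand hφ) y
  rw [show ((Finset.univ.filter (fun g : G => g * x * g⁻¹ = y)).card : ℂ) = φ y from rfl, this,
    Finset.sum_apply]
  refine Finset.sum_congr rfl fun χ hχ => ?_
  rw [Pi.smul_apply, h1 χ hχ, smul_eq_mul]

/-- number of square roots -/
noncomputable def sqr (x : G) : ℕ := (Finset.univ.filter (fun g : G => g * g = x)).card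

/-- Frobenius-Schur indicator -/
noncomputable def fs (χ : G → ℂ) : ℂ := (Fintype.card G : ℂ)⁻¹ * ∑ g, χ (g * g)

lemma sqr_eq (x : G) : (sqr x : ℂ) = ∑ χ ∈ irr G, fs χ * χ x⁻¹ := by
  let φ : G → ℂ := fun y => (sqr y⁻¹ : ℂ)
  have hφ : IsCl φ := by
    intro y k
    simp only [φ, sqr]
    congr 1
    refine Finset.card_bij (fun g _ => k⁻¹ * g * k) ?_ ?_ ?_
    · intro g hg
      simp only [Finset.mem_filter, Finset.mem_univ, true_and] at hg ⊢
      calc k⁻¹ * g * k * (k⁻¹ * g * k) = k⁻¹ * (g * g) * k := by group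
        _ = y⁻¹ := by rw [hg]; group
    · intro a _ b _ h
      simpa using h
    · intro g hg
      simp only [Finset.mem_filter, Finset.mem_univ, true_and] at hg
      refine ⟨k * g * k⁻¹, ?_, by group⟩
      simp only [Finset.mem_filter, Finset.mem_univ, true_and]
      calc k * g * k⁻¹ * (k * g * k⁻¹) = k * (g * g) * k⁻¹ := by group
        _ = _ := by rw [hg]; group
  have h1 : ∀ χ ∈ irr G, ip φ χ = fs χ := by
    intro χ hχ
    rw [ip, fs]
    congr 1
    rw [← Equiv.sum_comp (Equiv.inv G)]
    have h2 : ∀ g : G, φ g⁻¹ * χ g⁻¹⁻¹ = ∑ k : G, if k * k = g then χ g else 0 := by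
      intro g
      simp only [φ, sqr]
      rw [← Finset.sum_filter, Finset.sum_const, nsmul_eq_mul, inv_inv]
    simp only [Equiv.inv_apply, h2]
    rw [Finset.sum_comm]
    refine Finset.sum_congr rfl fun k _ => ?_
    rw [Finset.sum_ite_eq]
    simp
  have := congrFun (expand hφ) x⁻¹
  rw [show (sqr x : ℂ) = φ x⁻¹ by simp [φ], this, Finset.sum_apply]
  refine Finset.sum_congr rfl fun χ hχ => ?_
  rw [Pi.smul_apply, h1 χ hχ, smul_eq_mul]

end CT

set_option linter.unusedSectionVars false
namespace CT
variable {G H : Type} [Group G] [Fintype G] [Group H] [Fintype H]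

lemma irr_inv {χ : G → ℂ} (h : χ ∈ irr G) : (fun g => χ g⁻¹) ∈ irr G := by
  rw [mem_irr'] at h ⊢
  refine ⟨h.1.inv, ?_⟩
  rw [← h.2, ip_comm]
  unfold ip
  congr 1
  exact Finset.sum_congr rfl fun g _ => by
    show χ g⁻¹ * χ g⁻¹⁻¹ = _
    rw [inv_inv, mul_comm]

lemma sandwich_apply {ι : Type} [Fintype ι] [DecidableEq ι] (A : Matrix ι ι ℂ) (a b i j : ι) :
    (A * Matrix.single a b (1 : ℂ) * A.transpose : Matrix ι ι ℂ) i j = A i a * A j b := by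
  rw [Matrix.mul_apply, Finset.sum_eq_single b]
  · simp [Matrix.mul_apply, Matrix.single_apply]
  · intro k _ hk
    simp [Matrix.mul_apply, Matrix.single_apply, hk.symm]
  · simp

lemma trace_sandwich {ι : Type} [Fintype ι] [DecidableEq ι] (A : Matrix ι ι ℂ) :
    LinearMap.trace ℂ (Matrix ι ι ℂ)
      (LinearMap.mulLeft ℂ A ∘ₗ LinearMap.mulRight ℂ A.transpose) = A.trace * A.trace := by
  rw [LinearMap.trace_eq_matrix_trace ℂ (Matrix.stdBasis ℂ ι ι), Matrix.trace]
  simp only [Matrix.diag_apply, LinearMap.toMatrix_apply]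
  rw [Fintype.sum_prod_type, Matrix.trace, Finset.sum_mul_sum]
  refine Finset.sum_congr rfl fun i _ => Finset.sum_congr rfl fun j _ => ?_
  rw [Matrix.stdBasis_eq_single, LinearMap.comp_apply, LinearMap.mulRight_apply,
    LinearMap.mulLeft_apply, ← Matrix.mul_assoc]
  exact sandwich_apply A i j i j

lemma fs_le_aux {χ : G → ℂ} (h : χ ∈ irr G) {ι : Type} [Fintype ι] [DecidableEq ι]
    (M : G → Matrix ι ι ℂ) (hM1 : M 1 = 1) (hMm : ∀ x y, M (x * y) = M x * M y)
    (hχ : ∀ g, χ g = (M g).trace) : ‖fs χ‖ ≤ 1 := by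
  let σ : Representation ℂ G (Matrix ι ι ℂ) :=
    { toFun := fun g => LinearMap.mulLeft ℂ (M g) ∘ₗ LinearMap.mulRight ℂ (M g).transpose
      map_one' := by
        ext1 X
        simp [hM1]
      map_mul' := fun x y => by
        refine LinearMap.ext fun X => ?_
        simp [hMm, Matrix.mul_assoc] }
  have hσ : ∀ g X, σ g X = M g * X * (M g).transpose := by
    intro g X
    simp [σ, Matrix.mul_assoc]
  have : Invertible (Nat.card G : ℂ) := invertibleOfNonzero (by simpa using card_ne)
  have hrk : Module.finrank ℂ σ.invariants ≤ 1 := by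
    have h1 := Representation.card_inv_mul_sum_char_eq_finrank σ
    have h2 : (Nat.card G : ℂ)⁻¹ * ∑ g, σ.character g = ip χ (fun g => χ g⁻¹) := by
      rw [ip, Nat.card_eq_fintype_card]
      congr 1
      refine Finset.sum_congr rfl fun g _ => ?_
      rw [inv_inv, hχ]
      exact trace_sandwich _
    have h3 := h2.symm.trans h1
    rw [orth' h (irr_inv h)] at h3
    split_ifs at h3
    · exact (by exact_mod_cast h3.symm : Module.finrank ℂ σ.invariants = 1).le
    · exact (by exact_mod_cast h3.symm : Module.finrank ℂ σ.invariants = 0).le.trans zero_le_one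
  obtain ⟨X0, hX0⟩ := (finrank_le_one_iff).1 hrk
  let P : Matrix ι ι ℂ → Matrix ι ι ℂ := fun X => (Fintype.card G : ℂ)⁻¹ • ∑ g, σ g X
  have hPi : ∀ X, ∀ g, σ g (P X) = P X := by
    intro X g
    simp only [P, map_smul, map_sum]
    congr 1
    conv_rhs => rw [← Equiv.sum_comp (Equiv.mulLeft g)]
    refine Finset.sum_congr rfl fun k _ => ?_
    simp
  have hPc : ∀ X, ∃ c : ℂ, P X = c • X0.1 := by
    intro X
    obtain ⟨c, hc⟩ := hX0 ⟨P X, fun g => hPi X g⟩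
    exact ⟨c, (congrArg Subtype.val hc).symm⟩
  choose c hc using hPc
  have hfs : fs χ = ∑ i, ∑ j, c (Matrix.single j i 1) * X0.1 i j := by
    have h1 : ∀ i j, c (Matrix.single j i 1) * X0.1 i j = P (Matrix.single j i 1) i j := by
      intro i j
      rw [hc]; simp
    have h2 : ∀ i j, P (Matrix.single j i 1) i j
        = (Fintype.card G : ℂ)⁻¹ * ∑ g, M g i j * M g j i := by
      intro i j
      simp only [P, Matrix.smul_apply, Matrix.sum_apply, smul_eq_mul, hσ]
      congr 1
      refine Finset.sum_congr rfl fun g _ => ?_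
      exact sandwich_apply (M g) _ _ _ _
    simp only [h1, h2, ← Finset.mul_sum]
    rw [fs]
    congr 1
    simp only [hχ, hMm, Matrix.trace, Matrix.diag_apply, Matrix.mul_apply]
    rw [Finset.sum_comm]
    refine Finset.sum_congr rfl fun i _ => ?_
    rw [Finset.sum_comm]
  have hinv0 : ∀ g, M g * X0.1 * (M g).transpose = X0.1 := by
    intro g; rw [← hσ]; exact X0.2 g
  have hinvT : ∀ g, σ g X0.1.transpose = X0.1.transpose := by
    intro g
    rw [hσ]
    conv_rhs => rw [← hinv0 g]
    simp [Matrix.transpose_mul, Matrix.mul_assoc]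
  have hPT : P X0.1.transpose = X0.1.transpose := by
    simp only [P, hinvT, Finset.sum_const, Finset.card_univ]
    rw [← Nat.cast_smul_eq_nsmul ℂ, smul_smul, inv_mul_cancel₀ card_ne, one_smul]
  have hPlin : P X0.1.transpose = fs χ • X0.1 := by
    have e1 : X0.1.transpose = ∑ i, ∑ j, X0.1 i j • Matrix.single j i (1 : ℂ) := by
      conv_lhs => rw [Matrix.matrix_eq_sum_single X0.1.transpose]
      rw [Finset.sum_comm]
      simp
    have e2 : P X0.1.transpose = ∑ i, ∑ j, X0.1 i j • P (Matrix.single j i (1 : ℂ)) := by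
      rw [e1]
      simp only [P, map_sum, map_smul, Finset.smul_sum]
      rw [Finset.sum_comm]
      refine Finset.sum_congr rfl fun i _ => ?_
      rw [Finset.sum_comm]
      refine Finset.sum_congr rfl fun j _ => Finset.sum_congr rfl fun g _ => ?_
      rw [smul_comm]
    rw [e2, hfs]
    simp only [hc, Finset.sum_smul, smul_smul]
    simp only [mul_comm]
  by_cases hz : X0.1 = 0
  · have : fs χ = 0 := by rw [hfs]; simp [hz]
    simp [this]
  have hT : X0.1.transpose = fs χ • X0.1 := hPT.symm.trans hPlin
  have hTT : X0.1 = (fs χ * fs χ) • X0.1 := by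
    have := congrArg Matrix.transpose hT
    rw [Matrix.transpose_transpose, Matrix.transpose_smul, hT, smul_smul] at this
    exact this
  have : (fs χ * fs χ - 1) • X0.1 = 0 := by
    rw [sub_smul, one_smul, ← hTT, sub_self]
  have h1 := (smul_eq_zero.1 this).resolve_right hz
  have h2 : ‖fs χ‖ * ‖fs χ‖ = 1 := by
    rw [← norm_mul, sub_eq_zero.1 h1, norm_one]
  nlinarith [norm_nonneg (fs χ)]

lemma fs_le {χ : G → ℂ} (h : χ ∈ irr G) : ‖fs χ‖ ≤ 1 := by
  obtain ⟨V, _, _, _, ρ, hρ⟩ := (isCh_irr h).rep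
  let b := Module.finBasis ℂ V
  refine fs_le_aux h (fun g => LinearMap.toMatrixAlgEquiv b (ρ g)) (by simp) (by simp) ?_
  intro g
  rw [hρ]
  simp only
  rw [LinearMap.trace_eq_matrix_trace ℂ b]
  rfl

end CT

set_option linter.unusedSectionVars false
namespace CT
variable {G K : Type} [Group G] [Fintype G] [Group K] [Fintype K]

lemma flip_conj {a g : G} (h : a * g * a⁻¹ = g⁻¹) : a⁻¹ * g * a = g⁻¹ := by
  have h1 : a * g⁻¹ * a⁻¹ = g := by
    calc a * g⁻¹ * a⁻¹ = (a * g * a⁻¹)⁻¹ := by group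
      _ = g := by rw [h, inv_inv]
  calc a⁻¹ * g * a = a⁻¹ * (a * g⁻¹ * a⁻¹) * a := by rw [h1]
    _ = g⁻¹ := by group

lemma gel_S1 (f : K →* G) : ∑ χ ∈ irr G, ∑ ν ∈ irr K, ip (fun k => χ (f k)) ν ^ 2 =
    (Fintype.card K : ℂ)⁻¹ * ∑ g : G,
      ((Finset.univ.filter (fun k : K => f k * g * (f k)⁻¹ = g)).card : ℂ) := by
  have h1 : ∀ χ ∈ irr G, ∑ ν ∈ irr K, ip (fun k => χ (f k)) ν ^ 2
      = (Fintype.card K : ℂ)⁻¹ * ∑ k, χ (f k)⁻¹ * χ (f k) := by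
    intro χ hχ
    have := parseval ((isCh_irr hχ).comp f).cl (fun k => χ (f k))
    simp only [sq]
    rw [← this, ip]
    congr 1
    refine Finset.sum_congr rfl fun k _ => ?_
    rw [map_inv, mul_comm]
  rw [Finset.sum_congr rfl h1, ← Finset.mul_sum, Finset.sum_comm]
  congr 1
  simp only [column]
  simp only [Finset.card_filter]
  push_cast
  rw [Finset.sum_comm]
  refine Finset.sum_congr rfl fun g _ => Finset.sum_congr rfl fun k _ => ?_
  have : g * f k * g⁻¹ = f k ↔ f k * g * (f k)⁻¹ = g := by
    rw [mul_inv_eq_iff_eq_mul, mul_inv_eq_iff_eq_mul, eq_comm]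
  simp only [this]

lemma gel_S2 (f : K →* G) : ∑ χ ∈ irr G, ∑ ν ∈ irr K, ip (fun k => χ (f k)) ν * (fs χ * fs ν) =
    (Fintype.card K : ℂ)⁻¹ * ∑ g : G,
      ((Finset.univ.filter (fun k : K => f k * g * (f k)⁻¹ = g⁻¹)).card : ℂ) := by
  have h1 : ∑ χ ∈ irr G, ∑ ν ∈ irr K, ip (fun k => χ (f k)) ν * (fs χ * fs ν)
      = (Fintype.card K : ℂ)⁻¹ * ∑ k, (sqr (f k)⁻¹ : ℂ) * (sqr k : ℂ) := by
    simp only [sqr_eq, inv_inv, ip]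
    simp only [mul_assoc, ← Finset.mul_sum]
    congr 1
    simp only [Finset.sum_mul, Finset.mul_sum]
    symm
    rw [Finset.sum_comm]
    rw [Finset.sum_congr rfl (fun y _ => Finset.sum_comm), Finset.sum_comm]
    refine Finset.sum_congr rfl fun χ _ => ?_
    refine Finset.sum_congr rfl fun ν _ => Finset.sum_congr rfl fun k _ => ?_
    ring
  rw [h1]
  congr 1
  have h2 : ∀ k : K, (sqr (f k)⁻¹ : ℂ) * (sqr k : ℂ)
      = ∑ h : K, if h * h = k then (sqr (f (h * h))⁻¹ : ℂ) else 0 := by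
    intro k
    rw [← Finset.sum_filter, Finset.sum_congr rfl (g := fun _ => (sqr (f k)⁻¹ : ℂ))]
    · rw [Finset.sum_const, nsmul_eq_mul, mul_comm]; rfl
    · intro h hh
      rw [(Finset.mem_filter.1 hh).2]
  simp only [h2]
  rw [Finset.sum_comm]
  simp only [Finset.sum_ite_eq, Finset.mem_univ, if_true, sqr, Finset.card_filter]
  push_cast
  rw [Finset.sum_comm (s := (Finset.univ : Finset G))]
  refine Finset.sum_congr rfl fun k _ => ?_
  rw [← Equiv.sum_comp (Equiv.mulRight (f k)⁻¹)]
  refine Finset.sum_congr rfl fun g _ => ?_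
  have : Equiv.mulRight (f k)⁻¹ g * Equiv.mulRight (f k)⁻¹ g = (f (k * k))⁻¹ ↔
      f k * g * (f k)⁻¹ = g⁻¹ := by
    rw [Equiv.coe_mulRight, map_mul]
    generalize f k = a
    constructor
    · intro h
      have h3 : g * a⁻¹ * (g * a⁻¹) * a * a = 1 := by rw [h]; group
      have h4 : a⁻¹ * g * a = g⁻¹ := by
        rw [eq_comm, inv_eq_iff_mul_eq_one, ← h3]; simp only [mul_assoc]
        simp
      have h5 : a⁻¹ * g * a⁻¹⁻¹ = g⁻¹ := by rw [inv_inv]; exact h4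
      have h6 := flip_conj h5
      rwa [inv_inv] at h6
    · intro h
      have h4 : a⁻¹ * g * a = g⁻¹ := flip_conj h
      calc g * a⁻¹ * (g * a⁻¹) = g * (a⁻¹ * g * a) * a⁻¹ * a⁻¹ := by group
        _ = _ := by rw [h4]; group
  simp only [this]

/-- Gelfand's criterion in character form -/
theorem gelfand (f : K →* G) (hf : ∀ g : G, ∃ k : K, f k * g * (f k)⁻¹ = g⁻¹)
    {χ : G → ℂ} {ν : K → ℂ} (hχ : χ ∈ irr G) (hν : ν ∈ irr K) {m : ℕ}
    (hm : ip (fun k => χ (f k)) ν = m) : m ≤ 1 := by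
  have heq : ∑ χ ∈ irr G, ∑ ν ∈ irr K, ip (fun k => χ (f k)) ν ^ 2 =
      ∑ χ ∈ irr G, ∑ ν ∈ irr K, ip (fun k => χ (f k)) ν * (fs χ * fs ν) := by
    rw [gel_S1, gel_S2]
    congr 1
    refine Finset.sum_congr rfl fun g _ => ?_
    congr 1
    obtain ⟨k0, hk0⟩ := hf g
    refine Finset.card_bij (fun k _ => k0 * k) ?_ ?_ ?_
    · intro k hk
      simp only [Finset.mem_filter, Finset.mem_univ, true_and] at hk ⊢
      rw [← hk0, map_mul]
      conv_rhs => rw [← hk]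
      group
    · intro a _ b _ h; exact mul_left_cancel h
    · intro k hk
      simp only [Finset.mem_filter, Finset.mem_univ, true_and] at hk
      refine ⟨k0⁻¹ * k, ?_, by group⟩
      simp only [Finset.mem_filter, Finset.mem_univ, true_and]
      rw [map_mul, map_inv]
      calc (f k0)⁻¹ * f k * g * ((f k0)⁻¹ * f k)⁻¹ = (f k0)⁻¹ * (f k * g * (f k)⁻¹) * f k0 := by group
        _ = (f k0)⁻¹ * (f k0 * g * (f k0)⁻¹) * f k0 := by rw [hk, hk0]
        _ = g := by group
  have hre : ∑ χ ∈ irr G, ∑ ν ∈ irr K, (ip (fun k => χ (f k)) ν ^ 2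
      - ip (fun k => χ (f k)) ν * (fs χ * fs ν)).re = 0 := by
    have := congrArg Complex.re (sub_eq_zero.2 heq)
    simpa only [← Finset.sum_sub_distrib, Complex.re_sum, Complex.zero_re] using this
  have hb : ∀ χ ∈ irr G, ∀ ν ∈ irr K, (fs χ * fs ν).re ≤ 1 := by
    intro χ hχ ν hν
    refine (Complex.re_le_norm _).trans ?_
    rw [norm_mul]
    exact mul_le_one₀ (fs_le hχ) (norm_nonneg _) (fs_le hν)
  have hform : ∀ χ ∈ irr G, ∀ ν ∈ irr K, ∀ m : ℕ, ip (fun k => χ (f k)) ν = m →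
      (ip (fun k => χ (f k)) ν ^ 2 - ip (fun k => χ (f k)) ν * (fs χ * fs ν)).re
        = (m : ℝ) ^ 2 - m * (fs χ * fs ν).re := by
    intro χ _ ν _ m hm
    rw [hm, Complex.sub_re, Complex.mul_re, Complex.natCast_re, Complex.natCast_im, zero_mul, sub_zero]
    congr 1
    exact_mod_cast Complex.natCast_re (m ^ 2)
  have hnn : ∀ χ ∈ irr G, ∀ ν ∈ irr K, 0 ≤ (ip (fun k => χ (f k)) ν ^ 2
      - ip (fun k => χ (f k)) ν * (fs χ * fs ν)).re := by
    intro χ hχ ν hν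
    obtain ⟨m, hm⟩ := ip_nat ((isCh_irr hχ).comp f) (isCh_irr hν)
    rw [hform χ hχ ν hν m hm]
    have := hb χ hχ ν hν
    rcases Nat.eq_zero_or_pos m with h0 | h0
    · simp [h0]
    · have : (1 : ℝ) ≤ m := by exact_mod_cast h0
      nlinarith
  have h1 := (Finset.sum_eq_zero_iff_of_nonneg
    (fun χ hχ => Finset.sum_nonneg (hnn χ hχ))).1 hre χ hχ
  have h2 := (Finset.sum_eq_zero_iff_of_nonneg (hnn χ hχ)).1 h1 ν hν
  rw [hform χ hχ ν hν m hm] at h2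
  have := hb χ hχ ν hν
  by_contra hcon
  have : (2 : ℝ) ≤ m := by exact_mod_cast (by omega : 2 ≤ m)
  nlinarith

end CT

set_option linter.unusedSectionVars false
namespace CT
variable {β : Type} [Fintype β]

lemma zpow_transfer (g : Equiv.Perm β) {p q : β} (h : g.SameCycle p q) {k l : ℤ}
    (e : (g ^ k) p = (g ^ l) p) : (g ^ k) q = (g ^ l) q := by
  obtain ⟨i, rfl⟩ := h
  rw [← Equiv.Perm.mul_apply, ← zpow_add, add_comm, zpow_add, Equiv.Perm.mul_apply, e,
    ← Equiv.Perm.mul_apply, ← zpow_add, add_comm, zpow_add, Equiv.Perm.mul_apply]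

lemma zpow_neg_transfer (g : Equiv.Perm β) {p q : β} (h : g.SameCycle p q) {k l : ℤ}
    (e : (g ^ k) p = (g ^ l) p) : (g ^ (-k)) q = (g ^ (-l)) q := by
  have e' := zpow_transfer g h e
  have : (g ^ (-k - l)) ((g ^ k) q) = (g ^ (-k - l)) ((g ^ l) q) := by rw [e']
  rw [← Equiv.Perm.mul_apply, ← zpow_add, ← Equiv.Perm.mul_apply, ← zpow_add] at this
  rw [show -k - l + k = -l by ring, show -k - l + l = -k by ring] at this
  exact this.symm

lemma perm_rev (g : Equiv.Perm β) (a b : β) : ∃ t : Equiv.Perm β, t * g * t⁻¹ = g⁻¹ ∧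
    ((t a = a ∧ t b = b) ∨ (t a = b ∧ t b = a)) := by
  let r : β → β := fun x =>
    @Quotient.out _ (Equiv.Perm.SameCycle.setoid g) (@Quotient.mk _ (Equiv.Perm.SameCycle.setoid g) x)
  have hr : ∀ x, g.SameCycle (r x) x := fun x =>
    @Quotient.exact _ (Equiv.Perm.SameCycle.setoid g) _ _
      (@Quotient.out_eq _ (Equiv.Perm.SameCycle.setoid g) _)
  have hr2 : ∀ x y, g.SameCycle x y → r x = r y := by
    intro x y h
    simp only [r]
    congr 1
    exact @Quotient.sound _ (Equiv.Perm.SameCycle.setoid g) _ _ h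
  let p : β → β := fun x => if g.SameCycle a x then a else if g.SameCycle b x then b else r x
  let q : β → β := fun x => if g.SameCycle a x then (if g.SameCycle a b then b else a)
    else if g.SameCycle b x then b else r x
  have hcl : ∀ x y z, g.SameCycle x y → (g.SameCycle z x ↔ g.SameCycle z y) := fun x y z h =>
    ⟨fun h' => h'.trans h, fun h' => h'.trans h.symm⟩
  have hp : ∀ x, g.SameCycle (p x) x := by
    intro x; simp only [p]; split_ifs <;> first | assumption | exact hr x
  have hq : ∀ x, g.SameCycle (q x) x := by
    intro x; simp only [q]; split_ifs with h1 h2 h3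
    · exact h2.symm.trans h1
    · exact h1
    · exact h3
    · exact hr x
  have hp2 : ∀ x y, g.SameCycle x y → p x = p y := by
    intro x y h
    simp only [p, hcl x y _ h, hr2 x y h]
  have hq2 : ∀ x y, g.SameCycle x y → q x = q y := by
    intro x y h
    simp only [q, hcl x y _ h, hr2 x y h]
  have hpq : ∀ x, g.SameCycle (p x) (q x) := fun x => (hp x).trans (hq x).symm
  choose k hk using hp
  let t0 : β → β := fun x => (g ^ (-(k x))) (q x)
  have key : ∀ (x : β) (l : ℤ), x = (g ^ l) (p x) → t0 x = (g ^ (-l)) (q x) := by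
    intro x l h
    exact zpow_neg_transfer g (hpq x) ((hk x).trans h : (g ^ k x) (p x) = (g ^ l) (p x))
  have ht0 : ∀ x, g.SameCycle (t0 x) x := by
    intro x
    exact (Equiv.Perm.SameCycle.symm ⟨-(k x), rfl⟩ : g.SameCycle (t0 x) (q x)).trans (hq x)
  have hinj : Function.Injective t0 := by
    intro x y h
    have hxy : g.SameCycle x y := (ht0 x).symm.trans (h ▸ ht0 y)
    have h1 : (g ^ (-(k x))) (q x) = (g ^ (-(k y))) (q x) := by
      rw [hq2 x y hxy]
      have : t0 x = t0 y := h
      simp only [t0] at this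
      rw [hq2 x y hxy] at this
      exact this
    have h2 := zpow_neg_transfer g (hpq x).symm h1
    rw [neg_neg, neg_neg, hk x, hp2 x y hxy, hk y] at h2
    exact h2
  let t : Equiv.Perm β := Equiv.ofBijective t0 (Finite.injective_iff_bijective.1 hinj)
  have ht : ∀ x, t x = t0 x := fun x => rfl
  refine ⟨t, ?_, ?_⟩
  · rw [mul_inv_eq_iff_eq_mul]
    ext x
    rw [Equiv.Perm.mul_apply, Equiv.Perm.mul_apply, ht, ht]
    have hs : g.SameCycle (g x) x := Equiv.Perm.sameCycle_apply_left.2 (Equiv.Perm.SameCycle.refl g x)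
    rw [key (g x) (1 + k x), hq2 _ _ hs]
    · simp only [t0]
      rw [neg_add, zpow_add, Equiv.Perm.mul_apply, zpow_neg_one]
    · rw [hp2 _ _ hs, zpow_add, Equiv.Perm.mul_apply, hk x, zpow_one]
  · have haa : g.SameCycle a a := Equiv.Perm.SameCycle.refl g a
    have hbb : g.SameCycle b b := Equiv.Perm.SameCycle.refl g b
    by_cases hab : g.SameCycle a b
    · right
      have hpa : p a = a := by simp [p, haa]
      have hpb : p b = a := by simp [p, hab, hbb]
      have hqa : q a = b := by simp [q, hab, haa, hbb]
      have hqb : q b = b := by simp [q, hab, haa, hbb]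
      constructor
      · rw [ht, key a 0 (by simp [hpa])]; simp [hqa]
      · obtain ⟨i, hi⟩ := hab
        rw [ht, key b i (by rw [hpb, hi]), hqb, ← hi, ← Equiv.Perm.mul_apply, ← zpow_add]
        simp
    · left
      have hpa : p a = a := by simp [p, haa]
      have hpb : p b = b := by simp [p, hab, hbb]
      have hqa : q a = a := by simp [q, hab, haa, hbb]
      have hqb : q b = b := by simp [q, hab, haa, hbb]
      exact ⟨by rw [ht, key a 0 (by simp [hpa])]; simp [hqa],
        by rw [ht, key b 0 (by simp [hpb])]; simp [hqb]⟩

end CT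

set_option linter.unusedSectionVars false
namespace CT
variable {G K L : Type} [Group G] [Fintype G] [Group K] [Fintype K] [Group L] [Fintype L]

/-- multiplicity in restriction -/
noncomputable def mu (i : K →* G) (ν : K → ℂ) (χ : G → ℂ) : ℂ := ip (fun k => χ (i k)) ν

/-- auxiliary intertwining number -/
noncomputable def FF (i : K →* G) (ν ν' : K → ℂ) (g : G) : ℂ :=
  ∑ k, ∑ k', if g * i k * g⁻¹ = i k' then ν k⁻¹ * ν' k' else 0

lemma mack1 (i : K →* G) (ν ν' : K → ℂ) :
    ∑ χ ∈ irr G, mu i ν χ * mu i ν' χ =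
      (Fintype.card K : ℂ)⁻¹ * (Fintype.card K : ℂ)⁻¹ * ∑ g, FF i ν ν' g := by
  have h1 : ∀ χ ∈ irr G, mu i ν χ * mu i ν' χ = (Fintype.card K : ℂ)⁻¹ * (Fintype.card K : ℂ)⁻¹ *
      ∑ k, ∑ k', ν k * ν' k' * (χ (i k)⁻¹ * χ (i k')⁻¹) := by
    intro χ _
    unfold mu
    rw [ip_comm, ip_comm _ ν', ip, ip, mul_mul_mul_comm, Finset.sum_mul_sum]
    congr 1
    refine Finset.sum_congr rfl fun k _ => Finset.sum_congr rfl fun k' _ => ?_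
    rw [map_inv, map_inv]; ring
  rw [Finset.sum_congr rfl h1, ← Finset.mul_sum]
  congr 1
  rw [Finset.sum_comm]
  unfold FF
  rw [Finset.sum_comm (s := (Finset.univ : Finset G))]
  rw [← Equiv.sum_comp (Equiv.inv K)]
  refine Finset.sum_congr rfl fun k _ => ?_
  rw [Finset.sum_comm, Finset.sum_comm (s := (Finset.univ : Finset G))]
  refine Finset.sum_congr rfl fun k' _ => ?_
  rw [← Finset.mul_sum]
  have h2 : ∑ χ ∈ irr G, χ (i k⁻¹)⁻¹ * χ (i k')⁻¹
      = ((Finset.univ.filter (fun g : G => g * i k⁻¹ * g⁻¹ = (i k')⁻¹)).card : ℂ) :=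
    column _ _
  simp only [Equiv.inv_apply]
  rw [h2, ← Finset.sum_filter, Finset.sum_const, nsmul_eq_mul, mul_comm]
  congr 3
  ext g
  simp only [Finset.mem_filter, Finset.mem_univ, true_and]
  rw [← inv_inj (a := g * i k * g⁻¹)]
  have : (g * i k * g⁻¹)⁻¹ = g * i k⁻¹ * g⁻¹ := by rw [map_inv]; group
  rw [this]

lemma FF_left (i : K →* G) {ν ν' : K → ℂ} (hν' : IsCl ν') (a : K) (g : G) :
    FF i ν ν' (i a * g) = FF i ν ν' g := by
  unfold FF
  refine Finset.sum_congr rfl fun k _ => ?_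
  rw [← Equiv.sum_comp (MulAut.conj a).toEquiv]
  refine Finset.sum_congr rfl fun k' _ => ?_
  simp only [MulEquiv.toEquiv_eq_coe, EquivLike.coe_coe, MulAut.conj_apply]
  rw [hν' k' a]
  have : i a * g * i k * (i a * g)⁻¹ = i (a * k' * a⁻¹) ↔ g * i k * g⁻¹ = i k' := by
    rw [map_mul, map_mul, map_inv]
    rw [show i a * g * i k * (i a * g)⁻¹ = i a * (g * i k * g⁻¹) * (i a)⁻¹ by group]
    simp
  simp only [this]

lemma FF_right (i : K →* G) {ν ν' : K → ℂ} (hν : IsCl ν) (a : K) (g : G) :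
    FF i ν ν' (g * i a) = FF i ν ν' g := by
  unfold FF
  conv_rhs => rw [← Equiv.sum_comp (MulAut.conj a).toEquiv]
  refine Finset.sum_congr rfl fun k _ => ?_
  refine Finset.sum_congr rfl fun k' _ => ?_
  simp only [MulEquiv.toEquiv_eq_coe, EquivLike.coe_coe, MulAut.conj_apply]
  have h1 : ν (a * k * a⁻¹)⁻¹ = ν k⁻¹ := by
    rw [← hν k⁻¹ a]; congr 1; group
  rw [h1]
  have : g * i a * i k * (g * i a)⁻¹ = g * i (a * k * a⁻¹) * g⁻¹ := by
    rw [map_mul, map_mul, map_inv]; group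
  exact if_congr (by rw [this]) rfl rfl

lemma FF_in (i : K →* G) (hi : Function.Injective i) {ν ν' : K → ℂ} (hν' : IsCl ν') (a : K) :
    FF i ν ν' (i a) = Fintype.card K * ip ν' ν := by
  have := FF_left i (ν := ν) hν' a 1
  rw [mul_one] at this
  rw [this, FF, ip, mul_inv_cancel_left₀ card_ne]
  refine Finset.sum_congr rfl fun k _ => ?_
  simp only [one_mul, inv_one, mul_one, hi.eq_iff]
  rw [Finset.sum_ite_eq]
  simp [mul_comm]

/-- if `i` is onto, the Mackey sum is trivial -/
lemma mack0 (i : K →* G) (hi : Function.Bijective i) {ν ν' : K → ℂ} (hν : ν ∈ irr K)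
    (hν' : ν' ∈ irr K) :
    ∑ χ ∈ irr G, mu i ν χ * mu i ν' χ = if ν = ν' then 1 else 0 := by
  rw [mack1, ← (Equiv.ofBijective i hi).sum_comp]
  simp only [Equiv.ofBijective_apply, FF_in i hi.1 (isCh_irr hν').cl, Finset.sum_const,
    Finset.card_univ, nsmul_eq_mul]
  rw [ip_comm, orth' hν hν']
  have := card_ne (G := K)
  field_simp

lemma FF_s (j : L →* K) (i : K →* G) (hi : Function.Injective i) (hj : Function.Injective j)
    (s : G) (hs : s * s = 1) (hc : ∀ x, s * i (j x) = i (j x) * s)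
    (hin : ∀ k k', s * i k * s = i k' → ∃ x, k = j x) {ν ν' : K → ℂ} :
    FF i ν ν' s = Fintype.card L * ip (fun x => ν' (j x)) (fun x => ν (j x)) := by
  have hsi : s⁻¹ = s := inv_eq_of_mul_eq_one_left hs
  rw [FF, ip, mul_inv_cancel_left₀ card_ne, hsi]
  have h1 : ∀ k, k ∉ Finset.univ.image j →
      (∑ k', if s * i k * s = i k' then ν k⁻¹ * ν' k' else 0) = 0 := by
    intro k hk
    refine Finset.sum_eq_zero fun k' _ => ?_
    rw [if_neg]
    intro h
    obtain ⟨x, rfl⟩ := hin k k' h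
    exact hk (Finset.mem_image_of_mem _ (Finset.mem_univ _))
  rw [← Finset.sum_subset (Finset.subset_univ (Finset.univ.image j)) (fun k _ hk => h1 k hk),
    Finset.sum_image (fun a _ b _ h => hj h)]
  refine Finset.sum_congr rfl fun x _ => ?_
  have : s * i (j x) * s = i (j x) := by rw [hc, mul_assoc, hs, mul_one]
  simp only [this, hi.eq_iff]
  rw [Finset.sum_ite_eq]
  simp [mul_comm]

/-- Mackey formula for a doubly transitive situation -/
lemma mackey (j : L →* K) (i : K →* G) (hi : Function.Injective i) (hj : Function.Injective j)
    (s : G) (hs : s * s = 1) (hc : ∀ x, s * i (j x) = i (j x) * s)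
    (hin : ∀ k k', s * i k * s = i k' → ∃ x, k = j x)
    (hout : ∀ g, (∃ k, g = i k) ∨ ∃ a b, g = i a * s * i b)
    (hcard : Fintype.card G * Fintype.card L =
      Fintype.card K * Fintype.card L + Fintype.card K * Fintype.card K)
    {ν ν' : K → ℂ} (hν : ν ∈ irr K) (hν' : ν' ∈ irr K) :
    ∑ χ ∈ irr G, mu i ν χ * mu i ν' χ =
      (if ν = ν' then 1 else 0) + ∑ κ ∈ irr L, mu j κ ν * mu j κ ν' := by
  have hcν := (isCh_irr hν).cl
  have hcν' := (isCh_irr hν').cl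
  have hp : ∑ κ ∈ irr L, mu j κ ν * mu j κ ν' = ip (fun x => ν' (j x)) (fun x => ν (j x)) := by
    rw [ip_comm, parseval ((isCh_irr hν).comp j).cl]
    rfl
  rw [mack1, hp]
  set c := ip (fun x => ν' (j x)) (fun x => ν (j x)) with hcdef
  have hsum : ∑ g, FF i ν ν' g = ∑ g ∈ Finset.univ.image i, (Fintype.card K : ℂ) * ip ν' ν
      + ∑ g ∈ Finset.univ \ Finset.univ.image i, (Fintype.card L : ℂ) * c := by
    rw [← Finset.sum_sdiff (Finset.subset_univ (Finset.univ.image i)), add_comm]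
    congr 1
    · refine Finset.sum_congr rfl fun g hg => ?_
      obtain ⟨k, _, rfl⟩ := Finset.mem_image.1 hg
      exact FF_in i hi hcν' k
    · refine Finset.sum_congr rfl fun g hg => ?_
      rcases hout g with ⟨k, rfl⟩ | ⟨a, b, rfl⟩
      · exact absurd (Finset.mem_image_of_mem _ (Finset.mem_univ _)) (Finset.mem_sdiff.1 hg).2
      · rw [FF_right i hcν, FF_left i hcν', FF_s j i hi hj s hs hc hin]
  have hc1 : (Finset.univ.image i).card = Fintype.card K := by
    rw [Finset.card_image_of_injective _ hi, Finset.card_univ]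
  have hc2 : (Finset.univ \ Finset.univ.image i).card + Fintype.card K = Fintype.card G := by
    rw [← hc1, Finset.card_sdiff_add_card_eq_card (Finset.subset_univ _), Finset.card_univ]
  have hc3 : (Finset.univ \ Finset.univ.image i).card * Fintype.card L =
      Fintype.card K * Fintype.card K := by
    rw [← hc2, add_mul] at hcard
    omega
  rw [hsum, Finset.sum_const, Finset.sum_const, nsmul_eq_mul, nsmul_eq_mul, hc1, ← mul_assoc,
    ← mul_assoc]
  have hc4 : ((Finset.univ \ Finset.univ.image i).card : ℂ) * Fintype.card L =
      Fintype.card K * Fintype.card K := by exact_mod_cast hc3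
  rw [hc4, ip_comm ν' ν, orth' hν hν']
  have := card_ne (G := K)
  field_simp

lemma up_sum (i : K →* G) (hi : Function.Injective i) (ν : K → ℂ) :
    ∑ χ ∈ irr G, mu i ν χ * χ 1 = (Fintype.card K : ℂ)⁻¹ * Fintype.card G * ν 1 := by
  have h1 : ∀ χ ∈ irr G, mu i ν χ * χ 1 = (Fintype.card K : ℂ)⁻¹ *
      ∑ k, ν k * (χ (i k)⁻¹ * χ 1) := by
    intro χ _
    rw [mu, ip_comm, ip, mul_assoc, Finset.sum_mul]
    congr 1
    refine Finset.sum_congr rfl fun k _ => ?_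
    rw [map_inv]; ring
  rw [Finset.sum_congr rfl h1, ← Finset.mul_sum, Finset.sum_comm, mul_assoc]
  congr 1
  simp only [← Finset.mul_sum, column]
  rw [Finset.sum_eq_single 1]
  · simp [mul_comm]
  · intro k _ hk
    rw [Finset.filter_false_of_mem]
    · simp
    · intro g _ h
      have : i k = 1 := by simpa using h
      exact hk (hi (this.trans (map_one i).symm))
  · simp

lemma down_sum (i : K →* G) {χ : G → ℂ} (hχ : IsCh χ) :
    χ 1 = ∑ ν ∈ irr K, mu i ν χ * ν 1 := by
  have := congrFun (expand (hχ.comp i).cl) 1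
  simp only [map_one, Finset.sum_apply, Pi.smul_apply, smul_eq_mul] at this
  exact this

lemma mu_comp (j : L →* K) (i : K →* G) {χ : G → ℂ} (hχ : IsCh χ) (κ : L → ℂ) :
    ∑ ν ∈ irr K, mu j κ ν * mu i ν χ = mu (i.comp j) κ χ := by
  have h := expand (hχ.comp i).cl
  have h2 : (fun x => χ ((i.comp j) x)) = ∑ ν ∈ irr K, mu i ν χ • (fun x => ν (j x)) := by
    funext x
    have := congrFun h (j x)
    simp only [Finset.sum_apply, Pi.smul_apply] at this ⊢
    exact this
  rw [mu, h2, ip_sum]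
  refine Finset.sum_congr rfl fun ν _ => ?_
  rw [ip_smul, mul_comm]; rfl

lemma mu_nat (i : K →* G) {ν : K → ℂ} {χ : G → ℂ} (hν : ν ∈ irr K) (hχ : IsCh χ) :
    ∃ m : ℕ, mu i ν χ = m := ip_nat (hχ.comp i) (isCh_irr hν)

/-- multiplicity at most two, with a commuting involution -/
lemma mu_le_two (i : K →* G) (s : G) (hs : s * s = 1) (hc : ∀ k, s * i k = i k * s)
    (hf : ∀ g : G, ∃ k, i k * g * (i k)⁻¹ = g⁻¹ ∨ (i k * s) * g * (i k * s)⁻¹ = g⁻¹)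
    {ν : K → ℂ} {χ : G → ℂ} (hν : ν ∈ irr K) (hχ : χ ∈ irr G) {m : ℕ} (hm : mu i ν χ = m) :
    m ≤ 2 := by
  let σ : ℤˣ →* G :=
    { toFun := fun e => if e = 1 then 1 else s
      map_one' := by simp
      map_mul' := by
        intro a b
        rcases Int.units_eq_one_or a with rfl | rfl <;>
        rcases Int.units_eq_one_or b with rfl | rfl <;> simp [hs] }
  have hσ1 : σ 1 = 1 := map_one σ
  have hσ2 : σ (-1) = s := by simp [σ]
  let f : K × ℤˣ →* G :=
    { toFun := fun p => i p.1 * σ p.2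
      map_one' := by simp
      map_mul' := by
        rintro ⟨a, e⟩ ⟨b, e'⟩
        simp only [Prod.mk_mul_mk, map_mul]
        have : σ e * i b = i b * σ e := by
          rcases Int.units_eq_one_or e with rfl | rfl
          · simp
          · rw [hσ2, hc]
        rw [mul_assoc, mul_assoc, ← mul_assoc (i b), ← this]
        simp only [mul_assoc] }
  have hf' : ∀ g : G, ∃ p : K × ℤˣ, f p * g * (f p)⁻¹ = g⁻¹ := by
    intro g
    obtain ⟨k, h | h⟩ := hf g
    · exact ⟨(k, 1), by simpa [f] using h⟩
    · exact ⟨(k, -1), by simpa [f, hσ2] using h⟩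
  let sg : K × ℤˣ →* ℂ :=
    { toFun := fun p => ((p.2 : ℤ) : ℂ)
      map_one' := by simp
      map_mul' := by intro a b; simp }
  let ν1 : K × ℤˣ → ℂ := fun p => ν p.1
  let ν2 : K × ℤˣ → ℂ := fun p => ν p.1 * sg p
  have hcardp : (Fintype.card (K × ℤˣ) : ℂ) = Fintype.card K * 2 := by
    rw [Fintype.card_prod]; simp
  have hnorm := (mem_irr'.1 hν).2
  have hsumZ : ∀ F : K × ℤˣ → ℂ, ∑ p, F p = ∑ k, (F (k, 1) + F (k, -1)) := by
    intro F
    rw [Fintype.sum_prod_type]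
    refine Finset.sum_congr rfl fun k _ => ?_
    rw [show (Finset.univ : Finset ℤˣ) = {1, -1} from rfl, Finset.sum_pair (by decide)]
  have hν1 : ν1 ∈ irr (K × ℤˣ) := by
    rw [mem_irr']
    refine ⟨(isCh_irr hν).comp (MonoidHom.fst K ℤˣ), ?_⟩
    rw [← hnorm, ip, ip, hsumZ, hcardp]
    simp only [ν1, Prod.fst_inv, ← two_mul, ← Finset.mul_sum]
    have := card_ne (G := K)
    field_simp
  have hν2 : ν2 ∈ irr (K × ℤˣ) := by
    rw [mem_irr']
    refine ⟨((isCh_irr hν).comp (MonoidHom.fst K ℤˣ)).mul (isCh_lin sg), ?_⟩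
    rw [← hnorm, ip, ip, hsumZ, hcardp]
    simp only [ν2, sg, Prod.fst_inv, Prod.snd_inv, MonoidHom.coe_mk, OneHom.coe_mk]
    simp only [inv_one, Units.val_one, Int.cast_one, mul_one, inv_neg, Units.val_neg, Int.cast_neg,
      mul_neg, neg_mul, neg_neg, ← two_mul, ← Finset.mul_sum]
    have := card_ne (G := K)
    field_simp
  obtain ⟨m1, hm1⟩ := mu_nat f hν1 (isCh_irr hχ)
  obtain ⟨m2, hm2⟩ := mu_nat f hν2 (isCh_irr hχ)
  have h1 := gelfand f hf' hχ hν1 hm1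
  have h2 := gelfand f hf' hχ hν2 hm2
  have hadd : mu i ν χ = mu f ν1 χ + mu f ν2 χ := by
    unfold mu ip
    rw [← mul_add, ← Finset.sum_add_distrib, hsumZ, hcardp]
    simp only [ν1, ν2, f, sg, Prod.fst_inv, Prod.snd_inv, MonoidHom.coe_mk, OneHom.coe_mk, hσ1]
    simp only [inv_one, Units.val_one, Int.cast_one, mul_one, inv_neg, Units.val_neg, Int.cast_neg,
      mul_neg, neg_mul, neg_neg, add_neg_cancel, add_zero, ← two_mul, ← Finset.mul_sum]
    have := card_ne (G := K)
    field_simp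
  rw [hm, hm1, hm2] at hadd
  have : m = m1 + m2 := by exact_mod_cast hadd
  omega

end CT

set_option linter.unusedSectionVars false
namespace CT
open Equiv

section Deg
variable {G K : Type} [Group G] [Fintype G] [Group K] [Fintype K]

/-- degree of a character -/
noncomputable def deg (χ : G → ℂ) : ℕ := ⌊(χ 1).re⌋₊

lemma deg_spec {χ : G → ℂ} (h : IsCh χ) : χ 1 = deg χ := by
  obtain ⟨d, hd⟩ := h.one
  rw [deg, hd]; simp

lemma deg_pos {χ : G → ℂ} (h : χ ∈ irr G) : 0 < deg χ := by
  rcases Nat.eq_zero_or_pos (deg χ) with h0 | h0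
  swap
  · exact h0
  exfalso
  have h1 := deg_spec (isCh_irr h)
  rw [h0] at h1
  have h2 := (mem_irr'.1 h).2
  obtain ⟨V, _, _, _, ρ, rfl⟩ := (isCh_irr h).rep
  have h3 : Module.finrank ℂ V = 0 := by
    have : LinearMap.trace ℂ V (ρ 1) = Module.finrank ℂ V := by simp
    have h4 : LinearMap.trace ℂ V (ρ 1) = ((0 : ℕ) : ℂ) := h1
    rw [this] at h4
    exact_mod_cast h4
  have : Subsingleton V := Module.finrank_zero_iff.1 h3
  have h5 : ∀ g, ρ g = 0 := fun g => LinearMap.ext fun v => Subsingleton.elim _ _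
  simp [ip, h5] at h2

end Deg

/-- embedding of symmetric groups -/
def iota (n : ℕ) : Perm (Fin n) →* Perm (Fin (n + 1)) where
  toFun k := Equiv.Perm.decomposeFin.symm (0, k)
  map_one' := by simp; rfl
  map_mul' a b := by
    ext x
    refine Fin.cases ?_ (fun y => ?_) x <;> simp

lemma iota_zero {n : ℕ} (k : Perm (Fin n)) : iota n k 0 = 0 := by simp [iota]
lemma iota_succ {n : ℕ} (k : Perm (Fin n)) (x : Fin n) : iota n k x.succ = (k x).succ := by
  simp [iota]
lemma iota_sign {n : ℕ} (k : Perm (Fin n)) : Perm.sign (iota n k) = Perm.sign k := by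
  simp [iota]
lemma iota_inj (n : ℕ) : Function.Injective (iota n) := by
  intro a b h
  have := Equiv.Perm.decomposeFin.symm.injective h
  exact (Prod.mk.inj this).2
lemma iota_range {n : ℕ} {g : Perm (Fin (n + 1))} (h : g 0 = 0) : ∃ k, g = iota n k := by
  refine ⟨(Equiv.Perm.decomposeFin g).2, ?_⟩
  have h1 : Equiv.Perm.decomposeFin.symm (Equiv.Perm.decomposeFin g) = g :=
    Equiv.symm_apply_apply _ _
  have h2 : (Equiv.Perm.decomposeFin g).1 = 0 := by
    rw [← Equiv.Perm.decomposeFin_symm_apply_zero (Equiv.Perm.decomposeFin g).1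
      (Equiv.Perm.decomposeFin g).2]
    exact (congrArg (fun e : Perm (Fin (n + 1)) => e 0) h1).trans h
  conv_lhs => rw [← h1]
  change _ = Equiv.Perm.decomposeFin.symm (0, _)
  rw [← h2]

/-- the basic transposition -/
def ss (n : ℕ) : Perm (Fin (n + 2)) := swap 0 1

lemma ss_mul (n : ℕ) : ss n * ss n = 1 := by simp [ss]
lemma iota2_one {n : ℕ} (x : Perm (Fin n)) : iota (n + 1) (iota n x) 1 = 1 := by
  have := iota_succ (iota n x) 0
  rw [iota_zero, Fin.succ_zero_eq_one] at this
  exact this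
lemma ss_comm (n : ℕ) (x : Perm (Fin n)) :
    ss n * iota (n + 1) (iota n x) = iota (n + 1) (iota n x) * ss n := by
  rw [ss, Equiv.mul_swap_eq_swap_mul, iota_zero, iota2_one]
lemma ss_zero (n : ℕ) : ss n 0 = 1 := by simp [ss]
lemma ss_one (n : ℕ) : ss n 1 = 0 := by simp [ss]

lemma ss_in (n : ℕ) (k k' : Perm (Fin (n + 1)))
    (h : ss n * iota (n + 1) k * ss n = iota (n + 1) k') : ∃ x, k = iota n x := by
  apply iota_range
  have h1 := congrArg (fun e : Perm (Fin (n + 2)) => e 0) h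
  simp only [Perm.mul_apply, iota_zero, ss_zero] at h1
  rw [← ss_one n] at h1
  have h2 := (ss n).injective h1
  rw [← Fin.succ_zero_eq_one, iota_succ] at h2
  exact Fin.succ_injective _ h2

lemma ss_out (n : ℕ) (g : Perm (Fin (n + 2))) :
    (∃ k, g = iota (n + 1) k) ∨ ∃ a b, g = iota (n + 1) a * ss n * iota (n + 1) b := by
  by_cases h : g 0 = 0
  · exact Or.inl (iota_range h)
  right
  obtain ⟨d, hd⟩ := Fin.exists_succ_eq_of_ne_zero h
  have h1 : iota (n + 1) (swap 0 d) 1 = g 0 := by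
    rw [← Fin.succ_zero_eq_one, iota_succ, swap_apply_left, hd]
  have h3 : ∀ a : Perm (Fin (n + 2)), a⁻¹ (a 1) = 1 := fun a => a.symm_apply_apply 1
  have h2 : (ss n * (iota (n + 1) (swap 0 d))⁻¹ * g) 0 = 0 := by
    rw [Perm.mul_apply, Perm.mul_apply, ← h1, h3, ss_one]
  obtain ⟨b, hb⟩ := iota_range h2
  refine ⟨swap 0 d, b, ?_⟩
  rw [← hb]
  have := ss_mul n
  rw [mul_assoc, mul_assoc, ← mul_assoc (ss n) (ss n), this]
  group

lemma perm_card (n : ℕ) : Fintype.card (Perm (Fin n)) = n.factorial := by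
  rw [Fintype.card_perm, Fintype.card_fin]

lemma tower_mackey (n : ℕ) {ν ν' : Perm (Fin (n + 1)) → ℂ} (hν : ν ∈ irr (Perm (Fin (n + 1))))
    (hν' : ν' ∈ irr (Perm (Fin (n + 1)))) :
    ∑ χ ∈ irr (Perm (Fin (n + 2))), mu (iota (n + 1)) ν χ * mu (iota (n + 1)) ν' χ =
      (if ν = ν' then 1 else 0) +
        ∑ κ ∈ irr (Perm (Fin n)), mu (iota n) κ ν * mu (iota n) κ ν' := by
  refine mackey (iota n) (iota (n + 1)) (iota_inj _) (iota_inj _) (ss n) (ss_mul n) (ss_comm n)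
    (ss_in n) (ss_out n) ?_ hν hν'
  rw [perm_card, perm_card, perm_card, Nat.factorial_succ (n + 1), Nat.factorial_succ n]
  ring

lemma tower_mackey0 {ν ν' : Perm (Fin 0) → ℂ} (hν : ν ∈ irr (Perm (Fin 0)))
    (hν' : ν' ∈ irr (Perm (Fin 0))) :
    ∑ χ ∈ irr (Perm (Fin 1)), mu (iota 0) ν χ * mu (iota 0) ν' χ = if ν = ν' then 1 else 0 := by
  refine mack0 (iota 0) ⟨iota_inj 0, fun g => ?_⟩ hν hν'
  obtain ⟨k, hk⟩ := iota_range (show g 0 = 0 from Fin.fin_one_eq_zero _)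
  exact ⟨k, hk.symm⟩

lemma mult_one (n : ℕ) {ν : Perm (Fin n) → ℂ} {χ : Perm (Fin (n + 1)) → ℂ}
    (hν : ν ∈ irr (Perm (Fin n))) (hχ : χ ∈ irr (Perm (Fin (n + 1)))) :
    mu (iota n) ν χ = if mu (iota n) ν χ ≠ 0 then 1 else 0 := by
  obtain ⟨m, hm⟩ := mu_nat (iota n) hν (isCh_irr hχ)
  have h1 : m ≤ 1 := by
    refine gelfand (iota n) (fun g => ?_) hχ hν hm
    obtain ⟨t, ht, h⟩ := perm_rev g 0 0
    have h0 : t 0 = 0 := by rcases h with h | h <;> exact h.1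
    obtain ⟨k, rfl⟩ := iota_range h0
    exact ⟨k, ht⟩
  rw [hm]
  interval_cases m <;> simp

lemma mult_two (n : ℕ) {ν : Perm (Fin n) → ℂ} {χ : Perm (Fin (n + 2)) → ℂ}
    (hν : ν ∈ irr (Perm (Fin n))) (hχ : χ ∈ irr (Perm (Fin (n + 2)))) {m : ℕ}
    (hm : mu ((iota (n + 1)).comp (iota n)) ν χ = m) : m ≤ 2 := by
  have key : ∀ t : Perm (Fin (n + 2)), t 0 = 0 → t 1 = 1 →
      ∃ k, t = ((iota (n + 1)).comp (iota n)) k := by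
    intro t h0 h1
    obtain ⟨k, rfl⟩ := iota_range h0
    have : k 0 = 0 := by
      rw [← Fin.succ_zero_eq_one, iota_succ] at h1
      exact Fin.succ_injective _ h1
    obtain ⟨l, rfl⟩ := iota_range this
    exact ⟨l, rfl⟩
  refine mu_le_two _ (ss n) (ss_mul n) (fun k => ss_comm n k) (fun g => ?_) hν hχ hm
  obtain ⟨t, ht, h | h⟩ := perm_rev g 0 1
  · obtain ⟨k, hk⟩ := key t h.1 h.2
    exact ⟨k, Or.inl (by rw [← hk]; exact ht)⟩
  · obtain ⟨k, hk⟩ := key (t * ss n) (by rw [Perm.mul_apply, ss_zero, h.2])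
      (by rw [Perm.mul_apply, ss_one, h.1])
    refine ⟨k, Or.inr ?_⟩
    rw [← hk, mul_assoc t, ss_mul, mul_one]
    exact ht

end CT

set_option linter.unusedSectionVars false
namespace CT
open Equiv

/-- irreducible characters of the symmetric group as a type -/
abbrev II (n : ℕ) : Type := {χ : Perm (Fin n) → ℂ // χ ∈ irr (Perm (Fin n))}
/-- all irreducible characters of all symmetric groups -/
abbrev PP : Type := Σ n, II n

/-- branching relation -/
def rel {n : ℕ} (ν : II n) (χ : II (n + 1)) : Prop := mu (iota n) ν.1 χ.1 ≠ 0

/-- upper covers -/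
noncomputable def UU (x : PP) : Finset PP :=
  (Finset.univ.filter (rel x.2)).map (Function.Embedding.sigmaMk (β := II) (x.1 + 1))

/-- lower covers -/
noncomputable def DD : PP → Finset PP
  | ⟨0, _⟩ => ∅
  | ⟨n + 1, χ⟩ =>
    (Finset.univ.filter (fun ν => rel ν χ)).map (Function.Embedding.sigmaMk (β := II) n)

/-- rank -/
def rkk (x : PP) : ℕ := x.1
/-- degree -/
noncomputable def ff (x : PP) : ℕ := deg x.2.1

lemma mem_UU {x y : PP} : y ∈ UU x ↔ ∃ χ : II (x.1 + 1), rel x.2 χ ∧ ⟨x.1 + 1, χ⟩ = y := by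
  simp [UU]

lemma mem_DD {n : ℕ} {χ : II (n + 1)} {y : PP} :
    y ∈ DD ⟨n + 1, χ⟩ ↔ ∃ ν : II n, rel ν χ ∧ ⟨n, ν⟩ = y := by
  simp [DD]

lemma mem_iff (x y : PP) : x ∈ DD y ↔ y ∈ UU x := by
  rw [mem_UU]
  rcases y with ⟨_ | m, χ⟩
  · constructor
    · intro h; simp [DD] at h
    · rintro ⟨χ', _, h⟩
      exact absurd (congrArg Sigma.fst h) (Nat.succ_ne_zero _)
  · rw [mem_DD]
    constructor
    · rintro ⟨ν, h, rfl⟩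
      exact ⟨χ, h, rfl⟩
    · rcases x with ⟨n, ν⟩
      rintro ⟨χ', h, e⟩
      cases e
      exact ⟨ν, h, rfl⟩

lemma rk_iff {x y : PP} (h : x ∈ DD y) : rkk y = rkk x + 1 := by
  rw [mem_iff, mem_UU] at h
  obtain ⟨χ, _, rfl⟩ := h
  rfl

lemma sum01 {α : Type} [Fintype α] (a b : α → ℂ) (ha : ∀ x, a x = if a x ≠ 0 then 1 else 0)
    (hb : ∀ x, b x = if b x ≠ 0 then 1 else 0) :
    ∑ x, a x * b x = ((Finset.univ.filter (fun x => a x ≠ 0) ∩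
      Finset.univ.filter (fun x => b x ≠ 0)).card : ℂ) := by
  rw [← Finset.filter_and, ← Finset.sum_boole]
  refine Finset.sum_congr rfl fun x _ => ?_
  rw [ha x, hb x]
  by_cases h1 : a x = 0 <;> by_cases h2 : b x = 0 <;> simp [h1, h2]

lemma irr_sum (n : ℕ) (F : (Perm (Fin n) → ℂ) → ℂ) :
    ∑ χ ∈ irr (Perm (Fin n)), F χ = ∑ χ : II n, F χ.1 := by
  exact (Finset.sum_coe_sort _ _).symm

lemma card_up [DecidableEq PP] {n : ℕ} (ν ν' : II n) :
    ((UU ⟨n, ν⟩ ∩ UU ⟨n, ν'⟩).card : ℂ) =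
      ∑ χ ∈ irr (Perm (Fin (n + 1))), mu (iota n) ν.1 χ * mu (iota n) ν'.1 χ := by
  rw [irr_sum, sum01 _ _ (fun χ => mult_one n ν.2 χ.2) (fun χ => mult_one n ν'.2 χ.2), UU, UU,
    ← Finset.map_inter, Finset.card_map]
  exact congrArg (fun s : Finset (II _) => (s.card : ℂ)) (Finset.ext fun a => by
    simp only [Finset.mem_inter, Finset.mem_filter, Finset.mem_univ, true_and]; exact Iff.rfl)

lemma card_down [DecidableEq PP] {n : ℕ} (χ χ' : II (n + 1)) :
    ((DD ⟨n + 1, χ⟩ ∩ DD ⟨n + 1, χ'⟩).card : ℂ) =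
      ∑ ν ∈ irr (Perm (Fin n)), mu (iota n) ν χ.1 * mu (iota n) ν χ'.1 := by
  rw [irr_sum, sum01 _ _ (fun ν => mult_one n ν.2 χ.2) (fun ν => mult_one n ν.2 χ'.2), DD, DD,
    ← Finset.map_inter, Finset.card_map]
  exact congrArg (fun s : Finset (II _) => (s.card : ℂ)) (Finset.ext fun a => by
    simp only [Finset.mem_inter, Finset.mem_filter, Finset.mem_univ, true_and]; exact Iff.rfl)

lemma card_ud [DecidableEq PP] {n : ℕ} (x y : II n) :
    (UU ⟨n, x⟩ ∩ UU ⟨n, y⟩).card = (if x = y then 1 else 0) +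
      (DD ⟨n, x⟩ ∩ DD ⟨n, y⟩).card := by
  have : ((UU ⟨n, x⟩ ∩ UU ⟨n, y⟩).card : ℂ) = (if x.1 = y.1 then 1 else 0) +
      ((DD ⟨n, x⟩ ∩ DD ⟨n, y⟩).card : ℂ) := by
    rcases n with _ | n
    · rw [card_up, tower_mackey0 x.2 y.2]; simp [DD]
    · rw [card_up, tower_mackey n x.2 y.2, card_down]
  simp only [← Subtype.ext_iff] at this
  by_cases h : x = y
  · rw [if_pos h] at this ⊢; exact_mod_cast this
  · rw [if_neg h] at this ⊢; exact_mod_cast this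

lemma ax_com [DecidableEq PP] (x y : PP) (h : x ≠ y) :
    (UU x ∩ UU y).card = (DD x ∩ DD y).card := by
  revert x y
  rintro ⟨n, x⟩ ⟨m, y⟩ h
  by_cases e : n = m
  · subst e
    have hne : x ≠ y := fun e => h (by rw [e])
    have := card_ud x y
    rw [if_neg hne] at this
    omega
  · have h1 : UU ⟨n, x⟩ ∩ UU ⟨m, y⟩ = ∅ := by
      refine Finset.eq_empty_of_forall_notMem fun z hz => e ?_
      rw [Finset.mem_inter, ← mem_iff, ← mem_iff] at hz
      have h1 := rk_iff hz.1
      have h2 := rk_iff hz.2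
      simp only [rkk] at h1 h2
      omega
    have h2 : DD ⟨n, x⟩ ∩ DD ⟨m, y⟩ = ∅ := by
      refine Finset.eq_empty_of_forall_notMem fun z hz => e ?_
      rw [Finset.mem_inter] at hz
      have h1 := rk_iff hz.1
      have h2 := rk_iff hz.2
      simp only [rkk] at h1 h2
      omega
    rw [h1, h2]

lemma ax_thin [DecidableEq PP] (x z : PP) : (UU x ∩ DD z).card ≤ 2 := by
  revert x z
  rintro ⟨n, x⟩ ⟨m, z⟩
  by_cases e : m = n + 2
  · subst e
    have h1 : ((UU ⟨n, x⟩ ∩ DD ⟨n + 2, z⟩).card : ℂ) =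
        mu ((iota (n + 1)).comp (iota n)) x.1 z.1 := by
      rw [← mu_comp _ _ (isCh_irr z.2), irr_sum,
        sum01 _ _ (fun χ => mult_one n x.2 χ.2) (fun χ => mult_one (n + 1) χ.2 z.2), UU, DD,
        ← Finset.map_inter, Finset.card_map]
      exact congrArg (fun s : Finset (II _) => (s.card : ℂ)) (Finset.ext fun a => by
    simp only [Finset.mem_inter, Finset.mem_filter, Finset.mem_univ, true_and]; exact Iff.rfl)
    exact mult_two n x.2 z.2 h1.symm
  · have h1 : UU ⟨n, x⟩ ∩ DD ⟨m, z⟩ = ∅ := by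
      refine Finset.eq_empty_of_forall_notMem fun w hw => e ?_
      rw [Finset.mem_inter, ← mem_iff] at hw
      have h1 := rk_iff hw.1
      have h2 := rk_iff hw.2
      simp only [rkk] at h1 h2
      omega
    rw [h1]; simp

theorem ax : TD.Ax DD UU rkk where
  mem := mem_iff
  rk := rk_iff
  hU := by
    rintro ⟨n, x⟩
    have := card_ud x x
    rw [Finset.inter_self, Finset.inter_self, if_pos rfl] at this
    omega
  com := @ax_com (fun a b => Classical.propDecidable (a = b))
  thin := @ax_thin (fun a b => Classical.propDecidable (a = b))

theorem dg : TD.Dg DD UU rkk ff where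
  pos x := deg_pos x.2.2
  down := by
    rintro ⟨_ | n, χ⟩ h
    · exact absurd h (lt_irrefl 0)
    have h1 := down_sum (iota n) (isCh_irr χ.2)
    rw [deg_spec (isCh_irr χ.2), irr_sum] at h1
    have h2 : ∀ ν : II n, mu (iota n) ν.1 χ.1 * ν.1 1 =
        if rel ν χ then (deg ν.1 : ℂ) else 0 := by
      intro ν
      rw [mult_one n ν.2 χ.2, deg_spec (isCh_irr ν.2)]
      unfold rel
      split_ifs <;> simp
    rw [Finset.sum_congr rfl (fun ν _ => h2 ν), ← Finset.sum_filter] at h1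
    rw [DD, Finset.sum_map]
    exact_mod_cast h1
  up := by
    rintro ⟨n, ν⟩
    have h1 := up_sum (iota n) (iota_inj n) ν.1
    rw [deg_spec (isCh_irr ν.2), irr_sum] at h1
    have h2 : ∀ χ : II (n + 1), mu (iota n) ν.1 χ.1 * χ.1 1 =
        if rel ν χ then (deg χ.1 : ℂ) else 0 := by
      intro χ
      rw [mult_one n ν.2 χ.2, deg_spec (isCh_irr χ.2)]
      unfold rel
      split_ifs <;> simp
    rw [Finset.sum_congr rfl (fun ν _ => h2 ν), ← Finset.sum_filter] at h1
    have h3 : ((Fintype.card (Perm (Fin n)) : ℂ))⁻¹ * Fintype.card (Perm (Fin (n + 1))) =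
        ((n + 1 : ℕ) : ℂ) := by
      have h4 : (n.factorial : ℂ) ≠ 0 := by exact_mod_cast n.factorial_ne_zero
      rw [perm_card, perm_card, Nat.factorial_succ]
      push_cast
      field_simp
    rw [h3] at h1
    rw [UU, Finset.sum_map]
    exact_mod_cast h1.symm

section
variable {α : Type} [Fintype α] [DecidableEq α]
/-- the sign character -/
noncomputable def sg (α : Type) [Fintype α] [DecidableEq α] : Perm α →* ℂ :=
  ((Int.castRingHom ℂ : ℤ →+* ℂ) : ℤ →* ℂ).comp ((Units.coeHom ℤ).comp Perm.sign)

lemma sg_apply (g : Perm α) : sg α g = ((Perm.sign g : ℤ) : ℂ) := rfl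
lemma sg_sq (g : Perm α) : sg α g * sg α g = 1 := by
  rw [sg_apply]
  rcases Int.units_eq_one_or (Perm.sign g) with h | h <;> simp [h]
lemma sg_inv (g : Perm α) : sg α g⁻¹ = sg α g := by
  rw [sg_apply, sg_apply, Perm.sign_inv]

/-- twist by sign -/
noncomputable def tw (χ : Perm α → ℂ) : Perm α → ℂ := fun g => χ g * sg α g

lemma tw_tw (χ : Perm α → ℂ) : tw (tw χ) = χ := by
  funext g
  rw [tw, tw, mul_assoc, sg_sq, mul_one]
lemma tw_ip (χ ψ : Perm α → ℂ) : ip (tw χ) (tw ψ) = ip χ ψ := by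
  unfold ip tw
  congr 1
  refine Finset.sum_congr rfl fun g _ => ?_
  rw [sg_inv]
  linear_combination (χ g * ψ g⁻¹) * sg_sq g
lemma tw_irr {χ : Perm α → ℂ} (h : χ ∈ irr (Perm α)) : tw χ ∈ irr (Perm α) := by
  rw [mem_irr']
  exact ⟨(isCh_irr h).mul (isCh_lin (sg α)), by rw [tw_ip]; exact (mem_irr'.1 h).2⟩
lemma tw_deg (χ : Perm α → ℂ) : deg (tw χ) = deg χ := by simp [deg, tw]
end

/-- twist on the poset -/
noncomputable def tt (x : PP) : PP := ⟨x.1, ⟨tw x.2.1, tw_irr x.2.2⟩⟩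

lemma tt_tt (x : PP) : tt (tt x) = x := by
  rcases x with ⟨n, χ, h⟩
  have : (⟨tw (tw χ), tw_irr (tw_irr h)⟩ : II n) = ⟨χ, h⟩ := Subtype.ext (tw_tw χ)
  exact congrArg (Sigma.mk n) this

lemma mu_tw {n : ℕ} (ν : Perm (Fin n) → ℂ) (χ : Perm (Fin (n + 1)) → ℂ) :
    mu (iota n) (tw ν) (tw χ) = mu (iota n) ν χ := by
  rw [mu, mu, ← tw_ip (fun k => χ (iota n k))]
  congr 1
  funext k
  simp only [tw, sg_apply, iota_sign]

lemma tt_up {x y : PP} (h : x ∈ UU y) : tt x ∈ UU (tt y) := by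
  rw [mem_UU] at h ⊢
  obtain ⟨χ, h, rfl⟩ := h
  refine ⟨⟨tw χ.1, tw_irr χ.2⟩, ?_, rfl⟩
  have := mu_tw y.2.1 χ.1
  unfold rel at h ⊢
  change mu (iota y.1) (tw y.2.1) (tw χ.1) ≠ 0
  rw [this]; exact h

theorem tau : TD.Tau DD UU rkk tt where
  inv := tt_tt
  mapD h := by
    rw [mem_iff] at h ⊢
    exact tt_up h
  mapU := tt_up
  two := by
    rintro ⟨n, χ⟩ h e
    have e' : n = 2 := e
    subst e'
    have h0 : tw χ.1 = χ.1 := by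
      have h' := eq_of_heq (Sigma.mk.inj h).2
      exact congrArg Subtype.val h'
    have h1 : χ.1 (swap 0 1) = 0 := by
      have := congrFun h0 (swap 0 1)
      simp only [tw, sg_apply] at this
      rw [Perm.sign_swap (by decide)] at this
      have h2 : -χ.1 (swap 0 1) = χ.1 (swap 0 1) := by simpa using this
      exact self_eq_neg.1 h2.symm
    have h2 := (mem_irr'.1 χ.2).2
    have hu : (Finset.univ : Finset (Perm (Fin 2))) = {1, swap 0 1} := by decide
    rw [ip, hu, Finset.sum_pair (by decide), h1, perm_card, inv_one, deg_spec (isCh_irr χ.2)] at h2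
    have h3 : (deg χ.1 : ℂ) * deg χ.1 = 2 := by
      simp only [zero_mul, add_zero, Nat.factorial_two] at h2
      push_cast at h2
      linear_combination 2 * h2
    have h4 : deg χ.1 * deg χ.1 = 2 := by exact_mod_cast h3
    have h5 : deg χ.1 < 2 := by nlinarith
    interval_cases (deg χ.1) <;> omega
  ne := by
    intro x hx
    by_contra hn
    rw [Finset.not_nonempty_iff_eq_empty] at hn
    have := dg.down x hx
    rw [hn, Finset.sum_empty] at this
    exact absurd this (dg.pos x).ne'

end CT

set_option linter.unusedSectionVars false
namespace CT
open Equiv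

section General
variable {G K : Type} [Group G] [Fintype G] [Group K] [Fintype K]

/-- natural multiplicity -/
noncomputable def mm (i : K →* G) (ν : K → ℂ) (χ : G → ℂ) : ℕ := ⌊(mu i ν χ).re⌋₊

lemma mm_spec (i : K →* G) {ν : K → ℂ} {χ : G → ℂ} (hν : ν ∈ irr K) (hχ : χ ∈ irr G) :
    mu i ν χ = mm i ν χ := by
  obtain ⟨m, hm⟩ := mu_nat i hν (isCh_irr hχ)
  rw [mm, hm]; simp

lemma mm_down (i : K →* G) {χ : G → ℂ} (hχ : χ ∈ irr G) :
    deg χ = ∑ ν ∈ irr K, mm i ν χ * deg ν := by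
  have h := down_sum i (isCh_irr hχ)
  rw [deg_spec (isCh_irr hχ), Finset.sum_congr rfl (fun ν hν => by
    rw [mm_spec i hν hχ, deg_spec (isCh_irr hν)])] at h
  exact_mod_cast h

lemma mm_up (i : K →* G) (hi : Function.Injective i) {c : ℕ}
    (hc : Fintype.card G = c * Fintype.card K) {ν : K → ℂ} (hν : ν ∈ irr K) :
    ∑ χ ∈ irr G, mm i ν χ * deg χ = c * deg ν := by
  have h := up_sum i hi ν
  rw [deg_spec (isCh_irr hν), Finset.sum_congr rfl (fun χ hχ => by
    rw [mm_spec i hν hχ, deg_spec (isCh_irr hχ)]), hc] at h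
  have hk := card_ne (G := K)
  have h2 : (Fintype.card K : ℂ)⁻¹ * ((c * Fintype.card K : ℕ) : ℂ) = c := by
    push_cast; field_simp
  rw [h2] at h
  exact_mod_cast h

lemma one_irr (G : Type) [Group G] [Fintype G] : (fun _ : G => (1 : ℂ)) ∈ irr G := by
  rw [mem_irr']
  refine ⟨isCh_lin (1 : G →* ℂ), ?_⟩
  have := card_ne (G := G)
  simp [ip, this]

lemma one_deg (G : Type) [Group G] : deg (fun _ : G => (1 : ℂ)) = 1 := by
  simp [deg]

lemma degset (G : Type) [Group G] [Fintype G] :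
    {d : ℕ | ∃ V : FDRep ℂ G, CategoryTheory.Simple V ∧ Module.finrank ℂ V = d} =
      ((irr G).image deg : Finset ℕ) := by
  ext d
  simp only [Set.mem_ofPred_eq, Finset.coe_image, Set.mem_image, Finset.mem_coe, mem_irr]
  constructor
  · rintro ⟨V, hV, rfl⟩
    refine ⟨V.character, ⟨V, hV, rfl⟩, ?_⟩
    rw [deg, FDRep.char_one]; simp
  · rintro ⟨χ, ⟨V, hV, rfl⟩, rfl⟩
    refine ⟨V, hV, ?_⟩
    rw [deg, FDRep.char_one]; simp

lemma deg_le_max {χ : G → ℂ} (h : χ ∈ irr G) : deg χ ≤ maxIrrDeg G := by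
  rw [maxIrrDeg, degset]
  refine le_csSup (Finset.bddAbove _) ?_
  exact Finset.mem_coe.2 (Finset.mem_image_of_mem _ h)

lemma exists_max (G : Type) [Group G] [Fintype G] : ∃ χ ∈ irr G, deg χ = maxIrrDeg G := by
  have h : maxIrrDeg G ∈ ((irr G).image deg : Finset ℕ) := by
    rw [maxIrrDeg, degset, ← Finset.mem_coe]
    exact Nat.sSup_mem ⟨1, Finset.mem_coe.2 (Finset.mem_image.2 ⟨_, one_irr G, one_deg G⟩)⟩
      (Finset.bddAbove _)
  exact Finset.mem_image.1 h

lemma max_pos (G : Type) [Group G] [Fintype G] : 0 < maxIrrDeg G := by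
  obtain ⟨χ, h, e⟩ := exists_max G
  rw [← e]; exact deg_pos h

lemma epsG_eq (G : Type) [Group G] [Fintype G] : epsG G =
    ((∑ χ ∈ (irr G).filter (fun χ => deg χ < maxIrrDeg G), deg χ ^ 2 : ℕ) : ℝ) /
      (maxIrrDeg G : ℝ) ^ 2 := by
  have hre : ∀ χ ∈ irr G, (χ 1).re = (deg χ : ℝ) := by
    intro χ hχ
    rw [deg_spec (isCh_irr hχ)]; simp
  have hset : {f ∈ IrrChar G | (f 1).re < (maxIrrDeg G : ℝ)} =
      (((irr G).filter (fun χ => deg χ < maxIrrDeg G) : Finset (G → ℂ)) : Set (G → ℂ)) := by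
    ext χ
    simp only [Set.mem_ofPred_eq, Finset.coe_filter, ← mem_irr]
    constructor
    · rintro ⟨h, h'⟩
      rw [hre χ h] at h'
      exact ⟨h, by exact_mod_cast h'⟩
    · rintro ⟨h, h'⟩
      rw [hre χ h]
      exact ⟨h, by exact_mod_cast h'⟩
  rw [epsG, hset, finsum_mem_coe_finset]
  congr 1
  push_cast
  refine Finset.sum_congr rfl fun χ hχ => ?_
  rw [hre χ (Finset.mem_filter.1 hχ).1]

lemma eps_pos (hmax : 1 < maxIrrDeg G) : 0 < epsG G := by
  rw [epsG_eq]
  have hb := max_pos G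
  refine div_pos ?_ (by positivity)
  have : 0 < ∑ χ ∈ (irr G).filter (fun χ => deg χ < maxIrrDeg G), deg χ ^ 2 := by
    refine Finset.sum_pos (fun χ hχ => ?_) ⟨fun _ => 1, Finset.mem_filter.2 ⟨one_irr G, ?_⟩⟩
    · have := deg_pos (Finset.mem_filter.1 hχ).1
      positivity
    · rw [one_deg]; exact hmax
  exact_mod_cast this

lemma lin_of_deg {χ : G → ℂ} (h : χ ∈ irr G) (h1 : deg χ = 1) (x : G) : χ x⁻¹ * χ x = 1 := by
  have h2 := deg_spec (isCh_irr h)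
  obtain ⟨V, _, _, _, ρ, rfl⟩ := (isCh_irr h).rep
  rw [h1] at h2
  have h3 : Module.finrank ℂ V = 1 := by
    have : LinearMap.trace ℂ V (ρ 1) = Module.finrank ℂ V := by simp
    have h4 : LinearMap.trace ℂ V (ρ 1) = ((1 : ℕ) : ℂ) := h2
    rw [this] at h4
    exact_mod_cast h4
  obtain ⟨c, hc, _⟩ := LinearMap.existsUnique_eq_smul_id_of_finrank_eq_one h3 (ρ x)
  obtain ⟨d, hd, _⟩ := LinearMap.existsUnique_eq_smul_id_of_finrank_eq_one h3 (ρ x⁻¹)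
  have hm : ρ x⁻¹ * ρ x = 1 := by rw [← map_mul]; simp
  have ht : ∀ e : ℂ, LinearMap.trace ℂ V (e • LinearMap.id) = e := by
    intro e; rw [map_smul, LinearMap.trace_id, h3]; simp
  have hm2 : d * c = 1 := by
    have : LinearMap.trace ℂ V (ρ x⁻¹ * ρ x) = LinearMap.trace ℂ V ((d * c) • LinearMap.id) := by
      rw [hc, hd]
      congr 1
      ext v
      simp [mul_smul, smul_comm c d]
    rw [ht, hm] at this
    rw [← this, LinearMap.trace_one, h3]; simp
  simp only [hc, hd, ht, hm2]

lemma comm_of_max (h : maxIrrDeg G ≤ 1) (x g : G) : g * x * g⁻¹ = x := by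
  have h1 : ∀ χ ∈ irr G, deg χ = 1 := fun χ hχ =>
    le_antisymm ((deg_le_max hχ).trans h) (deg_pos hχ)
  have hx := column x x
  have h0 := column (1 : G) 1
  rw [Finset.sum_congr rfl (fun χ hχ => lin_of_deg hχ (h1 χ hχ) _)] at hx h0
  rw [hx] at h0
  have h2 : (Finset.univ.filter (fun g : G => g * x * g⁻¹ = x)).card = Fintype.card G := by
    have : (Finset.univ.filter (fun g : G => g * x * g⁻¹ = x)).card =
      (Finset.univ.filter (fun g : G => g * 1 * g⁻¹ = 1)).card := by exact_mod_cast h0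
    rw [this]; simp
  have h3 := Finset.eq_univ_of_card _ h2
  have h4 := Finset.mem_univ g
  rw [← h3] at h4
  exact (Finset.mem_filter.1 h4).2

end General

lemma max_alt {n : ℕ} (hn : 4 ≤ n) : 1 < maxIrrDeg (alternatingGroup (Fin n)) := by
  by_contra h
  have hc := comm_of_max (G := alternatingGroup (Fin n)) (by omega)
  have h4 : 4 ≤ Nat.card (Fin n) := by simpa using hn
  have hb := alternatingGroup.center_eq_bot h4
  have ht : Subgroup.center (alternatingGroup (Fin n)) = ⊤ := by
    rw [eq_top_iff]
    intro x _
    rw [Subgroup.mem_center_iff]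
    intro g
    exact mul_inv_eq_iff_eq_mul.1 (hc x g)
  obtain ⟨m, rfl⟩ := Nat.exists_eq_add_of_le hn
  have : Nontrivial (alternatingGroup (Fin (4 + m))) := by
    rw [show 4 + m = (m + 1) + 3 by ring]; infer_instance
  exact bot_ne_top (hb.symm.trans ht)

end CT

set_option linter.unusedSectionVars false
namespace CT
open Equiv

/-- inclusion of the alternating group -/
def inc (n : ℕ) : alternatingGroup (Fin n) →* Perm (Fin n) := (alternatingGroup (Fin n)).subtype

lemma inc_inj (n : ℕ) : Function.Injective (inc n) := Subtype.val_injective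

lemma card_alt {n : ℕ} (hn : 2 ≤ n) :
    Fintype.card (Perm (Fin n)) = 2 * Fintype.card (alternatingGroup (Fin n)) := by
  have : Nontrivial (Fin n) := Fin.nontrivial_iff_two_le.2 hn
  exact two_mul_card_alternatingGroup.symm

lemma sum_alt {n : ℕ} (F : Perm (Fin n) → ℂ) :
    ∑ a, F (inc n a) = ∑ g, if g ∈ alternatingGroup (Fin n) then F g else 0 := by
  rw [← Finset.sum_filter]
  exact (Finset.sum_subtype _ (by simp) _).symm

lemma res_ip {n : ℕ} (hn : 2 ≤ n) (χ ψ : Perm (Fin n) → ℂ) :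
    ip (fun a => χ (inc n a)) (fun a => ψ (inc n a)) = ip χ ψ + ip (tw χ) ψ := by
  have hA := card_ne (G := alternatingGroup (Fin n))
  have h1 : ∑ g, χ g * ψ g⁻¹ + ∑ g, tw χ g * ψ g⁻¹ =
      2 * ∑ a, χ (inc n a) * ψ (inc n a)⁻¹ := by
    rw [sum_alt (fun g => χ g * ψ g⁻¹), Finset.mul_sum, ← Finset.sum_add_distrib]
    refine Finset.sum_congr rfl fun g _ => ?_
    rw [tw, sg_apply, Perm.mem_alternatingGroup]
    rcases Int.units_eq_one_or (Perm.sign g) with h | h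
    · rw [if_pos h, h]; simp; ring
    · rw [if_neg (by rw [h]; decide), h]; simp
  rw [ip, ip, ip, ← mul_add, h1, card_alt hn]
  push_cast
  simp only [map_inv]
  field_simp

lemma mm_sq {n : ℕ} (hn : 2 ≤ n) {χ : Perm (Fin n) → ℂ} (hχ : χ ∈ irr (Perm (Fin n))) :
    ∑ ν ∈ irr (alternatingGroup (Fin n)), mm (inc n) ν χ ^ 2 = if tw χ = χ then 2 else 1 := by
  have h1 := parseval ((isCh_irr hχ).comp (inc n)).cl (fun a => χ (inc n a))
  have h2 := res_ip hn χ χ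
  rw [h1, orth' hχ hχ, orth' (tw_irr hχ) hχ, if_pos rfl] at h2
  have h3 : ∑ ν ∈ irr (alternatingGroup (Fin n)), ((mm (inc n) ν χ : ℕ) : ℂ) ^ 2 =
      1 + if tw χ = χ then 1 else 0 := by
    rw [← h2]
    refine Finset.sum_congr rfl fun ν hν => ?_
    rw [← mm_spec (inc n) hν hχ, sq]; rfl
  split_ifs at h3 ⊢
  · have : (1 : ℂ) + 1 = 2 := by norm_num
    rw [this] at h3
    exact_mod_cast h3
  · rw [add_zero] at h3
    exact_mod_cast h3

lemma nonfixed {n : ℕ} (hn : 2 ≤ n) {χ : Perm (Fin n) → ℂ} (hχ : χ ∈ irr (Perm (Fin n)))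
    (h : tw χ ≠ χ) : deg χ ≤ maxIrrDeg (alternatingGroup (Fin n)) := by
  have h2 := res_ip hn χ χ
  rw [orth' hχ hχ, orth' (tw_irr hχ) hχ, if_pos rfl, if_neg h, add_zero] at h2
  have h3 : (fun a => χ (inc n a)) ∈ irr (alternatingGroup (Fin n)) :=
    mem_irr'.2 ⟨(isCh_irr hχ).comp (inc n), h2⟩
  have := deg_le_max h3
  simpa [deg] using this

lemma under_le {n : ℕ} (hn : 2 ≤ n) {χ : Perm (Fin n) → ℂ} (hχ : χ ∈ irr (Perm (Fin n)))
    {ν : alternatingGroup (Fin n) → ℂ} (hν : ν ∈ irr (alternatingGroup (Fin n))) :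
    mm (inc n) ν χ * deg χ ≤ 2 * deg ν := by
  rw [← mm_up (inc n) (inc_inj n) (card_alt hn) hν]
  exact Finset.single_le_sum (f := fun χ => mm (inc n) ν χ * deg χ) (fun _ _ => Nat.zero_le _) hχ

lemma fixed {n : ℕ} (hn : 2 ≤ n) {χ : Perm (Fin n) → ℂ} (hχ : χ ∈ irr (Perm (Fin n)))
    (h : tw χ = χ) : ∃ ν ∈ irr (alternatingGroup (Fin n)), deg χ = 2 * deg ν := by
  have hs := mm_sq hn hχ
  rw [if_pos h] at hs
  have h1 : ∀ ν ∈ irr (alternatingGroup (Fin n)), mm (inc n) ν χ ≤ 1 := by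
    intro ν hν
    have := Finset.single_le_sum (f := fun ν => mm (inc n) ν χ ^ 2) (fun _ _ => Nat.zero_le _) hν
    rw [hs] at this
    nlinarith
  have h2 : ∑ ν ∈ irr (alternatingGroup (Fin n)), mm (inc n) ν χ = 2 := by
    rw [← hs]
    refine Finset.sum_congr rfl fun ν hν => ?_
    have := h1 ν hν
    interval_cases (mm (inc n) ν χ) <;> rfl
  have h3 : ∀ ν ∈ irr (alternatingGroup (Fin n)),
      mm (inc n) ν χ * deg χ ≤ mm (inc n) ν χ * (2 * deg ν) := by
    intro ν hν
    have := under_le hn hχ hν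
    have h4 := h1 ν hν
    interval_cases (mm (inc n) ν χ) <;> omega
  have h4 : ∑ ν ∈ irr (alternatingGroup (Fin n)), mm (inc n) ν χ * deg χ =
      ∑ ν ∈ irr (alternatingGroup (Fin n)), mm (inc n) ν χ * (2 * deg ν) := by
    rw [← Finset.sum_mul, h2]
    conv_lhs => rw [mm_down (inc n) hχ, Finset.mul_sum]
    exact Finset.sum_congr rfl fun ν _ => by ring
  rw [Finset.sum_eq_sum_iff_of_le h3] at h4
  obtain ⟨ν, hν, hne⟩ := Finset.exists_ne_zero_of_sum_ne_zero (by rw [h2]; norm_num)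
  exact ⟨ν, hν, Nat.eq_of_mul_eq_mul_left (Nat.pos_of_ne_zero hne) (h4 ν hν)⟩

/-- sum of squares of small degrees -/
noncomputable def SS (n : ℕ) : ℕ :=
  ∑ ν ∈ (irr (alternatingGroup (Fin n))).filter
    (fun ν => deg ν < maxIrrDeg (alternatingGroup (Fin n))), deg ν ^ 2

lemma sum_le {n : ℕ} (hn : 2 ≤ n) :
    ∑ χ ∈ (irr (Perm (Fin n))).filter (fun χ => deg χ < maxIrrDeg (alternatingGroup (Fin n))),
      deg χ ^ 2 ≤ 2 * SS n := by
  set b := maxIrrDeg (alternatingGroup (Fin n)) with hb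
  have h1 : ∀ χ ∈ (irr (Perm (Fin n))).filter (fun χ => deg χ < b), deg χ ^ 2 =
      ∑ ν ∈ (irr (alternatingGroup (Fin n))).filter (fun ν => deg ν < b),
        deg ν * (mm (inc n) ν χ * deg χ) := by
    intro χ hχ
    obtain ⟨hχ, hlt⟩ := Finset.mem_filter.1 hχ
    have hd := mm_down (inc n) hχ
    rw [Finset.sum_filter_of_ne]
    · rw [sq]
      conv_lhs => rw [hd, Finset.sum_mul]
      refine Finset.sum_congr rfl fun ν _ => ?_
      rw [← hd]; ring
    · intro ν hν hne
      have h5 : mm (inc n) ν χ ≠ 0 := by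
        intro h0; rw [h0] at hne; simp at hne
      have h6 := Finset.single_le_sum (f := fun ν => mm (inc n) ν χ * deg ν)
        (fun _ _ => Nat.zero_le _) hν
      rw [← hd] at h6
      have h7 : deg ν ≤ mm (inc n) ν χ * deg ν := Nat.le_mul_of_pos_left _ (Nat.pos_of_ne_zero h5)
      omega
  rw [Finset.sum_congr rfl h1, Finset.sum_comm, SS, Finset.mul_sum]
  refine Finset.sum_le_sum fun ν hν => ?_
  rw [← Finset.mul_sum]
  have h8 := mm_up (inc n) (inc_inj n) (card_alt hn) (Finset.mem_filter.1 hν).1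
  have h9 : ∑ χ ∈ (irr (Perm (Fin n))).filter (fun χ => deg χ < b), mm (inc n) ν χ * deg χ ≤
      ∑ χ ∈ irr (Perm (Fin n)), mm (inc n) ν χ * deg χ :=
    Finset.sum_le_sum_of_subset (Finset.filter_subset _ _)
  rw [h8] at h9
  nlinarith

lemma big {n : ℕ} (hn : 200 ≤ n) : maxIrrDeg (alternatingGroup (Fin n)) ^ 2 ≤ 128 * SS n := by
  have hn2 : 2 ≤ n := by omega
  set b := maxIrrDeg (alternatingGroup (Fin n)) with hb
  by_cases hc : ∃ χ ∈ irr (Perm (Fin n)), tw χ = χ ∧ b ≤ deg χ ∧ deg χ ≠ 2 * b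
  · obtain ⟨χ, hχ, hf, h1, h2⟩ := hc
    obtain ⟨ν, hν, hd⟩ := fixed hn2 hχ hf
    have hle := deg_le_max hν
    rw [← hb] at hle
    have hlt : deg ν < b := by omega
    have : deg ν ^ 2 ≤ SS n :=
      Finset.single_le_sum (f := fun ν : alternatingGroup (Fin n) → ℂ => deg ν ^ 2)
        (fun _ _ => Nat.zero_le _) (Finset.mem_filter.2 ⟨hν, hlt⟩)
    have h3 : b ≤ 2 * deg ν := by omega
    nlinarith
  · push Not at hc
    let La : Finset PP :=
      (Finset.univ : Finset (II n)).map (Function.Embedding.sigmaMk (β := II) n)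
    have hLa : ∀ x, x ∈ La ↔ rkk x = n := by
      rintro ⟨m, χ⟩
      constructor
      · intro h
        obtain ⟨a, _, e⟩ := Finset.mem_map.1 h
        exact (congrArg Sigma.fst e).symm
      · intro h
        have h' : m = n := h
        subst h'
        exact Finset.mem_map.2 ⟨χ, Finset.mem_univ _, rfl⟩
    have htt : ∀ χ : II n, tt ⟨n, χ⟩ = ⟨n, χ⟩ ↔ tw χ.1 = χ.1 := by
      intro χ
      constructor
      · intro h
        exact congrArg Subtype.val (eq_of_heq (Sigma.mk.inj h).2)
      · intro h
        have : (⟨tw χ.1, tw_irr χ.2⟩ : II n) = χ := Subtype.ext h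
        exact congrArg (Sigma.mk n) this
    have hmain := TD.main (b := b) ax tau dg hn (max_pos _) La hLa ?_ ?_ ?_
    · refine hmain.trans ?_
      have hs : ∑ x ∈ La.filter (fun x => ff x < b), ff x ^ 2 =
          ∑ χ ∈ (irr (Perm (Fin n))).filter (fun χ => deg χ < b), deg χ ^ 2 := by
        rw [Finset.sum_filter, Finset.sum_filter, Finset.sum_map]
        exact Finset.sum_coe_sort (irr (Perm (Fin n)))
          (fun χ => if deg χ < b then deg χ ^ 2 else 0)
      rw [hs]
      have := sum_le hn2
      rw [← hb] at this
      omega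
    · intro x hx h
      obtain ⟨χ, _, rfl⟩ := Finset.mem_map.1 hx
      exact nonfixed hn2 χ.2 (fun e => h ((htt χ).2 e))
    · intro x hx h
      obtain ⟨χ, _, rfl⟩ := Finset.mem_map.1 hx
      have hf := (htt χ).1 h
      by_cases hlt : deg χ.1 < b
      · exact Or.inl hlt
      · exact Or.inr (hc χ.1 χ.2 hf (not_lt.1 hlt))
    · obtain ⟨ν, hν, hd⟩ := exists_max (alternatingGroup (Fin n))
      have h8 := mm_up (inc n) (inc_inj n) (card_alt hn2) hν
      obtain ⟨χ, hχ, hne⟩ := Finset.exists_ne_zero_of_sum_ne_zero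
        (by rw [h8]; have := deg_pos hν; omega)
      refine ⟨⟨n, χ, hχ⟩, (hLa _).2 rfl, ?_⟩
      have h5 : mm (inc n) ν χ ≠ 0 := by
        intro h0; rw [h0] at hne; simp at hne
      have h6 := Finset.single_le_sum (f := fun ν => mm (inc n) ν χ * deg ν)
        (fun _ _ => Nat.zero_le _) hν
      rw [← mm_down (inc n) hχ] at h6
      have h7 : deg ν ≤ mm (inc n) ν χ * deg ν := Nat.le_mul_of_pos_left _ (Nat.pos_of_ne_zero h5)
      change b ≤ deg χ
      omega

theorem final : ∃ ε : ℝ, 0 < ε ∧ ∀ n : ℕ, 5 ≤ n → ε ≤ epsG (alternatingGroup (Fin n)) := by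
  have hpos : ∀ n, 5 ≤ n → 0 < epsG (alternatingGroup (Fin n)) := fun n hn =>
    eps_pos (max_alt (by omega))
  obtain ⟨m, hm, hmin⟩ := Finset.exists_min_image (Finset.Icc 5 200)
    (fun n => epsG (alternatingGroup (Fin n))) ⟨5, by simp⟩
  refine ⟨min (1 / 128) (epsG (alternatingGroup (Fin m))), lt_min (by norm_num)
    (hpos m (Finset.mem_Icc.1 hm).1), fun n hn => ?_⟩
  by_cases h : n ≤ 200
  · exact (min_le_right _ _).trans (hmin n (Finset.mem_Icc.2 ⟨hn, h⟩))
  · refine (min_le_left _ _).trans ?_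
    have hb := big (n := n) (by omega)
    have hp := max_pos (alternatingGroup (Fin n))
    have hp' : (0 : ℝ) < (maxIrrDeg (alternatingGroup (Fin n)) : ℝ) ^ 2 := by positivity
    rw [epsG_eq, le_div_iff₀ hp']
    have hb' : (maxIrrDeg (alternatingGroup (Fin n)) : ℝ) ^ 2 ≤ 128 * (SS n : ℝ) := by
      exact_mod_cast hb
    change _ ≤ (SS n : ℝ)
    linarith

end CT

theorem stmt2 :
    ∃ ε : ℝ, 0 < ε ∧
      ∀ n : ℕ, 5 ≤ n → ε ≤ epsG (alternatingGroup (Fin n)) := by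
  exact CT.final
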